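/- Let 0 < θ < 1/2 and let a < b, c < d be real numbers. Then as T → ∞, (1/T)·meas{ t ∈ [T,2T] : log ζ(σ_T + it)/√(π ψ_T) ∈ [a,b] × [c,d] } = ∫_c^d ∫_a^b e^{−π(x²+y²)} dx dy + O(1/(log log T)^{3/2}), where a complex number lies in [a,b] × [c,d] if its real part is in [a,b] and its imaginary part is in [c,d]. -/

import Mathlib

open scoped Real Classical
open Filter Asymptotics

noncomputable section

/-- `σ_T = 1/2 + (log T)^{-θ}`. -/
def sigmaT (θ T : ℝ) : ℝ := 1 / 2 + Real.log T ^ (-θ)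

/-- `ψ_T = ∑_p ∑_{k ≥ 1} (1/k²) p^{-2kσ_T}`, the outer sum over all primes. -/
def psiT (θ T : ℝ) : ℝ :=
  ∑' p : Nat.Primes, ∑' k : ℕ,
    (1 / ((k : ℝ) + 1) ^ 2) * (p : ℝ) ^ (-(2 : ℝ) * ((k : ℝ) + 1) * sigmaT θ T)

/-- `logZetaRay σ t z` says that `z` is the value at `σ + it` of the branch of `log ζ`
obtained by continuous variation along the horizontal ray `{σ' + it : σ' ≥ σ}`,
normalized so that `log ζ(σ' + it) → 0` as `σ' → ∞` (in particular `ζ` is nonvanishing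
on the ray). -/
def logZetaRay (σ t : ℝ) (z : ℂ) : Prop :=
  ∃ g : ℝ → ℂ, ContinuousOn g (Set.Ici σ) ∧
    (∀ σ' ∈ Set.Ici σ, Complex.exp (g σ') = riemannZeta (σ' + t * Complex.I)) ∧
    Tendsto g atTop (nhds 0) ∧ g σ = z

/-- Abel's inequality for antitone nonnegative weights. -/
lemma norm_sum_smul_le_of_antitone {E : Type*} [NormedAddCommGroup E] [NormedSpace ℝ E]
    {v : ℕ → E} {r : ℕ → ℝ} {B : ℝ} (hr : Antitone r) (hr0 : ∀ i, 0 ≤ r i)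
    (hv : ∀ k, ‖∑ i ∈ Finset.range k, v i‖ ≤ B) (n : ℕ) :
    ‖∑ i ∈ Finset.range n, r i • v i‖ ≤ B * r 0 := by
  have hB : 0 ≤ B := by simpa using hv 0
  rcases n with _ | n
  · simpa using mul_nonneg hB (hr0 0)
  rw [Finset.sum_range_by_parts]
  have h2 : ‖∑ i ∈ Finset.range n, (r (i + 1) - r i) • ∑ j ∈ Finset.range (i + 1), v j‖
      ≤ ∑ i ∈ Finset.range n, (r i - r (i + 1)) * B := by
    refine norm_sum_le_of_le _ fun i _ => ?_
    rw [norm_smul, Real.norm_eq_abs, abs_sub_comm,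
      abs_of_nonneg (sub_nonneg.2 (hr (Nat.le_succ i)))]
    exact mul_le_mul_of_nonneg_left (hv _) (sub_nonneg.2 (hr (Nat.le_succ i)))
  rw [← Finset.sum_mul, Finset.sum_range_sub'] at h2
  have h1 : ‖r n • ∑ i ∈ Finset.range (n + 1), v i‖ ≤ r n * B := by
    rw [norm_smul, Real.norm_of_nonneg (hr0 n)]
    exact mul_le_mul_of_nonneg_left (hv _) (hr0 n)
  refine (norm_sub_le _ _).trans ?_
  simp only [Nat.add_sub_cancel]
  linarith

/-- The function `cot x - 1 / x`, written without division by the tangent. -/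
def cotSubInv (x : ℝ) : ℝ := Real.cos x / Real.sin x - 1 / x

lemma cotSubInv_antitoneOn : AntitoneOn cotSubInv (Set.Ioc 0 1) := by
  have hsin : ∀ x ∈ Set.Ioc (0 : ℝ) 1, 0 < Real.sin x := fun x hx =>
    Real.sin_pos_of_pos_of_le_one hx.1 hx.2
  have hd : ∀ x ∈ Set.Ioc (0 : ℝ) 1, HasDerivAt cotSubInv
      (((-Real.sin x) * Real.sin x - Real.cos x * Real.cos x) / Real.sin x ^ 2
        - (0 * x - 1 * 1) / x ^ 2) x := fun x hx =>
    ((Real.hasDerivAt_cos x).div (Real.hasDerivAt_sin x) (hsin x hx).ne').sub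
      ((hasDerivAt_const x (1 : ℝ)).div (hasDerivAt_id x) hx.1.ne')
  refine antitoneOn_of_deriv_nonpos (convex_Ioc 0 1)
    (fun x hx => (hd x hx).continuousAt.continuousWithinAt)
    (fun x hx => (hd x (interior_subset hx)).differentiableAt.differentiableWithinAt) ?_
  intro x hx
  replace hx := interior_subset hx
  rw [(hd x hx).deriv]
  have h1 : (-Real.sin x) * Real.sin x - Real.cos x * Real.cos x = -1 := by
    nlinarith [Real.sin_sq_add_cos_sq x]
  rw [h1]
  have h2 : (1 : ℝ) / x ^ 2 ≤ 1 / Real.sin x ^ 2 :=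
    one_div_le_one_div_of_le (pow_pos (hsin x hx) 2)
      (pow_le_pow_left₀ (hsin x hx).le (Real.sin_le hx.1.le) 2)
  have e1 : (-1 : ℝ) / Real.sin x ^ 2 = -(1 / Real.sin x ^ 2) := by ring
  have e2 : (0 * x - 1 * 1) / x ^ 2 = -(1 / x ^ 2) := by ring
  rw [e1, e2]; linarith

lemma cotSubInv_nonpos {x : ℝ} (hx : x ∈ Set.Ioc (0 : ℝ) 1) : cotSubInv x ≤ 0 := by
  have hs := Real.sin_pos_of_pos_of_le_one hx.1 hx.2
  have hc : 0 < Real.cos x := Real.cos_pos_of_le_one (by rw [abs_of_pos hx.1]; exact hx.2)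
  have h := (Real.lt_tan hx.1 (by linarith [hx.2, Real.pi_gt_three])).le
  rw [Real.tan_eq_sin_div_cos, le_div_iff₀ hc] at h
  rw [cotSubInv, sub_nonpos, div_le_div_iff₀ hs hx.1]
  linarith

lemma neg_one_le_cotSubInv {x : ℝ} (hx : x ∈ Set.Ioc (0 : ℝ) 1) : -1 ≤ cotSubInv x := by
  have hs := Real.sin_pos_of_pos_of_le_one hx.1 hx.2
  have hc := Real.one_sub_sq_div_two_le_cos (x := x)
  have h : 1 / x - 1 ≤ Real.cos x / Real.sin x := by
    rw [le_div_iff₀ hs]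
    have h1 : (1 / x - 1) * Real.sin x ≤ (1 / x - 1) * x :=
      mul_le_mul_of_nonneg_left (Real.sin_le hx.1.le) (by
        rw [sub_nonneg, le_div_iff₀ hx.1]; linarith [hx.2])
    have h2 : (1 / x - 1) * x = 1 - x := by field_simp [hx.1.ne']
    nlinarith [hx.1, hx.2]
  rw [cotSubInv]; linarith

/-- `x ^ (-s)` for real `x`. -/
def realCpowNeg (s : ℂ) (x : ℝ) : ℂ := Complex.exp (-s * (Real.log x : ℂ))

lemma norm_realCpowNeg (s : ℂ) (x : ℝ) :
    ‖realCpowNeg s x‖ = Real.exp (-s.re * Real.log x) := by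
  rw [realCpowNeg, Complex.norm_exp]; simp

lemma norm_realCpowNeg_mul_I (t x : ℝ) : ‖realCpowNeg (t * Complex.I) x‖ = 1 := by
  rw [norm_realCpowNeg]; simp

lemma norm_exp_mul_I_sub_le (a b : ℝ) :
    ‖Complex.exp (a * Complex.I) - Complex.exp (b * Complex.I)‖ ≤ |a - b| := by
  have h : Complex.exp (a * Complex.I) - Complex.exp (b * Complex.I)
      = Complex.exp (b * Complex.I) * (Complex.exp (Complex.I * ((a - b : ℝ) : ℂ)) - 1) := by
    rw [mul_sub, ← Complex.exp_add]; push_cast; ring_nf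
  rw [h, norm_mul, Complex.norm_exp_ofReal_mul_I, one_mul]
  exact Real.norm_exp_I_mul_ofReal_sub_one_le

lemma exp_sub_eq_cotSubInv {x : ℝ} (hx : x ∈ Set.Ioc (0 : ℝ) 1) :
    1 - (1 - Complex.exp (-2 * x * Complex.I)) * (-Complex.I / (2 * x))
      = (1 - Complex.exp (-2 * x * Complex.I)) * (1 / 2 - Complex.I / 2 * cotSubInv x) := by
  have hs := (Real.sin_pos_of_pos_of_le_one hx.1 hx.2).ne'
  have hs' : (Real.sin x : ℂ) ≠ 0 := by exact_mod_cast hs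
  have hx' : (x : ℂ) ≠ 0 := by exact_mod_cast hx.1.ne'
  have he : Complex.exp (-2 * x * Complex.I) =
      (Real.cos x - Real.sin x * Complex.I) ^ 2 := by
    rw [show (-2 * x * Complex.I : ℂ) = (-x : ℂ) * Complex.I + (-x : ℂ) * Complex.I by ring,
      Complex.exp_add, Complex.exp_mul_I, Complex.cos_neg, Complex.sin_neg]
    push_cast; ring
  have hsc : (Real.sin x : ℂ) ^ 2 + (Real.cos x : ℂ) ^ 2 = 1 := by
    exact_mod_cast Real.sin_sq_add_cos_sq x
  have h1 : 1 - Complex.exp (-2 * x * Complex.I)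
      = 2 * Real.sin x * (Real.sin x + Real.cos x * Complex.I) := by
    rw [he]
    linear_combination (-1 : ℂ) * hsc - (Real.sin x : ℂ) ^ 2 * Complex.I_sq
  rw [h1, cotSubInv]
  push_cast
  rw [Complex.ofReal_sin, Complex.ofReal_cos] at hsc
  rw [Complex.ofReal_sin] at hs'
  field_simp
  ring_nf
  simp only [Complex.I_sq]
  linear_combination (-(x : ℂ)) * hsc

lemma realCpowNeg_mul_I_eq (t x : ℝ) :
    realCpowNeg (t * Complex.I) x = Complex.exp ((-(t * Real.log x) : ℝ) * Complex.I) := by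
  rw [realCpowNeg]; congr 1; push_cast; ring

lemma log_add_sub_linear_mem {x v : ℝ} (hx : 0 < x) (hv0 : 0 ≤ v) (hv1 : v ≤ 1) :
    |Real.log (x + v) - (Real.log x + v * (Real.log (x + 1) - Real.log x))|
      ≤ 1 / x - 1 / (x + 1) := by
  have hx1 : 0 < x + 1 := by linarith
  have hxv : 0 < x + v := by linarith
  have hlow : Real.log x + v * (Real.log (x + 1) - Real.log x) ≤ Real.log (x + v) := by
    have h := strictConcaveOn_log_Ioi.concaveOn.2 (Set.mem_Ioi.2 hx) (Set.mem_Ioi.2 hx1)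
      (sub_nonneg.2 hv1) hv0 (by ring)
    simp only [smul_eq_mul] at h
    rw [show (1 - v) * x + v * (x + 1) = x + v by ring] at h
    linarith
  have hup : Real.log (x + v) - Real.log x ≤ v / x := by
    rw [← Real.log_div hxv.ne' hx.ne']
    refine (Real.log_le_sub_one_of_pos (div_pos hxv hx)).trans (le_of_eq ?_)
    field_simp; ring
  have hlo1 : 1 / (x + 1) ≤ Real.log (x + 1) - Real.log x := by
    rw [← Real.log_div hx1.ne' hx.ne']
    refine le_trans (le_of_eq ?_) (Real.one_sub_inv_le_log_of_pos (div_pos hx1 hx))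
    field_simp; ring
  have hgap : 1 / (x + 1) ≤ 1 / x := one_div_le_one_div_of_le hx (by linarith)
  rw [abs_of_nonneg (by linarith)]
  have h1 : v * (1 / (x + 1)) ≤ v * (Real.log (x + 1) - Real.log x) :=
    mul_le_mul_of_nonneg_left hlo1 hv0
  have h2 : v * (1 / x - 1 / (x + 1)) ≤ 1 * (1 / x - 1 / (x + 1)) :=
    mul_le_mul_of_nonneg_right hv1 (by linarith)
  have h3 : v / x = v * (1 / x) := by ring
  nlinarith

/-- Half the phase advance of `x ^ (-it)` over one unit step. -/
def halfPhase (t x : ℝ) : ℝ := t / 2 * (Real.log (x + 1) - Real.log x)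

lemma halfPhase_pos {t x : ℝ} (ht : 0 < t) (hx : 0 < x) : 0 < halfPhase t x :=
  mul_pos (by linarith) (sub_pos.2 (Real.log_lt_log hx (by linarith)))

lemma halfPhase_le_one {t x : ℝ} (ht : 0 < t) (hx : 0 < x) (htx : t ≤ x) :
    halfPhase t x ≤ 1 := by
  have h : Real.log (x + 1) - Real.log x ≤ 1 / x := by
    rw [← Real.log_div (by linarith) hx.ne']
    refine (Real.log_le_sub_one_of_pos (by positivity)).trans (le_of_eq ?_)
    field_simp; ring
  have h2 : t / 2 * (1 / x) ≤ 1 := by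
    rw [mul_one_div, div_le_one hx]; linarith
  exact (mul_le_mul_of_nonneg_left h (by linarith)).trans h2

lemma halfPhase_antitoneOn {t : ℝ} (ht : 0 < t) : AntitoneOn (halfPhase t) (Set.Ioi 0) := by
  intro x hx y hy hxy
  have hx : 0 < x := hx
  have hy : 0 < y := hy
  refine mul_le_mul_of_nonneg_left ?_ (by linarith)
  rw [← Real.log_div (by linarith) hx.ne', ← Real.log_div (by linarith) hy.ne']
  refine Real.log_le_log (by positivity) ?_
  rw [div_le_div_iff₀ hy hx]; nlinarith

lemma realCpowNeg_mul_I_succ {t x : ℝ} :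
    realCpowNeg (t * Complex.I) (x + 1)
      = realCpowNeg (t * Complex.I) x * Complex.exp (-2 * halfPhase t x * Complex.I) := by
  rw [realCpowNeg, realCpowNeg, ← Complex.exp_add, halfPhase]; congr 1; push_cast; ring

lemma intervalIntegrable_realCpowNeg (s : ℂ) {a b : ℝ} (ha : 0 < a) (hb : 0 < b) :
    IntervalIntegrable (realCpowNeg s) MeasureTheory.volume a b := by
  refine ContinuousOn.intervalIntegrable ?_
  refine Complex.continuous_exp.comp_continuousOn ?_
  refine continuousOn_const.mul (Complex.continuous_ofReal.comp_continuousOn ?_)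
  refine Real.continuousOn_log.mono fun x hx => ?_
  have : 0 < x := lt_of_lt_of_le (lt_min ha hb) hx.1
  exact this.ne'

lemma norm_linear_sub_integral_le {t x : ℝ} (ht : 0 < t) (hx : 0 < x) :
    ‖(realCpowNeg (t * Complex.I) x - realCpowNeg (t * Complex.I) (x + 1))
        * (-Complex.I / (2 * halfPhase t x))
      - ∫ y in x..x + 1, realCpowNeg (t * Complex.I) y‖ ≤ t * (1 / x - 1 / (x + 1)) := by
  have hφ : (halfPhase t x : ℂ) ≠ 0 := by exact_mod_cast (halfPhase_pos ht hx).ne'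
  have hlin : (realCpowNeg (t * Complex.I) x - realCpowNeg (t * Complex.I) (x + 1))
        * (-Complex.I / (2 * halfPhase t x))
      = ∫ v in (0 : ℝ)..1, realCpowNeg (t * Complex.I) x
          * Complex.exp ((-2 * halfPhase t x * Complex.I) * v) := by
    rw [intervalIntegral.integral_const_mul,
      integral_exp_mul_complex (by simp [hφ, Complex.I_ne_zero]), realCpowNeg_mul_I_succ]
    have hI : Complex.I * Complex.I = -1 := Complex.I_mul_I
    simp only [Complex.ofReal_one, mul_one, Complex.ofReal_zero, mul_zero, Complex.exp_zero]
    generalize Complex.exp (-2 * (halfPhase t x : ℂ) * Complex.I) = e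
    have hI' := Complex.I_ne_zero
    field_simp
    linear_combination (-(realCpowNeg (t * Complex.I) x * (1 - e))) * hI
  have hint : ∫ y in x..x + 1, realCpowNeg (t * Complex.I) y
      = ∫ v in (0 : ℝ)..1, realCpowNeg (t * Complex.I) (x + v) := by
    rw [intervalIntegral.integral_comp_add_left]; simp
  have hcont : Continuous fun v : ℝ => realCpowNeg (t * Complex.I) x
      * Complex.exp ((-2 * halfPhase t x * Complex.I) * v) := by fun_prop
  rw [hlin, hint, ← intervalIntegral.integral_sub (hcont.intervalIntegrable _ _) (by
    have := (intervalIntegrable_realCpowNeg (t * Complex.I) hx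
      (by linarith : 0 < x + 1)).comp_add_left x
    simpa using this)]
  refine (intervalIntegral.norm_integral_le_of_norm_le_const (C := t * (1 / x - 1 / (x + 1)))
    ?_).trans (by simp)
  intro v hv
  rw [Set.uIoc_of_le zero_le_one] at hv
  have e1 : realCpowNeg (t * Complex.I) x * Complex.exp ((-2 * halfPhase t x * Complex.I) * v)
      = Complex.exp ((-(t * (Real.log x + v * (Real.log (x + 1) - Real.log x))) : ℝ)
          * Complex.I) := by
    rw [realCpowNeg, ← Complex.exp_add, halfPhase]; congr 1; push_cast; ring
  rw [e1, realCpowNeg_mul_I_eq]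
  refine (norm_exp_mul_I_sub_le _ _).trans ?_
  rw [neg_sub_neg, ← mul_sub, abs_mul, abs_of_pos ht]
  exact mul_le_mul_of_nonneg_left (log_add_sub_linear_mem hx hv.1.le hv.2) ht.le

lemma norm_sum_sub_integral_le {t a : ℝ} (ht : 0 < t) (ha : 0 < a) (hta : t ≤ a) (k : ℕ) :
    ‖∑ i ∈ Finset.range k, (realCpowNeg (t * Complex.I) (a + i)
      - ∫ y in (a + i)..(a + i) + 1, realCpowNeg (t * Complex.I) y)‖ ≤ 3 := by
  set u : ℕ → ℂ := fun i => realCpowNeg (t * Complex.I) (a + i) with hu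
  have hai : ∀ i : ℕ, 0 < a + i := fun i => by positivity
  have hxm : ∀ i : ℕ, halfPhase t (a + i) ∈ Set.Ioc (0 : ℝ) 1 := fun i =>
    ⟨halfPhase_pos ht (hai i), halfPhase_le_one ht (hai i)
      (hta.trans (le_add_of_nonneg_right (Nat.cast_nonneg i)))⟩
  have husucc : ∀ i : ℕ, u (i + 1) = realCpowNeg (t * Complex.I) (a + i + 1) := fun i => by
    simp only [hu]; push_cast; rw [add_assoc]
  have hun : ∀ i, ‖u i‖ = 1 := fun i => norm_realCpowNeg_mul_I _ _
  have hpart : ∀ m, ‖∑ i ∈ Finset.range m, (u i - u (i + 1))‖ ≤ 2 := fun m => by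
    rw [Finset.sum_range_sub']
    refine (norm_sub_le _ _).trans ?_
    rw [hun, hun]; norm_num
  have hdecomp : ∀ i : ℕ, u i - ∫ y in (a + i)..(a + i) + 1, realCpowNeg (t * Complex.I) y
      = ((u i - u (i + 1)) * (1 / 2)
          + (Complex.I / 2) * ((-cotSubInv (halfPhase t (a + i))) • (u i - u (i + 1))))
        + ((realCpowNeg (t * Complex.I) (a + i) - realCpowNeg (t * Complex.I) (a + i + 1))
            * (-Complex.I / (2 * halfPhase t (a + i)))
          - ∫ y in (a + i)..(a + i) + 1, realCpowNeg (t * Complex.I) y) := fun i => by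
    have h := exp_sub_eq_cotSubInv (hxm i)
    rw [husucc, realCpowNeg_mul_I_succ]
    change realCpowNeg (t * Complex.I) (a + i) - _ = _
    rw [Complex.real_smul]
    simp only [hu]
    push_cast
    linear_combination (realCpowNeg (t * Complex.I) (a + i)) * h
  rw [Finset.sum_congr rfl fun i _ => hdecomp i, Finset.sum_add_distrib,
    Finset.sum_add_distrib, ← Finset.sum_mul, ← Finset.mul_sum]
  have hanti : Antitone fun i : ℕ => -cotSubInv (halfPhase t (a + i)) := by
    intro i j hij
    simp only [neg_le_neg_iff]
    refine cotSubInv_antitoneOn (hxm j) (hxm i) (halfPhase_antitoneOn ht (hai i) (hai j) ?_)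
    have : (i : ℝ) ≤ j := by exact_mod_cast hij
    linarith
  have h1 : ‖(∑ i ∈ Finset.range k, (u i - u (i + 1))) * (1 / 2)‖ ≤ 1 := by
    have h12 : ‖(1 / 2 : ℂ)‖ = 1 / 2 := by norm_num
    rw [norm_mul, h12]
    linarith [hpart k]
  have h2 : ‖(Complex.I / 2) * ∑ i ∈ Finset.range k,
      (-cotSubInv (halfPhase t (a + i))) • (u i - u (i + 1))‖ ≤ 1 := by
    have h := norm_sum_smul_le_of_antitone hanti
      (fun i => neg_nonneg.2 (cotSubInv_nonpos (hxm i))) hpart k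
    have h' := neg_one_le_cotSubInv (hxm 0)
    have h12 : ‖(Complex.I / 2 : ℂ)‖ = 1 / 2 := by norm_num
    rw [norm_mul, h12]
    linarith
  have h3 : ‖∑ i ∈ Finset.range k, ((realCpowNeg (t * Complex.I) (a + i)
      - realCpowNeg (t * Complex.I) (a + i + 1)) * (-Complex.I / (2 * halfPhase t (a + i)))
      - ∫ y in (a + i)..(a + i) + 1, realCpowNeg (t * Complex.I) y)‖ ≤ 1 := by
    refine (norm_sum_le_of_le _ fun i _ => norm_linear_sub_integral_le ht (hai i)).trans ?_
    have e : ∀ i : ℕ, t * (1 / (a + i) - 1 / (a + i + 1))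
        = (fun j : ℕ => t / (a + j)) i - (fun j : ℕ => t / (a + j)) (i + 1) := fun i => by
      simp only; push_cast; rw [← add_assoc]; ring
    rw [Finset.sum_congr rfl fun i _ => e i, Finset.sum_range_sub']
    have p1 : 0 ≤ t / (a + k) := div_nonneg ht.le (hai k).le
    have p2 : t / (a + (0 : ℕ)) ≤ 1 := by
      rw [Nat.cast_zero, add_zero]; exact (div_le_one ha).2 hta
    linarith
  refine (norm_add_le _ _).trans ?_
  refine (add_le_add (norm_add_le _ _) le_rfl).trans ?_
  linarith

/-- The defect `x ^ (-s) - ∫ y in x..x + 1, y ^ (-s)`. -/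
def zetaDefect (s : ℂ) (x : ℝ) : ℂ := realCpowNeg s x - ∫ y in x..x + 1, realCpowNeg s y

lemma realCpowNeg_add (s w : ℂ) (x : ℝ) :
    realCpowNeg (s + w) x = realCpowNeg s x * realCpowNeg w x := by
  rw [realCpowNeg, realCpowNeg, realCpowNeg, ← Complex.exp_add]; congr 1; ring

lemma realCpowNeg_ofReal (σ x : ℝ) :
    realCpowNeg σ x = ((Real.exp (-σ * Real.log x) : ℝ) : ℂ) := by
  rw [realCpowNeg]; push_cast; rfl

lemma norm_sum_zetaDefect_le {σ t a : ℝ} (hσ : 0 < σ) (ht : 0 < t) (ha : 0 < a) (hta : t ≤ a)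
    (k : ℕ) :
    ‖∑ i ∈ Finset.range k, zetaDefect (σ + t * Complex.I) (a + i)‖
      ≤ 4 * Real.exp (-σ * Real.log a) := by
  have hai : ∀ i : ℕ, 0 < a + i := fun i => by positivity
  set r : ℝ → ℝ := fun x => Real.exp (-σ * Real.log x) with hr
  have hr_anti : ∀ x y, 0 < x → x ≤ y → r y ≤ r x := fun x y hx hxy => by
    refine Real.exp_le_exp.2 ?_
    nlinarith [Real.log_le_log hx hxy]
  have hdec : ∀ x : ℝ, 0 < x → zetaDefect (σ + t * Complex.I) x
      = r x • (realCpowNeg (t * Complex.I) x - ∫ y in x..x + 1, realCpowNeg (t * Complex.I) y)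
        + ∫ y in x..x + 1, ((r x - r y : ℝ) : ℂ) * realCpowNeg (t * Complex.I) y := by
    intro x hx
    have hi1 := intervalIntegrable_realCpowNeg (t * Complex.I) hx (by linarith : 0 < x + 1)
    have hi2 := intervalIntegrable_realCpowNeg (σ + t * Complex.I) hx (by linarith : 0 < x + 1)
    have e : ∫ y in x..x + 1, ((r x - r y : ℝ) : ℂ) * realCpowNeg (t * Complex.I) y
        = (r x : ℂ) * (∫ y in x..x + 1, realCpowNeg (t * Complex.I) y)
          - ∫ y in x..x + 1, realCpowNeg (σ + t * Complex.I) y := by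
      rw [← intervalIntegral.integral_const_mul, ← intervalIntegral.integral_sub
        (hi1.const_mul _) hi2]
      refine intervalIntegral.integral_congr fun y _ => ?_
      simp only [realCpowNeg_add, realCpowNeg_ofReal, Complex.ofReal_sub, sub_mul, hr]
    rw [e, zetaDefect, realCpowNeg_add, realCpowNeg_ofReal, Complex.real_smul]
    ring
  have hbound : ∀ x : ℝ, 0 < x →
      ‖∫ y in x..x + 1, ((r x - r y : ℝ) : ℂ) * realCpowNeg (t * Complex.I) y‖
        ≤ r x - r (x + 1) := by
    intro x hx
    refine (intervalIntegral.norm_integral_le_of_norm_le_const (C := r x - r (x + 1))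
      ?_).trans (by simp)
    intro y hy
    rw [Set.uIoc_of_le (by linarith)] at hy
    rw [norm_mul, norm_realCpowNeg_mul_I, mul_one, Complex.norm_real, Real.norm_eq_abs,
      abs_of_nonneg (sub_nonneg.2 (hr_anti _ _ hx hy.1.le))]
    linarith [hr_anti _ _ (hx.trans hy.1) hy.2]
  rw [Finset.sum_congr rfl fun i _ => hdec _ (hai i), Finset.sum_add_distrib]
  have h1 := norm_sum_smul_le_of_antitone (r := fun i : ℕ => r (a + i))
    (fun i j hij => hr_anti _ _ (hai i) (by
      have : (i : ℝ) ≤ j := by exact_mod_cast hij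
      linarith)) (fun i => (Real.exp_pos _).le) (norm_sum_sub_integral_le ht ha hta) k
  have h2 : ‖∑ i ∈ Finset.range k, ∫ y in (a + i)..(a + i) + 1,
      ((r (a + i) - r y : ℝ) : ℂ) * realCpowNeg (t * Complex.I) y‖ ≤ r a := by
    refine (norm_sum_le_of_le _ fun i _ => hbound _ (hai i)).trans ?_
    have e : ∀ i : ℕ, r (a + i) - r (a + i + 1)
        = (fun j : ℕ => r (a + j)) i - (fun j : ℕ => r (a + j)) (i + 1) := fun i => by
      simp only; push_cast; rw [← add_assoc]
    rw [Finset.sum_congr rfl fun i _ => e i, Finset.sum_range_sub']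
    have : 0 ≤ r (a + k) := (Real.exp_pos _).le
    simp only [Nat.cast_zero, add_zero]
    linarith
  refine (norm_add_le _ _).trans ?_
  simp only [Nat.cast_zero, add_zero] at h1
  linarith

lemma hasDerivAt_realCpowNeg (s : ℂ) {x : ℝ} (hx : 0 < x) :
    HasDerivAt (realCpowNeg s) (-s * realCpowNeg (s + 1) x) x := by
  have h := (((Real.hasDerivAt_log hx.ne').ofReal_comp).const_mul (-s)).cexp
  refine h.congr_deriv ?_
  rw [realCpowNeg_add, show realCpowNeg 1 x = ((x⁻¹ : ℝ) : ℂ) by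
    rw [← Complex.ofReal_one, realCpowNeg_ofReal, neg_one_mul, Real.exp_neg, Real.exp_log hx],
    realCpowNeg]
  ring

lemma integral_realCpowNeg {s : ℂ} (hs : s ≠ 1) {a b : ℝ} (ha : 0 < a) (hb : 0 < b) :
    ∫ y in a..b, realCpowNeg s y
      = (realCpowNeg (s - 1) a - realCpowNeg (s - 1) b) / (s - 1) := by
  have hs' : s - 1 ≠ 0 := sub_ne_zero.2 hs
  rw [intervalIntegral.integral_eq_sub_of_hasDerivAt
    (f := fun y => realCpowNeg (s - 1) y / (-(s - 1)))
    (fun y hy => ?_) (intervalIntegrable_realCpowNeg s ha hb)]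
  · field_simp; ring
  · have hy : 0 < y := lt_of_lt_of_le (lt_min ha hb) hy.1
    refine ((hasDerivAt_realCpowNeg (s - 1) hy).div_const _).congr_deriv ?_
    rw [sub_add_cancel]; field_simp

lemma norm_zetaDefect_le {s : ℂ} (hs : 0 < s.re) {x : ℝ} (hx : 0 < x) :
    ‖zetaDefect s x‖ ≤ ‖s‖ * Real.exp (-(s.re + 1) * Real.log x) := by
  have hi := intervalIntegrable_realCpowNeg s hx (by linarith : 0 < x + 1)
  have e : zetaDefect s x = ∫ y in x..x + 1, (realCpowNeg s x - realCpowNeg s y) := by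
    rw [intervalIntegral.integral_sub intervalIntegrable_const hi]
    simp [zetaDefect]
  rw [e]
  refine (intervalIntegral.norm_integral_le_of_norm_le_const
    (C := ‖s‖ * Real.exp (-(s.re + 1) * Real.log x)) ?_).trans (by simp)
  intro y hy
  rw [Set.uIoc_of_le (by linarith)] at hy
  rw [norm_sub_rev]
  have h := (convex_Ici x).norm_image_sub_le_of_norm_hasDerivWithin_le
    (f := realCpowNeg s) (C := ‖s‖ * Real.exp (-(s.re + 1) * Real.log x))
    (fun z hz => (hasDerivAt_realCpowNeg s (hx.trans_le (Set.mem_Ici.1 hz))).hasDerivWithinAt)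
    (fun z hz => by
      rw [norm_mul, norm_neg, norm_realCpowNeg]
      refine mul_le_mul_of_nonneg_left (Real.exp_le_exp.2 ?_) (norm_nonneg _)
      simp only [Complex.add_re, Complex.one_re]
      nlinarith [Real.log_le_log hx (Set.mem_Ici.1 hz)])
    (Set.mem_Ici.2 le_rfl) (Set.mem_Ici.2 hy.1.le)
  refine h.trans (mul_le_of_le_one_right (by positivity) ?_)
  rw [Real.norm_eq_abs, abs_of_pos (by linarith [hy.1])]
  linarith [hy.2]

lemma sum_zetaDefect {s : ℂ} (hs : s ≠ 1) {a : ℝ} (ha : 0 < a) (k : ℕ) :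
    ∑ i ∈ Finset.range k, zetaDefect s (a + i)
      = ∑ i ∈ Finset.range k, realCpowNeg s (a + i)
        - (realCpowNeg (s - 1) a - realCpowNeg (s - 1) (a + k)) / (s - 1) := by
  simp only [zetaDefect, Finset.sum_sub_distrib]
  congr 1
  have hint : ∀ i : ℕ, ∫ y in (a + i)..(a + i) + 1, realCpowNeg s y = (realCpowNeg (s - 1) (a + i)
      - realCpowNeg (s - 1) (a + i + 1)) / (s - 1) := fun i =>
    integral_realCpowNeg hs (by positivity) (by positivity)
  rw [Finset.sum_congr rfl fun i _ => hint i, ← Finset.sum_div]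
  congr 1
  have e : ∀ i : ℕ, realCpowNeg (s - 1) (a + i) - realCpowNeg (s - 1) (a + i + 1)
      = (fun j : ℕ => realCpowNeg (s - 1) (a + j)) i
        - (fun j : ℕ => realCpowNeg (s - 1) (a + j)) (i + 1) := fun i => by
    simp only; push_cast; rw [← add_assoc]
  rw [Finset.sum_congr rfl fun i _ => e i, Finset.sum_range_sub']
  simp

lemma natCast_cpow_neg (s : ℂ) {n : ℕ} (hn : n ≠ 0) : (n : ℂ) ^ (-s) = realCpowNeg s n := by
  rw [Complex.cpow_def_of_ne_zero (Nat.cast_ne_zero.2 hn), realCpowNeg, ← Complex.natCast_log,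
    mul_comm]

lemma summable_zetaDefect {s : ℂ} (hs : 0 < s.re) :
    Summable fun i : ℕ => zetaDefect s (1 + i) := by
  refine Summable.of_norm_bounded (g := fun i : ℕ => ‖s‖ * (((i + 1 : ℕ) : ℝ) ^ (s.re + 1))⁻¹)
    (((summable_nat_add_iff 1).2 (Real.summable_nat_rpow_inv.2 (by linarith))).mul_left _) ?_
  intro i
  refine (norm_zetaDefect_le hs (by positivity)).trans (le_of_eq ?_)
  rw [Real.rpow_def_of_pos (by positivity), ← Real.exp_neg]
  push_cast; ring_nf

lemma hasSum_zetaDefect_of_one_lt {s : ℂ} (hs : 1 < s.re) :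
    ∑' i : ℕ, zetaDefect s (1 + i) = riemannZeta s - 1 / (s - 1) := by
  have hs1 : s ≠ 1 := fun h => by simp [h] at hs
  refine HasSum.tsum_eq ((summable_zetaDefect (by linarith)).hasSum_iff_tendsto_nat.2 ?_)
  have hz : Tendsto (fun k => ∑ i ∈ Finset.range k, realCpowNeg s (1 + i)) atTop
      (nhds (riemannZeta s)) := by
    rw [zeta_eq_tsum_one_div_nat_add_one_cpow hs]
    have hsum : Summable fun n : ℕ => 1 / ((n : ℂ) + 1) ^ s := by
      have := (summable_nat_add_iff 1).2 (Complex.summable_one_div_nat_cpow.2 hs)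
      simpa using this
    refine hsum.hasSum.tendsto_sum_nat.congr fun k => Finset.sum_congr rfl fun i _ => ?_
    have h := natCast_cpow_neg s (Nat.succ_ne_zero i)
    push_cast at h
    rw [one_div, ← Complex.cpow_neg, h, add_comm]
  have hlim : Tendsto (fun k : ℕ => realCpowNeg (s - 1) (1 + k)) atTop (nhds 0) := by
    rw [tendsto_zero_iff_norm_tendsto_zero]
    simp only [norm_realCpowNeg]
    refine Real.tendsto_exp_atBot.comp ?_
    have h1 : -(s - 1).re < 0 := by simp only [Complex.sub_re, Complex.one_re]; linarith
    exact (Real.tendsto_log_atTop.comp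
      (tendsto_atTop_add_const_left _ _ tendsto_natCast_atTop_atTop)).const_mul_atTop_of_neg h1
  have h1 : realCpowNeg (s - 1) 1 = 1 := by simp [realCpowNeg]
  have := hz.sub ((hlim.const_sub (realCpowNeg (s - 1) 1)).div_const (s - 1))
  rw [h1, sub_zero] at this
  refine this.congr fun k => ?_
  rw [sum_zetaDefect hs1 one_pos, h1]

lemma tsum_zetaDefect {s : ℂ} (hs : 0 < s.re) (hs' : 0 < s.im) :
    ∑' i : ℕ, zetaDefect s (1 + i) = riemannZeta s - 1 / (s - 1) := by
  set ε := s.re / 2 with hε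
  set R := ‖s‖ + 3 with hR
  have hε0 : 0 < ε := by positivity
  set U : Set ℂ := ({z | ε < z.re} ∩ {z | 0 < z.im}) ∩ Metric.ball 0 R with hU
  have hUo : IsOpen U := ((isOpen_lt continuous_const Complex.continuous_re).inter
    (isOpen_lt continuous_const Complex.continuous_im)).inter Metric.isOpen_ball
  have hUc : IsPreconnected U := ((((convex_halfSpace_re_gt ε).inter
    (convex_halfSpace_im_gt 0)).inter (convex_ball 0 R))).isPreconnected
  have hne : ∀ z ∈ U, z ≠ 1 := fun z hz h => by
    have := hz.1.2; simp [h] at this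
  have hd1 : DifferentiableOn ℂ (fun z => ∑' i : ℕ, zetaDefect z (1 + i)) U := by
    refine Complex.differentiableOn_tsum_of_summable_norm
      (u := fun i : ℕ => R * (((i + 1 : ℕ) : ℝ) ^ (ε + 1))⁻¹)
      (((summable_nat_add_iff 1).2 (Real.summable_nat_rpow_inv.2 (by linarith))).mul_left _)
      (fun i => ?_) hUo (fun i z hz => ?_)
    · have hd : DifferentiableOn ℂ (fun z : ℂ => realCpowNeg z (1 + i)
          - (realCpowNeg (z - 1) (1 + i) - realCpowNeg (z - 1) (1 + i + 1)) / (z - 1)) U := by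
        unfold realCpowNeg
        refine DifferentiableOn.sub (by fun_prop) (DifferentiableOn.div (by fun_prop)
          (by fun_prop) fun z hz => sub_ne_zero.2 (hne z hz))
      refine hd.congr fun z hz => ?_
      rw [zetaDefect, integral_realCpowNeg (hne z hz) (by positivity) (by positivity)]
    · have hz1 : ε < z.re := hz.1.1
      refine (norm_zetaDefect_le (hε0.trans hz1) (by positivity)).trans ?_
      have hzR : ‖z‖ ≤ R := by
        have := hz.2; rw [mem_ball_zero_iff] at this; exact this.le
      rw [Real.rpow_def_of_pos (by positivity), ← Real.exp_neg]
      refine mul_le_mul hzR (Real.exp_le_exp.2 ?_) (Real.exp_pos _).le (by positivity)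
      have hl : 0 ≤ Real.log (1 + (i : ℝ)) := Real.log_nonneg (by simp)
      push_cast
      rw [add_comm (i : ℝ) 1]
      nlinarith
  have hd2 : DifferentiableOn ℂ (fun z => riemannZeta z - 1 / (z - 1)) U := fun z hz =>
    ((differentiableAt_riemannZeta (hne z hz)).sub ((differentiableAt_const _).div
      (differentiableAt_id.sub_const 1) (sub_ne_zero.2 (hne z hz)))).differentiableWithinAt
  have hz0 : (s + 2 : ℂ) ∈ U := by
    refine ⟨⟨?_, ?_⟩, ?_⟩
    · simp only [Set.mem_ofPred_eq, Complex.add_re, Complex.re_ofNat]; linarith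
    · simpa using hs'
    · rw [mem_ball_zero_iff]
      refine (norm_add_le _ _).trans_lt ?_
      norm_num [hR]
  have hsU : s ∈ U := ⟨⟨by simp only [Set.mem_ofPred_eq]; linarith, hs'⟩, by
    rw [mem_ball_zero_iff]; linarith⟩
  refine (hd1.analyticOnNhd hUo).eqOn_of_preconnected_of_eventuallyEq
    (hd2.analyticOnNhd hUo) hUc hz0 ?_ hsU
  filter_upwards [(isOpen_lt continuous_const Complex.continuous_re).mem_nhds
    (show (1 : ℝ) < (s + 2).re by simp only [Complex.add_re, Complex.re_ofNat]; linarith)]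
    with z hz
  exact hasSum_zetaDefect_of_one_lt hz

/-- Approximation of `ζ` by a Dirichlet polynomial of length at least the ordinate. -/
theorem norm_zeta_sub_sum_le {σ t : ℝ} (hσ : 0 < σ) (ht : 0 < t) {N : ℕ} (hN : t ≤ N) :
    ‖riemannZeta (σ + t * Complex.I)
        - ∑ n ∈ Finset.Ico 1 N, (n : ℂ) ^ (-(σ + t * Complex.I))‖
      ≤ Real.exp ((1 - σ) * Real.log N) / t + 4 * Real.exp (-σ * Real.log N) := by
  set s : ℂ := σ + t * Complex.I with hs
  have hsre : s.re = σ := by simp [hs]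
  have hsim : s.im = t := by simp [hs]
  have hs1 : s ≠ 1 := fun h => by rw [h] at hsim; simp at hsim; linarith
  have hN0 : 0 < (N : ℝ) := ht.trans_le hN
  have hNn : 1 ≤ N := by exact_mod_cast hN0
  have htend := (summable_zetaDefect (s := s) (by rw [hsre]; exact hσ)).hasSum.tendsto_sum_nat
  rw [tsum_zetaDefect (by rw [hsre]; exact hσ) (by rw [hsim]; exact ht)] at htend
  have hcast : (1 : ℝ) + ((N - 1 : ℕ) : ℝ) = N := by push_cast [Nat.cast_sub hNn]; ring
  have hsplit : ∀ k, ∑ i ∈ Finset.range (k + (N - 1)), zetaDefect s (1 + i)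
      = (∑ n ∈ Finset.Ico 1 N, (n : ℂ) ^ (-s) - (1 - realCpowNeg (s - 1) N) / (s - 1))
        + ∑ i ∈ Finset.range k, zetaDefect s (N + i) := fun k => by
    rw [add_comm k, Finset.sum_range_add, sum_zetaDefect hs1 one_pos, hcast]
    have h1 : realCpowNeg (s - 1) 1 = 1 := by simp [realCpowNeg]
    rw [h1]
    congr 1
    · congr 1
      rw [Finset.sum_Ico_eq_sum_range]
      refine Finset.sum_congr rfl fun i _ => ?_
      rw [natCast_cpow_neg s (by omega)]; push_cast; rfl
    · refine Finset.sum_congr rfl fun i _ => ?_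
      push_cast; rw [← hcast]; ring_nf
  have h2 := (htend.comp (tendsto_add_atTop_nat (N - 1))).sub_const
    (∑ n ∈ Finset.Ico 1 N, (n : ℂ) ^ (-s) - (1 - realCpowNeg (s - 1) N) / (s - 1))
  have h3 : ‖riemannZeta s - 1 / (s - 1)
      - (∑ n ∈ Finset.Ico 1 N, (n : ℂ) ^ (-s) - (1 - realCpowNeg (s - 1) N) / (s - 1))‖
      ≤ 4 * Real.exp (-σ * Real.log N) := by
    refine le_of_tendsto h2.norm (Eventually.of_forall fun k => ?_)
    simp only [Function.comp_apply]
    rw [hsplit, add_sub_cancel_left]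
    exact norm_sum_zetaDefect_le hσ ht hN0 hN k
  have e : riemannZeta s - ∑ n ∈ Finset.Ico 1 N, (n : ℂ) ^ (-s)
      = (riemannZeta s - 1 / (s - 1)
      - (∑ n ∈ Finset.Ico 1 N, (n : ℂ) ^ (-s) - (1 - realCpowNeg (s - 1) N) / (s - 1)))
        + realCpowNeg (s - 1) N / (s - 1) := by
    ring
  rw [e]
  refine (norm_add_le _ _).trans ?_
  rw [add_comm]
  refine add_le_add ?_ h3
  rw [norm_div, norm_realCpowNeg]
  have hden : t ≤ ‖s - 1‖ := by
    have := Complex.abs_im_le_norm (s - 1)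
    rw [Complex.sub_im, hsim, Complex.one_im, sub_zero, abs_of_pos ht] at this
    exact this
  simp only [Complex.sub_re, hsre, Complex.one_re, neg_sub]
  exact div_le_div_of_nonneg_left (Real.exp_pos _).le ht hden

open ArithmeticFunction in
/-- The constant function `1` on positive integers, over the reals. -/
def zetaR : ArithmeticFunction ℝ := (ArithmeticFunction.zeta : ArithmeticFunction ℝ)

lemma zetaR_apply {n : ℕ} (hn : n ≠ 0) : zetaR n = 1 := by simp [zetaR, hn]

lemma zetaR_nonneg (n : ℕ) : 0 ≤ zetaR n := by
  rcases eq_or_ne n 0 with rfl | hn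
  · simp
  · simp [zetaR_apply hn]

lemma zetaR_le_one (n : ℕ) : zetaR n ≤ 1 := by
  rcases eq_or_ne n 0 with rfl | hn
  · simp
  · simp [zetaR_apply hn]

lemma vonMangoldt_mul_zetaR :
    ArithmeticFunction.vonMangoldt * zetaR = ArithmeticFunction.log :=
  ArithmeticFunction.vonMangoldt_mul_zeta

lemma arith_mul_le_mul {f f' g g' : ArithmeticFunction ℝ} (hf : ∀ n, |f n| ≤ f' n)
    (hg : ∀ n, |g n| ≤ g' n) (n : ℕ) : |(f * g) n| ≤ (f' * g') n := by
  rw [ArithmeticFunction.mul_apply, ArithmeticFunction.mul_apply]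
  refine (Finset.abs_sum_le_sum_abs _ _).trans (Finset.sum_le_sum fun x _ => ?_)
  rw [abs_mul]
  exact mul_le_mul (hf _) (hg _) (abs_nonneg _) ((abs_nonneg _).trans (hf _))

lemma arith_mul_nonneg {f g : ArithmeticFunction ℝ} (hf : ∀ n, 0 ≤ f n) (hg : ∀ n, 0 ≤ g n)
    (n : ℕ) : 0 ≤ (f * g) n :=
  (abs_nonneg _).trans (arith_mul_le_mul (fun n => (abs_of_nonneg (hf n)).le)
    (fun n => (abs_of_nonneg (hg n)).le) n)

lemma arith_pow_le_pow {f g : ArithmeticFunction ℝ} (hf : ∀ n, |f n| ≤ g n) (k : ℕ) :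
    ∀ n, |(f ^ k) n| ≤ (g ^ k) n := by
  induction k with
  | zero =>
    intro n
    rw [pow_zero, pow_zero, ArithmeticFunction.one_apply]
    split_ifs <;> simp
  | succ k ih => rw [pow_succ, pow_succ]; exact arith_mul_le_mul ih hf

lemma arith_pow_nonneg {f : ArithmeticFunction ℝ} (hf : ∀ n, 0 ≤ f n) (k n : ℕ) :
    0 ≤ (f ^ k) n :=
  (abs_nonneg _).trans (arith_pow_le_pow (fun n => (abs_of_nonneg (hf n)).le) k n)

lemma arith_pow_apply_one (f : ArithmeticFunction ℝ) (k : ℕ) : (f ^ k) 1 = f 1 ^ k := by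
  induction k with
  | zero => simp
  | succ k ih => rw [pow_succ, pow_succ, ArithmeticFunction.mul_apply_one, ih]

lemma arith_sum_apply {ι : Type*} (s : Finset ι) (f : ι → ArithmeticFunction ℝ) (n : ℕ) :
    (∑ i ∈ s, f i) n = ∑ i ∈ s, f i n := by
  induction s using Finset.induction_on with
  | empty => simp
  | insert a s ha ih => rw [Finset.sum_insert ha, Finset.sum_insert ha, ← ih]; rfl

/-- The derivation `f ↦ log · f` on arithmetic functions. -/
def logDerivation : ArithmeticFunction ℝ →ₗ[ℝ] ArithmeticFunction ℝ where
  toFun f := ArithmeticFunction.pmul ArithmeticFunction.log f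
  map_add' f g := by ext n; simp [mul_add]
  map_smul' c f := by ext n; simp; ring

lemma logDerivation_apply (f : ArithmeticFunction ℝ) (n : ℕ) :
    logDerivation f n = Real.log n * f n := by
  simp [logDerivation, ArithmeticFunction.log_apply]

lemma logDerivation_mul (f g : ArithmeticFunction ℝ) :
    logDerivation (f * g) = logDerivation f * g + f * logDerivation g := by
  ext n
  rw [logDerivation_apply, ArithmeticFunction.add_apply, ArithmeticFunction.mul_apply,
    ArithmeticFunction.mul_apply, ArithmeticFunction.mul_apply, Finset.mul_sum,
    ← Finset.sum_add_distrib]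
  refine Finset.sum_congr rfl fun x hx => ?_
  obtain ⟨h1, h2⟩ := Nat.mem_divisorsAntidiagonal.1 hx
  have hx1 : (x.1 : ℝ) ≠ 0 := Nat.cast_ne_zero.2 (left_ne_zero_of_mul (h1 ▸ h2))
  have hx2 : (x.2 : ℝ) ≠ 0 := Nat.cast_ne_zero.2 (right_ne_zero_of_mul (h1 ▸ h2))
  rw [logDerivation_apply, logDerivation_apply, ← h1, Nat.cast_mul, Real.log_mul hx1 hx2]
  ring

lemma logDerivation_pow (f : ArithmeticFunction ℝ) (k : ℕ) :
    logDerivation (f ^ (k + 1)) = ((k : ℝ) + 1) • (f ^ k * logDerivation f) := by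
  induction k with
  | zero => simp
  | succ k ih =>
    rw [pow_succ, logDerivation_mul, ih, smul_mul_assoc]
    push_cast
    rw [add_smul ((k : ℝ) + 1), one_smul, pow_succ f k]
    congr 2
    ring

lemma logDerivation_one : logDerivation 1 = 0 := by
  ext n
  rw [logDerivation_apply, ArithmeticFunction.one_apply]
  split_ifs with h <;> simp [h]

/-- The truncated exponential series in the Dirichlet ring. -/
def expTrunc (B : ArithmeticFunction ℝ) (K : ℕ) : ArithmeticFunction ℝ :=
  ∑ k ∈ Finset.range (K + 1), ((k.factorial : ℝ)⁻¹) • B ^ k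

lemma expTrunc_apply (B : ArithmeticFunction ℝ) (K n : ℕ) :
    expTrunc B K n = ∑ k ∈ Finset.range (K + 1), (B ^ k) n / k.factorial := by
  rw [expTrunc, arith_sum_apply]
  refine Finset.sum_congr rfl fun k _ => ?_
  rw [ArithmeticFunction.smul_map, smul_eq_mul]; ring

lemma logDerivation_expTrunc (B : ArithmeticFunction ℝ) (K : ℕ) :
    logDerivation (expTrunc B (K + 1)) = expTrunc B K * logDerivation B := by
  rw [expTrunc, map_sum, Finset.sum_range_succ']
  simp only [map_smul, pow_zero, logDerivation_one, smul_zero, add_zero]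
  rw [expTrunc, Finset.sum_mul]
  refine Finset.sum_congr rfl fun k _ => ?_
  rw [logDerivation_pow, smul_smul, smul_mul_assoc, Nat.factorial_succ]
  congr 1
  push_cast
  field_simp

lemma expTrunc_apply_one {B : ArithmeticFunction ℝ} (hB : B 1 = 0) (K : ℕ) :
    expTrunc B K 1 = 1 := by
  rw [expTrunc_apply, Finset.sum_range_succ']
  simp [arith_pow_apply_one, hB]

lemma expTrunc_nonneg {B : ArithmeticFunction ℝ} (hB : ∀ n, 0 ≤ B n) (K n : ℕ) :
    0 ≤ expTrunc B K n := by
  rw [expTrunc_apply]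
  exact Finset.sum_nonneg fun k _ => div_nonneg (arith_pow_nonneg hB k n) (Nat.cast_nonneg _)

/-- If `g` formally equals `exp B`, then the truncated exponential of `B` is at most `g`. -/
lemma expTrunc_le {B g : ArithmeticFunction ℝ} (hB : ∀ n, 0 ≤ B n) (hB1 : B 1 = 0)
    (hg : ∀ n, 0 ≤ g n) (hg1 : 1 ≤ g 1) (hD : logDerivation g = g * logDerivation B) (K : ℕ) :
    ∀ n, expTrunc B K n ≤ g n := by
  have hDB : ∀ n, 0 ≤ logDerivation B n := fun n => by
    rw [logDerivation_apply]; exact mul_nonneg (Real.log_natCast_nonneg n) (hB n)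
  induction K with
  | zero =>
    intro n
    rw [expTrunc_apply]
    simp only [zero_add, Finset.range_one, Finset.sum_singleton, pow_zero, Nat.factorial_zero,
      Nat.cast_one, div_one, ArithmeticFunction.one_apply]
    split_ifs with h
    · rw [h]; exact hg1
    · exact hg n
  | succ K ih =>
    intro n
    rcases Nat.lt_or_ge n 2 with h | h
    · interval_cases n
      · simp
      · rw [expTrunc_apply_one hB1]; exact hg1
    · have hl : 0 < Real.log n := Real.log_pos (by exact_mod_cast h)
      refine le_of_mul_le_mul_left ?_ hl
      rw [← logDerivation_apply, ← logDerivation_apply, logDerivation_expTrunc, hD]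
      have := arith_mul_le_mul (f := expTrunc B K) (f' := g) (fun m => by
        rw [abs_of_nonneg (expTrunc_nonneg hB K m)]; exact ih m)
        (fun m => (abs_of_nonneg (hDB m)).le) n
      exact (le_abs_self _).trans this

/-- The coefficients `Λ(n) / log n` of `log ζ`. -/
def logCoeff : ArithmeticFunction ℝ :=
  ⟨fun n => ArithmeticFunction.vonMangoldt n / Real.log n, by simp⟩

lemma logCoeff_apply (n : ℕ) :
    logCoeff n = ArithmeticFunction.vonMangoldt n / Real.log n := rfl

lemma logCoeff_nonneg (n : ℕ) : 0 ≤ logCoeff n :=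
  div_nonneg ArithmeticFunction.vonMangoldt_nonneg (Real.log_natCast_nonneg n)

lemma logCoeff_le_one (n : ℕ) : logCoeff n ≤ 1 :=
  div_le_one_of_le₀ ArithmeticFunction.vonMangoldt_le_log (Real.log_natCast_nonneg n)

lemma logCoeff_one : logCoeff 1 = 0 := by simp [logCoeff_apply]

lemma logDerivation_logCoeff : logDerivation logCoeff = ArithmeticFunction.vonMangoldt := by
  ext n
  rw [logDerivation_apply, logCoeff_apply]
  rcases Nat.lt_or_ge n 2 with h | h
  · interval_cases n <;> simp
  · have hl : Real.log n ≠ 0 := (Real.log_pos (by exact_mod_cast h)).ne'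
    field_simp

lemma logDerivation_zetaR : logDerivation zetaR = zetaR * ArithmeticFunction.vonMangoldt := by
  rw [mul_comm, vonMangoldt_mul_zetaR]
  ext n
  rw [logDerivation_apply, ArithmeticFunction.log_apply]
  rcases eq_or_ne n 0 with rfl | hn
  · simp
  · rw [zetaR_apply hn, mul_one]

lemma expTrunc_logCoeff_le (K n : ℕ) : expTrunc logCoeff K n ≤ zetaR n :=
  expTrunc_le logCoeff_nonneg logCoeff_one zetaR_nonneg (zetaR_apply one_ne_zero).ge
    (by rw [logDerivation_zetaR, logDerivation_logCoeff]) K n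

lemma pow_le_expTrunc {B : ArithmeticFunction ℝ} (hB : ∀ n, 0 ≤ B n) (K n : ℕ) :
    (B ^ K) n / K.factorial ≤ expTrunc B K n := by
  rw [expTrunc_apply]
  exact Finset.single_le_sum (f := fun k => (B ^ k) n / (k.factorial : ℝ))
    (fun k _ => div_nonneg (arith_pow_nonneg hB k n) (Nat.cast_nonneg _))
    (Finset.mem_range.2 (Nat.lt_succ_self K))

lemma logCoeff_pow_le (k n : ℕ) : (logCoeff ^ k) n ≤ k.factorial := by
  have h := (pow_le_expTrunc logCoeff_nonneg k n).trans
    ((expTrunc_logCoeff_le k n).trans (zetaR_le_one n))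
  rwa [div_le_one (by exact_mod_cast k.factorial_pos)] at h

lemma logCoeff_pow_div_factorial_le (K n : ℕ) :
    (logCoeff ^ K) n / K.factorial ≤ (2 : ℝ)⁻¹ ^ K * (zetaR * zetaR) n := by
  have hB : ∀ n, 0 ≤ ((2 : ℝ) • logCoeff) n := fun n => by
    rw [ArithmeticFunction.smul_map, smul_eq_mul]
    exact mul_nonneg zero_le_two (logCoeff_nonneg n)
  have h := (pow_le_expTrunc hB K n).trans (expTrunc_le hB
    (by rw [ArithmeticFunction.smul_map, logCoeff_one, smul_zero])
    (arith_mul_nonneg zetaR_nonneg zetaR_nonneg)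
    (by rw [ArithmeticFunction.mul_apply_one, zetaR_apply one_ne_zero, one_mul])
    (by
      rw [logDerivation_mul, map_smul, logDerivation_zetaR, logDerivation_logCoeff, two_smul]
      ring) K n)
  rw [smul_pow, ArithmeticFunction.smul_map, smul_eq_mul] at h
  rw [inv_pow, ← div_eq_inv_mul, le_div_iff₀ (by positivity)]
  refine le_trans (le_of_eq ?_) h
  ring

/-- Truncation of an arithmetic function to `n ≤ Y`. -/
def arithTrunc (Y : ℕ) (f : ArithmeticFunction ℝ) : ArithmeticFunction ℝ :=
  ⟨fun n => if n ≤ Y then f n else 0, by simp⟩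

lemma arithTrunc_apply (Y : ℕ) (f : ArithmeticFunction ℝ) (n : ℕ) :
    arithTrunc Y f n = if n ≤ Y then f n else 0 := rfl

lemma abs_arithTrunc_le {f : ArithmeticFunction ℝ} (hf : ∀ n, 0 ≤ f n) (Y n : ℕ) :
    |arithTrunc Y f n| ≤ f n := by
  rw [arithTrunc_apply]
  split_ifs
  · exact (abs_of_nonneg (hf n)).le
  · simpa using hf n

lemma arithTrunc_nonneg {f : ArithmeticFunction ℝ} (hf : ∀ n, 0 ≤ f n) (Y n : ℕ) :
    0 ≤ arithTrunc Y f n := by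
  rw [arithTrunc_apply]; split_ifs
  · exact hf n
  · exact le_rfl

lemma arith_mul_congr {Y : ℕ} {f f' g g' : ArithmeticFunction ℝ} (hf : ∀ n ≤ Y, f n = f' n)
    (hg : ∀ n ≤ Y, g n = g' n) : ∀ n ≤ Y, (f * g) n = (f' * g') n := by
  intro n hn
  rw [ArithmeticFunction.mul_apply, ArithmeticFunction.mul_apply]
  refine Finset.sum_congr rfl fun x hx => ?_
  obtain ⟨h1, h2⟩ := Nat.mem_divisorsAntidiagonal.1 hx
  have hx0 : 0 < n := Nat.pos_of_ne_zero h2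
  rw [hf _ ((Nat.le_of_dvd hx0 (Dvd.intro _ h1)).trans hn),
    hg _ ((Nat.le_of_dvd hx0 (Dvd.intro_left _ h1)).trans hn)]

lemma arith_pow_congr {Y : ℕ} {f f' : ArithmeticFunction ℝ} (hf : ∀ n ≤ Y, f n = f' n) (k : ℕ) :
    ∀ n ≤ Y, (f ^ k) n = (f' ^ k) n := by
  induction k with
  | zero => intro n _; rw [pow_zero, pow_zero]
  | succ k ih => rw [pow_succ, pow_succ]; exact arith_mul_congr ih hf

lemma expTrunc_congr {Y : ℕ} {f f' : ArithmeticFunction ℝ} (hf : ∀ n ≤ Y, f n = f' n) (K : ℕ) :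
    ∀ n ≤ Y, expTrunc f K n = expTrunc f' K n := fun n hn => by
  rw [expTrunc_apply, expTrunc_apply]
  exact Finset.sum_congr rfl fun k _ => by rw [arith_pow_congr hf k n hn]

lemma abs_expTrunc_le {f g : ArithmeticFunction ℝ} (hf : ∀ n, |f n| ≤ g n) (K n : ℕ) :
    |expTrunc f K n| ≤ expTrunc g K n := by
  rw [expTrunc_apply, expTrunc_apply]
  refine (Finset.abs_sum_le_sum_abs _ _).trans (Finset.sum_le_sum fun k _ => ?_)
  rw [abs_div, Nat.abs_cast]
  exact div_le_div_of_nonneg_right (arith_pow_le_pow hf k n) (Nat.cast_nonneg _)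

lemma logDerivation_zetaR_mul_expTrunc (K : ℕ) :
    logDerivation (zetaR * expTrunc (-logCoeff) K)
      = zetaR * ArithmeticFunction.vonMangoldt
        * (((K.factorial : ℝ)⁻¹) • (-logCoeff) ^ K) := by
  rcases K with _ | K
  · simp [expTrunc, logDerivation_zetaR]
  · rw [logDerivation_mul, logDerivation_expTrunc, map_neg, logDerivation_zetaR,
      logDerivation_logCoeff]
    have h : expTrunc (-logCoeff) (K + 1) = expTrunc (-logCoeff) K
        + (((K + 1).factorial : ℝ)⁻¹) • (-logCoeff) ^ (K + 1) := by
      rw [expTrunc, Finset.sum_range_succ]; rfl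
    rw [h]
    ring

lemma abs_zetaR_mul_expTrunc_le (K : ℕ) {n : ℕ} (hn : 2 ≤ n) :
    |(zetaR * expTrunc (-logCoeff) K) n| ≤ (2 : ℝ)⁻¹ ^ K * (zetaR ^ 3) n := by
  have hl : 0 < Real.log n := Real.log_pos (by exact_mod_cast hn)
  refine le_of_mul_le_mul_left ?_ hl
  have h1 : Real.log n * |(zetaR * expTrunc (-logCoeff) K) n|
      = |logDerivation (zetaR * expTrunc (-logCoeff) K) n| := by
    rw [logDerivation_apply, abs_mul, abs_of_pos hl]
  rw [h1, logDerivation_zetaR_mul_expTrunc, mul_comm zetaR, vonMangoldt_mul_zetaR]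
  have hlog : ∀ m, |ArithmeticFunction.log m| ≤ ArithmeticFunction.log m := fun m =>
    (abs_of_nonneg (by rw [ArithmeticFunction.log_apply]; exact Real.log_natCast_nonneg m)).le
  have h2 : ∀ m, |(((K.factorial : ℝ)⁻¹) • (-logCoeff) ^ K) m|
      ≤ (((2 : ℝ)⁻¹ ^ K) • (zetaR * zetaR)) m := fun m => by
    rw [ArithmeticFunction.smul_map, ArithmeticFunction.smul_map, smul_eq_mul, smul_eq_mul,
      abs_mul, abs_of_nonneg (by positivity : (0 : ℝ) ≤ (K.factorial : ℝ)⁻¹)]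
    refine le_trans ?_ (logCoeff_pow_div_factorial_le K m)
    rw [div_eq_inv_mul]
    refine mul_le_mul_of_nonneg_left ?_ (by positivity)
    refine arith_pow_le_pow (fun j => ?_) K m
    rw [show (-logCoeff) j = -(logCoeff j) from rfl, abs_neg, abs_of_nonneg (logCoeff_nonneg j)]
  refine (arith_mul_le_mul hlog h2 n).trans ?_
  have h3 : (ArithmeticFunction.log * (zetaR * zetaR)) n ≤ Real.log n * (zetaR ^ 3) n := by
    rw [show zetaR ^ 3 = zetaR * (zetaR * zetaR) by ring, ArithmeticFunction.mul_apply,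
      ArithmeticFunction.mul_apply, Finset.mul_sum]
    refine Finset.sum_le_sum fun x hx => ?_
    obtain ⟨h4, h5⟩ := Nat.mem_divisorsAntidiagonal.1 hx
    have hx1 : x.1 ≠ 0 := left_ne_zero_of_mul (h4 ▸ h5)
    rw [zetaR_apply hx1, one_mul, ArithmeticFunction.log_apply]
    refine mul_le_mul_of_nonneg_right ?_ (arith_mul_nonneg zetaR_nonneg zetaR_nonneg _)
    exact Real.log_le_log (by positivity)
      (by exact_mod_cast Nat.le_of_dvd (Nat.pos_of_ne_zero h5) (Dvd.intro _ h4))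
  rw [mul_smul_comm, ArithmeticFunction.smul_map, smul_eq_mul,
    mul_left_comm (Real.log n)]
  exact mul_le_mul_of_nonneg_left h3 (by positivity)

lemma submul_mul {f g : ArithmeticFunction ℝ} (hf0 : ∀ n, 0 ≤ f n) (hg0 : ∀ n, 0 ≤ g n)
    (hf : ∀ m n, f (m * n) ≤ f m * f n) (hg : ∀ m n, g (m * n) ≤ g m * g n) (m n : ℕ) :
    (f * g) (m * n) ≤ (f * g) m * (f * g) n := by
  rw [ArithmeticFunction.mul_apply, ArithmeticFunction.mul_apply, ArithmeticFunction.mul_apply,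
    Finset.sum_mul_sum, ← Finset.sum_product']
  rcases eq_or_ne (m * n) 0 with h0 | h0
  · have he : ∑ x ∈ Nat.divisorsAntidiagonal 0, f x.1 * g x.2 = 0 := by simp
    rw [h0, he]
    exact (Finset.sum_nonneg fun x _ => mul_nonneg (mul_nonneg (hf0 _) (hg0 _))
        (mul_nonneg (hf0 _) (hg0 _)))
  set S := m.divisorsAntidiagonal ×ˢ n.divisorsAntidiagonal with hS
  set φ : (ℕ × ℕ) × (ℕ × ℕ) → ℕ × ℕ := fun z => (z.1.1 * z.2.1, z.1.2 * z.2.2) with hφ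
  have hmaps : ∀ z ∈ S, φ z ∈ (m * n).divisorsAntidiagonal := fun z hz => by
    obtain ⟨h1, h2⟩ := Finset.mem_product.1 hz
    rw [Nat.mem_divisorsAntidiagonal] at h1 h2 ⊢
    exact ⟨by rw [← h1.1, ← h2.1]; simp only [hφ]; ring, h0⟩
  rw [← Finset.sum_fiberwise_of_maps_to hmaps]
  refine Finset.sum_le_sum fun x hx => ?_
  obtain ⟨h1, -⟩ := Nat.mem_divisorsAntidiagonal.1 hx
  obtain ⟨a, b, ⟨a', ha⟩, ⟨b', hb⟩, hab⟩ := exists_dvd_and_dvd_of_dvd_mul (Dvd.intro _ h1)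
  have hm : m ≠ 0 := left_ne_zero_of_mul h0
  have hn : n ≠ 0 := right_ne_zero_of_mul h0
  have hx2 : x.2 = a' * b' := by
    have h5 : a * b * x.2 = a * b * (a' * b') := by
      rw [← hab, h1, ha, hb, hab]; ring
    exact Nat.eq_of_mul_eq_mul_left (Nat.pos_of_ne_zero
      (mul_ne_zero (left_ne_zero_of_mul (ha ▸ hm)) (left_ne_zero_of_mul (hb ▸ hn)))) h5
  have hmem : ((a, a'), (b, b')) ∈ S.filter fun z => φ z = x := by
    refine Finset.mem_filter.2 ⟨Finset.mem_product.2 ⟨?_, ?_⟩, ?_⟩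
    · exact Nat.mem_divisorsAntidiagonal.2 ⟨ha.symm, hm⟩
    · exact Nat.mem_divisorsAntidiagonal.2 ⟨hb.symm, hn⟩
    · exact Prod.ext hab.symm hx2.symm
  refine le_trans ?_ (Finset.single_le_sum (f := fun z : (ℕ × ℕ) × (ℕ × ℕ) =>
    f z.1.1 * g z.1.2 * (f z.2.1 * g z.2.2)) (fun z _ => mul_nonneg
      (mul_nonneg (hf0 _) (hg0 _)) (mul_nonneg (hf0 _) (hg0 _))) hmem)
  rw [hab, hx2]
  calc f (a * b) * g (a' * b') ≤ (f a * f b) * (g a' * g b') :=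
        mul_le_mul (hf _ _) (hg _ _) (hg0 _) (mul_nonneg (hf0 _) (hf0 _))
    _ = f a * g a' * (f b * g b') := by ring

lemma submul_mul_pow_zetaR_le {d : ArithmeticFunction ℝ} (hd0 : ∀ n, 0 ≤ d n) (hd1 : d 1 ≤ 1)
    (hd : ∀ m n, d (m * n) ≤ d m * d n) (a : ℕ) :
    ∀ n, d n * (zetaR ^ a) n ≤ (d ^ a) n := by
  induction a with
  | zero =>
    intro n
    rw [pow_zero, pow_zero, ArithmeticFunction.one_apply]
    split_ifs with h
    · rw [h]; simpa using hd1
    · simp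
  | succ a ih =>
    intro n
    rw [pow_succ, pow_succ, ArithmeticFunction.mul_apply, ArithmeticFunction.mul_apply,
      Finset.mul_sum]
    refine Finset.sum_le_sum fun x hx => ?_
    obtain ⟨h1, h2⟩ := Nat.mem_divisorsAntidiagonal.1 hx
    have hz := arith_pow_nonneg zetaR_nonneg a x.1
    rw [zetaR_apply (right_ne_zero_of_mul (h1 ▸ h2)), mul_one, ← h1]
    calc d (x.1 * x.2) * (zetaR ^ a) x.1 ≤ (d x.1 * d x.2) * (zetaR ^ a) x.1 :=
          mul_le_mul_of_nonneg_right (hd _ _) hz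
      _ = (d x.1 * (zetaR ^ a) x.1) * d x.2 := by ring
      _ ≤ (d ^ a) x.1 * d x.2 := mul_le_mul_of_nonneg_right (ih _) (hd0 _)

lemma zetaR_pow_three_sq_le (n : ℕ) : ((zetaR ^ 3) n) ^ 2 ≤ (zetaR ^ 9) n := by
  have hz : ∀ m n, zetaR (m * n) ≤ zetaR m * zetaR n := fun m n => by
    rcases eq_or_ne m 0 with rfl | hm
    · simp
    rcases eq_or_ne n 0 with rfl | hn
    · simp
    rw [zetaR_apply (mul_ne_zero hm hn), zetaR_apply hm, zetaR_apply hn, mul_one]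
  have h2 := arith_mul_nonneg zetaR_nonneg zetaR_nonneg
  have h3 : zetaR ^ 3 = zetaR * zetaR * zetaR := by ring
  have h := submul_mul_pow_zetaR_le (d := zetaR ^ 3) (arith_pow_nonneg zetaR_nonneg 3)
    (by rw [arith_pow_apply_one, zetaR_apply one_ne_zero, one_pow])
    (by rw [h3]; exact submul_mul h2 zetaR_nonneg (submul_mul zetaR_nonneg zetaR_nonneg hz hz) hz)
    3 n
  rw [← pow_mul] at h
  rw [sq]; exact h

lemma zetaR_mul_zetaR_le (n : ℕ) : (zetaR * zetaR) n ≤ (zetaR ^ 3) n := by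
  have h1 : ∀ m, |(1 : ArithmeticFunction ℝ) m| ≤ zetaR m := fun m => by
    rw [ArithmeticFunction.one_apply]
    split_ifs with h
    · rw [h, zetaR_apply one_ne_zero, abs_one]
    · simpa using zetaR_nonneg m
  have h := arith_mul_le_mul (fun m => (abs_of_nonneg
    (arith_mul_nonneg zetaR_nonneg zetaR_nonneg m)).le) h1 n
  rw [mul_one] at h
  rw [show zetaR ^ 3 = zetaR * zetaR * zetaR by ring]
  exact (le_abs_self _).trans h

/-- Coefficients of the mollified truncated zeta polynomial. -/
def mollCoeff (Y K N : ℕ) : ArithmeticFunction ℝ :=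
  arithTrunc N zetaR * expTrunc (-arithTrunc Y logCoeff) K

lemma mollCoeff_one (Y K : ℕ) {N : ℕ} (hN : 1 ≤ N) : mollCoeff Y K N 1 = 1 := by
  have h : (-arithTrunc Y logCoeff) 1 = 0 := by
    rw [show (-arithTrunc Y logCoeff) 1 = -(arithTrunc Y logCoeff 1) from rfl,
      arithTrunc_apply, logCoeff_one]
    simp
  rw [mollCoeff, ArithmeticFunction.mul_apply_one, expTrunc_apply_one h, arithTrunc_apply,
    if_pos hN, zetaR_apply one_ne_zero, one_mul]

lemma mollCoeff_sq_le {Y K N : ℕ} (hYN : Y ≤ N) {n : ℕ} (hn : 2 ≤ n) :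
    (mollCoeff Y K N n) ^ 2 ≤ (zetaR ^ 9) n * ((2 : ℝ)⁻¹ ^ K + if Y < n then 1 else 0) := by
  have h3 := arith_pow_nonneg zetaR_nonneg 3 n
  have h9 := arith_pow_nonneg zetaR_nonneg 9 n
  split_ifs with h
  · have hA : ∀ m, |(-arithTrunc Y logCoeff) m| ≤ logCoeff m := fun m => by
      rw [show (-arithTrunc Y logCoeff) m = -(arithTrunc Y logCoeff m) from rfl, abs_neg]
      exact abs_arithTrunc_le logCoeff_nonneg Y m
    have hc : |mollCoeff Y K N n| ≤ (zetaR ^ 3) n :=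
      (arith_mul_le_mul (fun m => abs_arithTrunc_le zetaR_nonneg N m)
        (fun m => (abs_expTrunc_le hA K m).trans (expTrunc_logCoeff_le K m)) n).trans
        (zetaR_mul_zetaR_le n)
    rw [← sq_abs]
    refine (pow_le_pow_left₀ (abs_nonneg _) hc 2).trans ((zetaR_pow_three_sq_le n).trans ?_)
    have : (0 : ℝ) ≤ (2 : ℝ)⁻¹ ^ K := by positivity
    nlinarith
  · have hc : mollCoeff Y K N n = (zetaR * expTrunc (-logCoeff) K) n := by
      refine arith_mul_congr (Y := Y) (fun m hm => ?_) (expTrunc_congr (fun m hm => ?_) K) n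
        (not_lt.1 h)
      · rw [arithTrunc_apply, if_pos (hm.trans hYN)]
      · rw [show (-arithTrunc Y logCoeff) m = -(arithTrunc Y logCoeff m) from rfl,
          arithTrunc_apply, if_pos hm]
        rfl
    have hq : (0 : ℝ) ≤ (2 : ℝ)⁻¹ ^ K := by positivity
    have hq1 : (2 : ℝ)⁻¹ ^ K ≤ 1 := pow_le_one₀ (by norm_num) (by norm_num)
    rw [← sq_abs, hc, add_zero]
    refine (pow_le_pow_left₀ (abs_nonneg _) (abs_zetaR_mul_expTrunc_le K hn) 2).trans ?_
    rw [mul_pow]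
    have h1 : ((2 : ℝ)⁻¹ ^ K) ^ 2 ≤ (2 : ℝ)⁻¹ ^ K := by nlinarith
    calc ((2 : ℝ)⁻¹ ^ K) ^ 2 * (zetaR ^ 3) n ^ 2 ≤ (2 : ℝ)⁻¹ ^ K * (zetaR ^ 9) n :=
          mul_le_mul h1 (zetaR_pow_three_sq_le n) (sq_nonneg _) hq
      _ = _ := mul_comm _ _

/-- The generalized Dirichlet polynomial `∑_{1 ≤ n ≤ B} f(n) χ(n)`. -/
def dirPoly {R : Type*} [CommRing R] [Algebra ℝ R] (f : ArithmeticFunction ℝ) (χ : ℕ → R)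
    (B : ℕ) : R :=
  ∑ n ∈ Finset.Icc 1 B, f n • χ n

section DirPoly

variable {R : Type*} [CommRing R] [Algebra ℝ R]

lemma dirPoly_eq_of_le {f : ArithmeticFunction ℝ} {χ : ℕ → R} {B B' : ℕ} (h : B ≤ B')
    (hf : ∀ n, B < n → f n = 0) : dirPoly f χ B' = dirPoly f χ B := by
  refine (Finset.sum_subset (Finset.Icc_subset_Icc_right h) fun n hn hn' => ?_).symm
  rw [Finset.mem_Icc] at hn hn'
  rw [hf n (by omega), zero_smul]

lemma dirPoly_smul (c : ℝ) (f : ArithmeticFunction ℝ) (χ : ℕ → R) (B : ℕ) :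
    dirPoly (c • f) χ B = c • dirPoly f χ B := by
  simp [dirPoly, Finset.smul_sum, smul_smul]

lemma dirPoly_sum {ι : Type*} (s : Finset ι) (f : ι → ArithmeticFunction ℝ) (χ : ℕ → R) (B : ℕ) :
    dirPoly (∑ i ∈ s, f i) χ B = ∑ i ∈ s, dirPoly (f i) χ B := by
  simp only [dirPoly, arith_sum_apply, Finset.sum_smul]
  exact Finset.sum_comm

lemma dirPoly_one {χ : ℕ → R} (h1 : χ 1 = 1) {B : ℕ} (hB : 1 ≤ B) : dirPoly 1 χ B = 1 := by
  rw [dirPoly_eq_of_le hB fun n hn => ArithmeticFunction.one_apply_ne (by omega)]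
  simp [dirPoly, h1]

lemma dirPoly_mul {f g : ArithmeticFunction ℝ} {χ : ℕ → R} {B₁ B₂ : ℕ}
    (hχ : ∀ m n, m ≠ 0 → n ≠ 0 → χ (m * n) = χ m * χ n)
    (hf : ∀ n, B₁ < n → f n = 0) (hg : ∀ n, B₂ < n → g n = 0) :
    dirPoly (f * g) χ (B₁ * B₂) = dirPoly f χ B₁ * dirPoly g χ B₂ := by
  rw [dirPoly, dirPoly, dirPoly, Finset.sum_mul_sum, ← Finset.sum_product',
    ← Finset.sum_fiberwise_of_maps_to (s := Finset.Icc 1 B₁ ×ˢ Finset.Icc 1 B₂)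
      (t := Finset.Icc 1 (B₁ * B₂)) (g := fun x => x.1 * x.2) (fun x hx => by
        simp only [Finset.mem_product, Finset.mem_Icc] at hx ⊢
        exact ⟨Nat.mul_pos hx.1.1 hx.2.1, Nat.mul_le_mul hx.1.2 hx.2.2⟩)]
  refine Finset.sum_congr rfl fun n hn => ?_
  rw [ArithmeticFunction.mul_apply, Finset.sum_smul]
  symm
  have hn0 : n ≠ 0 := by rw [Finset.mem_Icc] at hn; omega
  refine Eq.trans (Finset.sum_subset (s₂ := n.divisorsAntidiagonal) (fun x hx => ?_)
    fun x hx hx' => ?_) (Finset.sum_congr rfl fun x hx => ?_)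
  · rw [Finset.mem_filter] at hx
    exact Nat.mem_divisorsAntidiagonal.2 ⟨hx.2, hn0⟩
  · obtain ⟨h1, -⟩ := Nat.mem_divisorsAntidiagonal.1 hx
    have hx1 : x.1 ≠ 0 := left_ne_zero_of_mul (h1 ▸ hn0)
    have hx2 : x.2 ≠ 0 := right_ne_zero_of_mul (h1 ▸ hn0)
    have hor : B₁ < x.1 ∨ B₂ < x.2 := by
      by_contra! hcon
      refine hx' (Finset.mem_filter.2 ⟨?_, h1⟩)
      simp only [Finset.mem_product, Finset.mem_Icc]
      omega
    rcases hor with h | h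
    · rw [hf _ h, zero_smul, zero_mul]
    · rw [hg _ h, zero_smul, mul_zero]
  · obtain ⟨h1, -⟩ := Nat.mem_divisorsAntidiagonal.1 hx
    rw [← h1, hχ _ _ (left_ne_zero_of_mul (h1 ▸ hn0)) (right_ne_zero_of_mul (h1 ▸ hn0)),
      smul_mul_smul_comm]

lemma arith_mul_eq_zero_of_lt {f g : ArithmeticFunction ℝ} {B₁ B₂ : ℕ}
    (hf : ∀ n, B₁ < n → f n = 0) (hg : ∀ n, B₂ < n → g n = 0) :
    ∀ n, B₁ * B₂ < n → (f * g) n = 0 := by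
  intro n hn
  rw [ArithmeticFunction.mul_apply]
  refine Finset.sum_eq_zero fun x hx => ?_
  obtain ⟨h1, -⟩ := Nat.mem_divisorsAntidiagonal.1 hx
  by_cases h : B₁ < x.1
  · rw [hf _ h, zero_mul]
  · rw [hg _ (by
      by_contra! h2
      exact absurd (Nat.mul_le_mul (not_lt.1 h) h2) (by omega)), mul_zero]

lemma arith_pow_eq_zero_of_lt {f : ArithmeticFunction ℝ} {Y : ℕ} (hf : ∀ n, Y < n → f n = 0)
    (k : ℕ) : ∀ n, Y ^ k < n → (f ^ k) n = 0 := by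
  induction k with
  | zero =>
    intro n hn
    rw [pow_zero] at hn ⊢
    exact ArithmeticFunction.one_apply_ne (by omega)
  | succ k ih => rw [pow_succ, pow_succ]; exact arith_mul_eq_zero_of_lt ih hf

lemma dirPoly_pow {f : ArithmeticFunction ℝ} {χ : ℕ → R} {Y : ℕ} (h1 : χ 1 = 1)
    (hχ : ∀ m n, m ≠ 0 → n ≠ 0 → χ (m * n) = χ m * χ n)
    (hf : ∀ n, Y < n → f n = 0) (k : ℕ) :
    dirPoly (f ^ k) χ (Y ^ k) = dirPoly f χ Y ^ k := by
  induction k with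
  | zero => rw [pow_zero, pow_zero, pow_zero, dirPoly_one h1 le_rfl]
  | succ k ih =>
    rw [pow_succ, pow_succ, pow_succ, dirPoly_mul hχ (arith_pow_eq_zero_of_lt hf k) hf, ih]

lemma expTrunc_eq_zero_of_lt {f : ArithmeticFunction ℝ} {Y : ℕ} (hY : 1 ≤ Y)
    (hf : ∀ n, Y < n → f n = 0) (K : ℕ) : ∀ n, Y ^ K < n → expTrunc f K n = 0 := by
  intro n hn
  rw [expTrunc_apply]
  refine Finset.sum_eq_zero fun k hk => ?_
  rw [arith_pow_eq_zero_of_lt hf k n ((Nat.pow_le_pow_right hY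
    (Nat.lt_succ_iff.1 (Finset.mem_range.1 hk))).trans_lt hn), zero_div]

lemma dirPoly_expTrunc {f : ArithmeticFunction ℝ} {χ : ℕ → R} {Y : ℕ} (hY : 1 ≤ Y)
    (h1 : χ 1 = 1) (hχ : ∀ m n, m ≠ 0 → n ≠ 0 → χ (m * n) = χ m * χ n)
    (hf : ∀ n, Y < n → f n = 0) (K : ℕ) :
    dirPoly (expTrunc f K) χ (Y ^ K)
      = ∑ k ∈ Finset.range (K + 1), ((k.factorial : ℝ)⁻¹) • dirPoly f χ Y ^ k := by
  rw [expTrunc, dirPoly_sum]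
  refine Finset.sum_congr rfl fun k hk => ?_
  rw [dirPoly_smul, dirPoly_eq_of_le (Nat.pow_le_pow_right hY
    (Nat.lt_succ_iff.1 (Finset.mem_range.1 hk))) (arith_pow_eq_zero_of_lt hf k),
    dirPoly_pow h1 hχ hf]

end DirPoly

lemma arithTrunc_eq_zero {Y n : ℕ} (f : ArithmeticFunction ℝ) (h : Y < n) :
    arithTrunc Y f n = 0 := by
  rw [arithTrunc_apply, if_neg (not_le.2 h)]

lemma dirPoly_mul_le {f g : ArithmeticFunction ℝ} {χ : ℕ → ℝ} (hχ0 : ∀ n, 0 ≤ χ n)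
    (hχ : ∀ m n, m ≠ 0 → n ≠ 0 → χ (m * n) = χ m * χ n)
    (hf : ∀ n, 0 ≤ f n) (hg : ∀ n, 0 ≤ g n) (B : ℕ) :
    dirPoly (f * g) χ B ≤ dirPoly f χ B * dirPoly g χ B := by
  have htr : ∀ h : ArithmeticFunction ℝ, dirPoly h χ B = dirPoly (arithTrunc B h) χ B :=
    fun h => Finset.sum_congr rfl fun n hn => by
      rw [arithTrunc_apply, if_pos (Finset.mem_Icc.1 hn).2]
  have hBB : B ≤ B * B := by nlinarith [Nat.zero_le B]
  rw [htr f, htr g, ← dirPoly_mul hχ (fun n => arithTrunc_eq_zero f)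
    (fun n => arithTrunc_eq_zero g)]
  have hnn := arith_mul_nonneg (arithTrunc_nonneg hf B) (arithTrunc_nonneg hg B)
  calc dirPoly (f * g) χ B = dirPoly (arithTrunc B f * arithTrunc B g) χ B :=
        Finset.sum_congr rfl fun n hn => by
          rw [arith_mul_congr (Y := B) (fun m hm => ?_) (fun m hm => ?_) n
            (Finset.mem_Icc.1 hn).2]
          · rw [arithTrunc_apply, if_pos hm]
          · rw [arithTrunc_apply, if_pos hm]
    _ ≤ _ := Finset.sum_le_sum_of_subset_of_nonneg (Finset.Icc_subset_Icc_right hBB)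
        fun n _ _ => mul_nonneg (hnn n) (hχ0 n)

lemma dirPoly_nonneg {f : ArithmeticFunction ℝ} {χ : ℕ → ℝ} (hχ0 : ∀ n, 0 ≤ χ n)
    (hf : ∀ n, 0 ≤ f n) (B : ℕ) : 0 ≤ dirPoly f χ B :=
  Finset.sum_nonneg fun n _ => mul_nonneg (hf n) (hχ0 n)

lemma dirPoly_pow_le {f : ArithmeticFunction ℝ} {χ : ℕ → ℝ} (hχ0 : ∀ n, 0 ≤ χ n) (h1 : χ 1 = 1)
    (hχ : ∀ m n, m ≠ 0 → n ≠ 0 → χ (m * n) = χ m * χ n)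
    (hf : ∀ n, 0 ≤ f n) {B : ℕ} (hB : 1 ≤ B) (k : ℕ) :
    dirPoly (f ^ k) χ B ≤ dirPoly f χ B ^ k := by
  induction k with
  | zero => rw [pow_zero, pow_zero, dirPoly_one h1 hB]
  | succ k ih =>
    rw [pow_succ, pow_succ]
    exact (dirPoly_mul_le hχ0 hχ (arith_pow_nonneg hf k) hf B).trans
      (mul_le_mul_of_nonneg_right ih (dirPoly_nonneg hχ0 hf B))

lemma hasSum_rpow_neg {s : ℝ} (hs : 1 < s) :
    HasSum (fun n : ℕ => (n : ℝ) ^ (-s)) (riemannZeta s).re := by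
  have h1 : Summable fun n : ℕ => (n : ℝ) ^ (-s) := Real.summable_nat_rpow.2 (by linarith)
  have h2 : riemannZeta s = ((∑' n : ℕ, (n : ℝ) ^ (-s) : ℝ) : ℂ) := by
    rw [zeta_eq_tsum_one_div_nat_cpow (by simpa using hs), Complex.ofReal_tsum]
    refine tsum_congr fun n => ?_
    rw [Complex.ofReal_cpow (Nat.cast_nonneg n), Complex.ofReal_neg, Complex.cpow_neg, one_div]
    simp
  rw [h2, Complex.ofReal_re]
  exact h1.hasSum

lemma sum_rpow_neg_le {s : ℝ} (hs : 1 < s) (F : Finset ℕ) :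
    ∑ n ∈ F, (n : ℝ) ^ (-s) ≤ (riemannZeta s).re :=
  sum_le_hasSum F (fun n _ => by positivity) (hasSum_rpow_neg hs)

lemma summable_logCoeff_rpow {s : ℝ} (hs : 1 < s) :
    Summable fun n : ℕ => logCoeff n * (n : ℝ) ^ (-s) :=
  (hasSum_rpow_neg hs).summable.of_nonneg_of_le
    (fun n => mul_nonneg (logCoeff_nonneg n) (by positivity))
    (fun n => mul_le_of_le_one_left (by positivity) (logCoeff_le_one n))

lemma hasSum_logCoeff_rpow {s : ℝ} (hs : 1 < s) :
    HasSum (fun n : ℕ => logCoeff n * (n : ℝ) ^ (-s)) (Real.log (riemannZeta s).re) := by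
  rw [log_riemannZeta_eq hs]
  convert (summable_logCoeff_rpow hs).hasSum using 1
  refine tsum_congr fun n => ?_
  rw [logCoeff_apply, Real.rpow_neg (Nat.cast_nonneg n)]
  field_simp

lemma sum_logCoeff_rpow_le {s : ℝ} (hs : 1 < s) (F : Finset ℕ) :
    ∑ n ∈ F, logCoeff n * (n : ℝ) ^ (-s) ≤ Real.log (riemannZeta s).re :=
  sum_le_hasSum F (fun n _ => mul_nonneg (logCoeff_nonneg n) (by positivity))
    (hasSum_logCoeff_rpow hs)

/-- The sum of `Λ(n)² / (log n)² n^{-s}` over all `n`. -/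
def sqLogSum (s : ℝ) : ℝ := ∑' n : ℕ, logCoeff n ^ 2 * (n : ℝ) ^ (-s)

lemma logCoeff_sq_le (n : ℕ) : logCoeff n ^ 2 ≤ logCoeff n := by
  nlinarith [logCoeff_nonneg n, logCoeff_le_one n]

lemma hasSum_sqLogSum {s : ℝ} (hs : 1 < s) :
    HasSum (fun n : ℕ => logCoeff n ^ 2 * (n : ℝ) ^ (-s)) (sqLogSum s) :=
  ((summable_logCoeff_rpow hs).of_nonneg_of_le (fun n => by positivity)
    (fun n => mul_le_mul_of_nonneg_right (logCoeff_sq_le n) (by positivity))).hasSum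

lemma sqLogSum_le {s : ℝ} (hs : 1 < s) : sqLogSum s ≤ Real.log (riemannZeta s).re :=
  hasSum_le (fun n => mul_le_mul_of_nonneg_right (logCoeff_sq_le n) (by positivity))
    (hasSum_sqLogSum hs) (hasSum_logCoeff_rpow hs)

lemma sqLogSum_sub_le {δ : ℝ} (hδ : 0 < δ) {Y : ℕ} (hY : 1 ≤ Y) :
    0 ≤ sqLogSum (1 + 2 * δ) - ∑ n ∈ Finset.Icc 1 Y, logCoeff n ^ 2 * (n : ℝ) ^ (-(1 + 2 * δ)) ∧
    sqLogSum (1 + 2 * δ) - ∑ n ∈ Finset.Icc 1 Y, logCoeff n ^ 2 * (n : ℝ) ^ (-(1 + 2 * δ))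
      ≤ (Y : ℝ) ^ (-δ) * (riemannZeta (1 + δ : ℝ)).re := by
  have h1 := hasSum_sqLogSum (s := 1 + 2 * δ) (by linarith)
  have h2 := hasSum_rpow_neg (s := 1 + δ) (by linarith)
  have h3 := (Finset.Icc 1 Y).hasSum_compl_iff.2
    (by simpa using h1 : HasSum _ ((sqLogSum (1 + 2 * δ)
      - ∑ n ∈ Finset.Icc 1 Y, logCoeff n ^ 2 * (n : ℝ) ^ (-(1 + 2 * δ)))
      + ∑ n ∈ Finset.Icc 1 Y, logCoeff n ^ 2 * (n : ℝ) ^ (-(1 + 2 * δ))))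
  have h4 : Summable fun n : {x // x ∉ Finset.Icc 1 Y} =>
      (Y : ℝ) ^ (-δ) * ((n : ℕ) : ℝ) ^ (-(1 + δ)) :=
    (h2.summable.mul_left _).subtype _
  refine ⟨h3.nonneg fun n => mul_nonneg (sq_nonneg _) (Real.rpow_nonneg (Nat.cast_nonneg _) _), ?_⟩
  have h5 : ∑' n : {x // x ∉ Finset.Icc 1 Y}, (Y : ℝ) ^ (-δ) * ((n : ℕ) : ℝ) ^ (-(1 + δ))
      ≤ (Y : ℝ) ^ (-δ) * (riemannZeta (1 + δ : ℝ)).re := by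
    rw [tsum_mul_left]
    refine mul_le_mul_of_nonneg_left ?_ (by positivity)
    rw [← h2.tsum_eq]
    exact h2.summable.tsum_subtype_le _ _
      (fun n => Real.rpow_nonneg (Nat.cast_nonneg n) _)
  refine le_trans (hasSum_le (fun n => ?_) h3 h4.hasSum) h5
  obtain ⟨n, hn⟩ := n
  rw [Finset.mem_Icc, not_and_or, not_le, not_le] at hn
  rcases hn with hn | hn
  · obtain rfl : n = 0 := by omega
    simp only [logCoeff.map_zero]
    norm_num
    positivity
  · have hn0 : (0 : ℝ) < n := by exact_mod_cast (by omega : 0 < n)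
    have hY0 : (0 : ℝ) < Y := by exact_mod_cast hY
    calc logCoeff n ^ 2 * (n : ℝ) ^ (-(1 + 2 * δ)) ≤ 1 * (n : ℝ) ^ (-(1 + 2 * δ)) := by
          refine mul_le_mul_of_nonneg_right ?_ (by positivity)
          exact (logCoeff_sq_le n).trans (logCoeff_le_one n)
      _ = (n : ℝ) ^ (-δ) * (n : ℝ) ^ (-(1 + δ)) := by
          rw [one_mul, ← Real.rpow_add hn0]; congr 1; ring
      _ ≤ _ := by
          refine mul_le_mul_of_nonneg_right ?_ (by positivity)
          exact Real.rpow_le_rpow_of_nonpos hY0 (by exact_mod_cast hn.le) (by linarith)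

lemma logCoeff_prime_pow {p : ℕ} (hp : p.Prime) {k : ℕ} (hk : k ≠ 0) :
    logCoeff (p ^ k) = 1 / k := by
  have h : Real.log p ≠ 0 := (Real.log_pos (by exact_mod_cast hp.one_lt)).ne'
  rw [logCoeff_apply, ArithmeticFunction.vonMangoldt_apply_pow hk,
    ArithmeticFunction.vonMangoldt_apply_prime hp, Nat.cast_pow, Real.log_pow]
  have : (k : ℝ) ≠ 0 := by exact_mod_cast hk
  field_simp

lemma isPrimePow_of_logCoeff_ne_zero {n : ℕ} (h : logCoeff n ≠ 0) : IsPrimePow n := by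
  by_contra hn
  rw [← ArithmeticFunction.vonMangoldt_eq_zero_iff] at hn
  exact h (by rw [logCoeff_apply, hn, zero_div])

lemma psiT_eq_sqLogSum {θ T : ℝ} (h : 1 / 2 < sigmaT θ T) :
    psiT θ T = sqLogSum (2 * sigmaT θ T) := by
  have hs := (hasSum_sqLogSum (s := 2 * sigmaT θ T) (by linarith)).summable
  rw [sqLogSum, tsum_eq_tsum_primes_of_support_subset_prime_powers hs, psiT]
  · refine tsum_congr fun p => tsum_congr fun k => ?_
    have he : ((p : ℝ) ^ (k + 1)) ^ (-(2 * sigmaT θ T))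
        = (p : ℝ) ^ (-(2 : ℝ) * ((k : ℝ) + 1) * sigmaT θ T) := by
      rw [← Real.rpow_natCast, ← Real.rpow_mul (Nat.cast_nonneg _)]
      push_cast
      congr 1
      ring
    rw [logCoeff_prime_pow p.2 k.succ_ne_zero, Nat.cast_pow, ← he, div_pow, one_pow]
    push_cast
    rfl
  · intro n hn
    refine isPrimePow_of_logCoeff_ne_zero fun h0 => hn ?_
    simp [h0]

lemma inv_one_sub_le_exp {x : ℝ} (h0 : 0 ≤ x) (h1 : x ≤ 1 / 2) : (1 - x)⁻¹ ≤ Real.exp (2 * x) := by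
  have h : (1 - x)⁻¹ ≤ 2 * x + 1 := by
    rw [inv_le_iff_one_le_mul₀ (by linarith)]
    nlinarith
  exact h.trans (Real.add_one_le_exp _)

lemma sum_prime_rpow_le {s : ℝ} (hs : 1 < s) (F : Finset ℕ) (hF : ∀ p ∈ F, p.Prime) :
    ∑ p ∈ F, (p : ℝ) ^ (-s) ≤ sqLogSum s := by
  refine le_trans (le_of_eq ?_) (sum_le_hasSum F (fun n _ => by positivity) (hasSum_sqLogSum hs))
  refine Finset.sum_congr rfl fun p hp => ?_
  have h := logCoeff_prime_pow (hF p hp) one_ne_zero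
  rw [pow_one] at h
  rw [h]
  simp

lemma log_zeta_le_two_mul_sqLogSum {s : ℝ} (hs : 1 < s) :
    Real.log (riemannZeta s).re ≤ 2 * sqLogSum s := by
  have h1 := (riemannZeta_eulerProduct (s := (s : ℂ)) (by simpa using hs)).norm
  have h2 : ‖riemannZeta s‖ ≤ Real.exp (2 * sqLogSum s) := by
    refine le_of_tendsto h1 (Eventually.of_forall fun n => ?_)
    have hpr : ∀ p ∈ n.primesBelow, p.Prime := fun p hp => Nat.prime_of_mem_primesBelow hp
    calc ‖∏ p ∈ n.primesBelow, (1 - (p : ℂ) ^ (-(s : ℂ)))⁻¹‖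
        ≤ ∏ p ∈ n.primesBelow, Real.exp (2 * (p : ℝ) ^ (-s)) := by
          rw [norm_prod]
          refine Finset.prod_le_prod (fun p _ => norm_nonneg _) fun p hp => ?_
          have hp2 : (2 : ℝ) ≤ p := by exact_mod_cast (hpr p hp).two_le
          have hx : (p : ℝ) ^ (-s) ≤ 1 / 2 := by
            calc (p : ℝ) ^ (-s) ≤ (p : ℝ) ^ (-1 : ℝ) :=
                  Real.rpow_le_rpow_of_exponent_le (by linarith) (by linarith)
              _ ≤ 1 / 2 := by
                  rw [Real.rpow_neg_one, one_div]
                  exact inv_anti₀ (by norm_num) hp2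
          have he : (1 - (p : ℂ) ^ (-(s : ℂ))) = ((1 - (p : ℝ) ^ (-s) : ℝ) : ℂ) := by
            rw [Complex.ofReal_sub, Complex.ofReal_one,
              Complex.ofReal_cpow (Nat.cast_nonneg p)]
            simp
          rw [norm_inv, he, Complex.norm_real, Real.norm_of_nonneg (by linarith)]
          exact inv_one_sub_le_exp (by positivity) hx
      _ ≤ Real.exp (2 * sqLogSum s) := by
          rw [← Real.exp_sum, ← Finset.mul_sum]
          exact Real.exp_le_exp.2 (mul_le_mul_of_nonneg_left
            (sum_prime_rpow_le hs _ hpr) zero_le_two)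
  rw [Real.log_le_iff_le_exp (riemannZeta_re_pos_of_one_lt hs)]
  exact (Complex.re_le_norm _).trans h2

lemma tendsto_mul_zeta_re :
    Tendsto (fun x : ℝ => x * (riemannZeta (1 + x : ℝ)).re) (nhdsWithin 0 (Set.Ioi 0))
      (nhds 1) := by
  have h1 : Tendsto (fun x : ℝ => ((1 + x : ℝ) : ℂ)) (nhdsWithin 0 (Set.Ioi 0))
      (nhdsWithin 1 {1}ᶜ) := by
    refine tendsto_nhdsWithin_iff.2 ⟨?_, ?_⟩
    · refine Tendsto.mono_left ?_ nhdsWithin_le_nhds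
      have : Continuous fun x : ℝ => ((1 + x : ℝ) : ℂ) := by fun_prop
      simpa using this.tendsto 0
    · filter_upwards [self_mem_nhdsWithin] with x hx
      have : x ≠ 0 := (Set.mem_Ioi.1 hx).ne'
      simpa using this
  have h2 := (Complex.continuous_re.tendsto _).comp (riemannZeta_residue_one.comp h1)
  rw [Complex.one_re] at h2
  refine h2.congr fun x => ?_
  simp only [Function.comp]
  rw [show ((1 + x : ℝ) : ℂ) - 1 = (x : ℂ) by push_cast; ring, Complex.re_ofReal_mul]

lemma eventually_zeta_bounds : ∀ᶠ x : ℝ in nhdsWithin 0 (Set.Ioi 0),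
    1 / (2 * x) ≤ (riemannZeta (1 + x : ℝ)).re ∧ (riemannZeta (1 + x : ℝ)).re ≤ 2 / x := by
  filter_upwards [tendsto_mul_zeta_re.eventually (Icc_mem_nhds (by norm_num : (1 / 2 : ℝ) < 1)
    (by norm_num : (1 : ℝ) < 2)), self_mem_nhdsWithin] with x hx hx0
  have hx0 : 0 < x := hx0
  constructor
  · rw [div_le_iff₀ (by positivity)]; linarith [hx.1]
  · rw [le_div_iff₀ hx0]; linarith [hx.2]

/-- The oscillating character `t ↦ n^{-it}`. -/
def osc (n : ℕ) (t : ℝ) : ℂ := Complex.exp (((-t * Real.log n : ℝ) : ℂ) * Complex.I)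

lemma norm_osc (n : ℕ) (t : ℝ) : ‖osc n t‖ = 1 := Complex.norm_exp_ofReal_mul_I _

@[fun_prop]
lemma continuous_osc (n : ℕ) : Continuous (osc n) := by
  unfold osc
  fun_prop

lemma osc_one (t : ℝ) : osc 1 t = 1 := by simp [osc]

lemma osc_mul {m n : ℕ} (hm : m ≠ 0) (hn : n ≠ 0) (t : ℝ) :
    osc (m * n) t = osc m t * osc n t := by
  rw [osc, osc, osc, ← Complex.exp_add, Nat.cast_mul,
    Real.log_mul (by exact_mod_cast hm) (by exact_mod_cast hn)]
  congr 1
  push_cast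
  ring

lemma natCast_cpow_neg_eq_osc {n : ℕ} (hn : n ≠ 0) (σ t : ℝ) :
    (n : ℂ) ^ (-((σ : ℂ) + t * Complex.I)) = ((n : ℝ) ^ (-σ) : ℝ) * osc n t := by
  have h0 : (n : ℂ) ≠ 0 := by exact_mod_cast hn
  have hpos : (0 : ℝ) < n := by exact_mod_cast Nat.pos_of_ne_zero hn
  rw [Complex.cpow_def_of_ne_zero h0, osc, Real.rpow_def_of_pos hpos, Complex.ofReal_exp,
    ← Complex.exp_add, ← Complex.natCast_log]
  congr 1
  push_cast
  ring

/-- The correlation `∫_T^{2 T} m^{-it} n^{it} dt`. -/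
def oscCorr (T : ℝ) (m n : ℕ) : ℂ := ∫ t in T..(2 * T), osc m t * (starRingEnd ℂ) (osc n t)

lemma oscCorr_self (T : ℝ) (n : ℕ) : oscCorr T n n = T := by
  have h : ∀ t, osc n t * (starRingEnd ℂ) (osc n t) = 1 := fun t => by
    rw [Complex.mul_conj, Complex.normSq_eq_norm_sq, norm_osc]; simp
  simp only [oscCorr, h]
  rw [intervalIntegral.integral_const]
  rw [Complex.real_smul]
  push_cast
  ring

lemma abs_sub_le_max_mul_abs_log_sub {x y : ℝ} (hx : 0 < x) (hy : 0 < y) :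
    |x - y| ≤ max x y * |Real.log x - Real.log y| := by
  wlog h : y ≤ x generalizing x y
  · rw [abs_sub_comm x, abs_sub_comm (Real.log x), max_comm]
    exact this hy hx (le_of_not_ge h)
  rw [abs_of_nonneg (sub_nonneg.2 h), max_eq_left h,
    abs_of_nonneg (sub_nonneg.2 (Real.log_le_log hy h)), ← Real.log_div hx.ne' hy.ne']
  have h1 := Real.one_sub_inv_le_log_of_pos (div_pos hx hy)
  rw [inv_div] at h1
  calc x - y = x * (1 - y / x) := by field_simp
    _ ≤ _ := mul_le_mul_of_nonneg_left h1 hx.le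

lemma norm_oscCorr_le (T : ℝ) {m n : ℕ} (hm : m ≠ 0) (hn : n ≠ 0) (hmn : m ≠ n) :
    ‖oscCorr T m n‖ ≤ 2 * (max (m : ℝ) n / |(m : ℝ) - n|) := by
  have hm0 : (0 : ℝ) < m := by exact_mod_cast Nat.pos_of_ne_zero hm
  have hn0 : (0 : ℝ) < n := by exact_mod_cast Nat.pos_of_ne_zero hn
  have hsub : 0 < |(m : ℝ) - n| := abs_pos.2 (sub_ne_zero.2 (by exact_mod_cast hmn))
  have hlog := abs_sub_le_max_mul_abs_log_sub hm0 hn0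
  set l : ℝ := Real.log n - Real.log m with hl
  have hlpos : 0 < |l| := by
    rw [hl, abs_sub_comm]
    exact pos_of_mul_pos_right (lt_of_lt_of_le hsub hlog) (by positivity)
  have hl0 : (l : ℂ) * Complex.I ≠ 0 :=
    mul_ne_zero (by exact_mod_cast abs_pos.1 hlpos) Complex.I_ne_zero
  have he : ∀ t : ℝ, osc m t * (starRingEnd ℂ) (osc n t) = Complex.exp (l * Complex.I * t) := by
    intro t
    rw [osc, osc, ← Complex.exp_conj, ← Complex.exp_add]
    congr 1
    simp only [map_mul, Complex.conj_I, Complex.conj_ofReal, hl]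
    push_cast
    ring
  have hexp : ∀ t : ℝ, ‖Complex.exp (l * Complex.I * t)‖ = 1 := fun t => by
    rw [show (l : ℂ) * Complex.I * t = ((l * t : ℝ) : ℂ) * Complex.I by push_cast; ring]
    exact Complex.norm_exp_ofReal_mul_I _
  simp only [oscCorr, he]
  rw [integral_exp_mul_complex hl0, norm_div, norm_mul, Complex.norm_I, mul_one, Complex.norm_real,
    Real.norm_eq_abs, div_le_iff₀ hlpos]
  have hnum := norm_sub_le (Complex.exp (l * Complex.I * ((2 * T : ℝ) : ℂ)))
    (Complex.exp (l * Complex.I * (T : ℂ)))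
  rw [hexp, hexp] at hnum
  refine hnum.trans ?_
  rw [mul_assoc, div_mul_eq_mul_div]
  have : 1 ≤ max (m : ℝ) n * |l| / |(m : ℝ) - n| := by
    rw [le_div_iff₀ hsub, one_mul, hl, abs_sub_comm (Real.log n)]
    exact hlog
  linarith

/-- The exponential polynomial `∑_{n ≤ B} a_n n^{-it}`. -/
def oscPoly (a : ℕ → ℂ) (B : ℕ) (t : ℝ) : ℂ := ∑ n ∈ Finset.Icc 1 B, a n * osc n t

@[fun_prop]
lemma continuous_oscPoly (a : ℕ → ℂ) (B : ℕ) : Continuous (oscPoly a B) := by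
  unfold oscPoly
  fun_prop

lemma integral_oscPoly_mul_conj (a b : ℕ → ℂ) (B : ℕ) (T : ℝ) :
    ∫ t in T..(2 * T), oscPoly a B t * (starRingEnd ℂ) (oscPoly b B t)
      = ∑ m ∈ Finset.Icc 1 B, ∑ n ∈ Finset.Icc 1 B,
        a m * (starRingEnd ℂ) (b n) * oscCorr T m n := by
  have h : ∀ t, oscPoly a B t * (starRingEnd ℂ) (oscPoly b B t)
      = ∑ m ∈ Finset.Icc 1 B, ∑ n ∈ Finset.Icc 1 B,
        a m * (starRingEnd ℂ) (b n) * (osc m t * (starRingEnd ℂ) (osc n t)) := fun t => by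
    rw [oscPoly, oscPoly, map_sum, Finset.sum_mul_sum]
    refine Finset.sum_congr rfl fun m _ => Finset.sum_congr rfl fun n _ => ?_
    rw [map_mul]
    ring
  simp only [h]
  have hint : ∀ m n, IntervalIntegrable (fun t => a m * (starRingEnd ℂ) (b n)
      * (osc m t * (starRingEnd ℂ) (osc n t))) MeasureTheory.volume T (2 * T) := fun m n => by
    refine Continuous.intervalIntegrable ?_ _ _
    have := Complex.continuous_conj.comp (continuous_osc n)
    exact continuous_const.mul ((continuous_osc m).mul this)
  rw [intervalIntegral.integral_finsetSum]
  · refine Finset.sum_congr rfl fun m _ => ?_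
    rw [intervalIntegral.integral_finsetSum]
    · refine Finset.sum_congr rfl fun n _ => ?_
      rw [intervalIntegral.integral_const_mul, oscCorr]
    · exact fun n _ => hint m n
  · refine fun m _ => ?_
    have := IntervalIntegrable.sum (Finset.Icc 1 B) (fun n _ => hint m n)
    simpa [Finset.sum_fn] using this

lemma norm_integral_oscPoly_mul_conj_sub_le (a b : ℕ → ℂ) (B : ℕ) (T : ℝ) :
    ‖(∫ t in T..(2 * T), oscPoly a B t * (starRingEnd ℂ) (oscPoly b B t))
      - T * ∑ n ∈ Finset.Icc 1 B, a n * (starRingEnd ℂ) (b n)‖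
      ≤ ∑ m ∈ Finset.Icc 1 B, ∑ n ∈ (Finset.Icc 1 B).erase m,
        ‖a m‖ * ‖b n‖ * (2 * (max (m : ℝ) n / |(m : ℝ) - n|)) := by
  rw [integral_oscPoly_mul_conj, Finset.mul_sum, ← Finset.sum_sub_distrib]
  refine (norm_sum_le _ _).trans (Finset.sum_le_sum fun m hm => ?_)
  rw [← Finset.add_sum_erase _ _ hm, oscCorr_self, mul_comm (T : ℂ), add_sub_cancel_left]
  refine (norm_sum_le _ _).trans (Finset.sum_le_sum fun n hn => ?_)
  rw [norm_mul, norm_mul, RCLike.norm_conj]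
  rw [Finset.mem_erase, Finset.mem_Icc] at hn
  rw [Finset.mem_Icc] at hm
  exact mul_le_mul_of_nonneg_left (norm_oscCorr_le T (by omega) (by omega) hn.1.symm)
    (by positivity)

lemma norm_integral_oscPoly_mul_conj_sub_le' (a b : ℕ → ℂ) (B : ℕ) (T : ℝ) :
    ‖(∫ t in T..(2 * T), oscPoly a B t * (starRingEnd ℂ) (oscPoly b B t))
      - T * ∑ n ∈ Finset.Icc 1 B, a n * (starRingEnd ℂ) (b n)‖
      ≤ 2 * B * ((∑ n ∈ Finset.Icc 1 B, ‖a n‖) * ∑ n ∈ Finset.Icc 1 B, ‖b n‖) := by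
  refine (norm_integral_oscPoly_mul_conj_sub_le a b B T).trans ?_
  rw [Finset.sum_mul_sum, Finset.mul_sum]
  refine Finset.sum_le_sum fun m hm => ?_
  rw [Finset.mul_sum]
  refine le_trans (Finset.sum_le_sum fun n hn => ?_)
    (Finset.sum_le_sum_of_subset_of_nonneg (Finset.erase_subset m _) fun n _ _ => by positivity)
  rw [Finset.mem_erase, Finset.mem_Icc] at hn
  rw [Finset.mem_Icc] at hm
  have h1 : 1 ≤ |(m : ℝ) - n| := by
    have : (1 : ℤ) ≤ |(m : ℤ) - n| := Int.one_le_abs (sub_ne_zero.2 (by exact_mod_cast hn.1.symm))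
    exact_mod_cast this
  have h2 : max (m : ℝ) n / |(m : ℝ) - n| ≤ B := by
    refine (div_le_self (by positivity) h1).trans (max_le ?_ ?_)
    · exact_mod_cast hm.2
    · exact_mod_cast hn.2.2
  calc ‖a m‖ * ‖b n‖ * (2 * (max (m : ℝ) n / |(m : ℝ) - n|)) ≤ ‖a m‖ * ‖b n‖ * (2 * B) := by
        gcongr
    _ = _ := by ring

lemma sum_inv_Icc_le {B m : ℕ} (hm : m ≤ B) :
    ∑ n ∈ Finset.Icc 1 m, (n : ℝ)⁻¹ ≤ 1 + Real.log B := by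
  have h := harmonic_le_one_add_log B
  rw [harmonic_eq_sum_Icc] at h
  push_cast at h
  exact (Finset.sum_le_sum_of_subset_of_nonneg (Finset.Icc_subset_Icc_right hm)
    fun n _ _ => by positivity).trans h

lemma sum_inv_abs_sub_le {B m : ℕ} (hm : m ∈ Finset.Icc 1 B) :
    ∑ n ∈ (Finset.Icc 1 B).erase m, |(m : ℝ) - n|⁻¹ ≤ 2 * (1 + Real.log B) := by
  rw [Finset.mem_Icc] at hm
  have hsub : (Finset.Icc 1 B).erase m
      ⊆ (Finset.Icc 1 (m - 1)).image (fun j => m - j) ∪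
        (Finset.Icc 1 (B - m)).image (fun j => m + j) := by
    intro n hn
    rw [Finset.mem_erase, Finset.mem_Icc] at hn
    rw [Finset.mem_union, Finset.mem_image, Finset.mem_image]
    rcases lt_or_gt_of_ne hn.1 with h | h
    · exact Or.inl ⟨m - n, by rw [Finset.mem_Icc]; omega, by omega⟩
    · exact Or.inr ⟨n - m, by rw [Finset.mem_Icc]; omega, by omega⟩
  refine (Finset.sum_le_sum_of_subset_of_nonneg hsub fun n _ _ => by positivity).trans ?_
  have h1 : ∑ n ∈ (Finset.Icc 1 (m - 1)).image (fun j => m - j), |(m : ℝ) - n|⁻¹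
      ≤ 1 + Real.log B := by
    rw [Finset.sum_image fun x hx y hy hxy => by
      simp only [Finset.coe_Icc, Set.mem_Icc] at hx hy; omega]
    refine le_trans (le_of_eq (Finset.sum_congr rfl fun j hj => ?_))
      (sum_inv_Icc_le (by omega : m - 1 ≤ B))
    rw [Finset.mem_Icc] at hj
    rw [Nat.cast_sub (by omega), sub_sub_cancel, Nat.abs_cast]
  have h2 : ∑ n ∈ (Finset.Icc 1 (B - m)).image (fun j => m + j), |(m : ℝ) - n|⁻¹
      ≤ 1 + Real.log B := by
    rw [Finset.sum_image fun x _ y _ hxy => by simpa using hxy]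
    refine le_trans (le_of_eq (Finset.sum_congr rfl fun j _ => ?_))
      (sum_inv_Icc_le (by omega : B - m ≤ B))
    rw [Nat.cast_add, sub_add_cancel_left, abs_neg, Nat.abs_cast]
  have h3 := Finset.sum_union_inter (f := fun n : ℕ => |(m : ℝ) - n|⁻¹)
    (s₁ := (Finset.Icc 1 (m - 1)).image (fun j => m - j))
    (s₂ := (Finset.Icc 1 (B - m)).image (fun j => m + j))
  have h4 : 0 ≤ ∑ n ∈ (Finset.Icc 1 (m - 1)).image (fun j => m - j)
      ∩ (Finset.Icc 1 (B - m)).image (fun j => m + j), |(m : ℝ) - n|⁻¹ :=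
    Finset.sum_nonneg fun n _ => by positivity
  linarith

lemma max_div_abs_sub_le {x y u v : ℝ} (hx : 0 ≤ x) (hy : 0 ≤ y)
    (hxy : x ≠ y) :
    u * v * (max x y / |x - y|)
      ≤ (x * u ^ 2 + y * v ^ 2) / 2 * |x - y|⁻¹ + u * v := by
  have hd : 0 < |x - y| := abs_pos.2 (sub_ne_zero.2 hxy)
  have h1 : max x y = min x y + |x - y| := by
    rw [← max_sub_min_eq_abs']; ring
  have h2 : min x y * (u * v) ≤ (x * u ^ 2 + y * v ^ 2) / 2 := by
    have h3 : min x y * u ^ 2 ≤ x * u ^ 2 :=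
      mul_le_mul_of_nonneg_right (min_le_left _ _) (sq_nonneg u)
    have h4 : min x y * v ^ 2 ≤ y * v ^ 2 :=
      mul_le_mul_of_nonneg_right (min_le_right _ _) (sq_nonneg v)
    nlinarith [mul_nonneg (le_min hx hy) (sq_nonneg (u - v))]
  have h5 : u * v * (max x y / |x - y|) = min x y * (u * v) * |x - y|⁻¹ + u * v := by
    rw [h1]; field_simp
  rw [h5]
  gcongr

lemma ofReal_integral_norm_sq (a : ℕ → ℂ) (B : ℕ) (T : ℝ) :
    ((∫ t in T..(2 * T), ‖oscPoly a B t‖ ^ 2 : ℝ) : ℂ)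
      = ∫ t in T..(2 * T), oscPoly a B t * (starRingEnd ℂ) (oscPoly a B t) := by
  rw [← intervalIntegral.integral_ofReal]
  refine intervalIntegral.integral_congr fun t _ => ?_
  simp only [Complex.mul_conj, Complex.normSq_eq_norm_sq]

theorem integral_norm_sq_oscPoly_le (a : ℕ → ℂ) (B : ℕ) (T : ℝ) :
    ∫ t in T..(2 * T), ‖oscPoly a B t‖ ^ 2
      ≤ ∑ n ∈ Finset.Icc 1 B, ‖a n‖ ^ 2 * (T + 6 * n * (1 + Real.log B)) := by
  set l : ℝ := 1 + Real.log B with hl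
  have hl0 : 0 ≤ l := add_nonneg zero_le_one (Real.log_natCast_nonneg B)
  have h1 := norm_integral_oscPoly_mul_conj_sub_le a a B T
  rw [← ofReal_integral_norm_sq] at h1
  have h2 : ∑ n ∈ Finset.Icc 1 B, a n * (starRingEnd ℂ) (a n)
      = ((∑ n ∈ Finset.Icc 1 B, ‖a n‖ ^ 2 : ℝ) : ℂ) := by
    push_cast
    refine Finset.sum_congr rfl fun n _ => ?_
    rw [Complex.mul_conj, Complex.normSq_eq_norm_sq]
    push_cast
    rfl
  rw [h2, ← Complex.ofReal_mul, ← Complex.ofReal_sub, Complex.norm_real, Real.norm_eq_abs] at h1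
  have h3 : ∑ m ∈ Finset.Icc 1 B, ∑ n ∈ (Finset.Icc 1 B).erase m,
      ‖a m‖ * ‖a n‖ * (2 * (max (m : ℝ) n / |(m : ℝ) - n|))
      ≤ ∑ m ∈ Finset.Icc 1 B, ∑ n ∈ (Finset.Icc 1 B).erase m,
        ((m * ‖a m‖ ^ 2 * |(m : ℝ) - n|⁻¹ + n * ‖a n‖ ^ 2 * |(m : ℝ) - n|⁻¹)
          + 2 * (‖a m‖ * ‖a n‖)) := by
    refine Finset.sum_le_sum fun m _ => Finset.sum_le_sum fun n hn => ?_
    have h := max_div_abs_sub_le (Nat.cast_nonneg m) (Nat.cast_nonneg n)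
      (x := (m : ℝ)) (y := n) (u := ‖a m‖) (v := ‖a n‖)
      (by exact_mod_cast (Finset.ne_of_mem_erase hn).symm)
    linarith
  have h4 : ∑ m ∈ Finset.Icc 1 B, ∑ n ∈ (Finset.Icc 1 B).erase m,
      m * ‖a m‖ ^ 2 * |(m : ℝ) - n|⁻¹ ≤ ∑ m ∈ Finset.Icc 1 B, m * ‖a m‖ ^ 2 * (2 * l) := by
    refine Finset.sum_le_sum fun m hm => ?_
    rw [← Finset.mul_sum]
    exact mul_le_mul_of_nonneg_left (sum_inv_abs_sub_le hm) (by positivity)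
  have h5 : ∑ m ∈ Finset.Icc 1 B, ∑ n ∈ (Finset.Icc 1 B).erase m,
      n * ‖a n‖ ^ 2 * |(m : ℝ) - n|⁻¹ = ∑ m ∈ Finset.Icc 1 B, ∑ n ∈ (Finset.Icc 1 B).erase m,
      m * ‖a m‖ ^ 2 * |(m : ℝ) - n|⁻¹ := by
    rw [Finset.sum_comm' (t' := Finset.Icc 1 B) (s' := fun n => (Finset.Icc 1 B).erase n)]
    · refine Finset.sum_congr rfl fun n _ => Finset.sum_congr rfl fun m _ => ?_
      rw [abs_sub_comm]
    · intro m n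
      simp only [Finset.mem_erase]
      tauto
  have h6 : ∑ m ∈ Finset.Icc 1 B, ∑ n ∈ (Finset.Icc 1 B).erase m, 2 * (‖a m‖ * ‖a n‖)
      ≤ 2 * (l * ∑ n ∈ Finset.Icc 1 B, n * ‖a n‖ ^ 2) := by
    calc _ ≤ ∑ m ∈ Finset.Icc 1 B, ∑ n ∈ Finset.Icc 1 B, 2 * (‖a m‖ * ‖a n‖) :=
          Finset.sum_le_sum fun m _ => Finset.sum_le_sum_of_subset_of_nonneg
            (Finset.erase_subset m _) fun n _ _ => by positivity
      _ = 2 * (∑ n ∈ Finset.Icc 1 B, ‖a n‖) ^ 2 := by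
          rw [sq, Finset.sum_mul_sum, Finset.mul_sum]
          simp only [Finset.mul_sum]
      _ ≤ _ := by
          refine mul_le_mul_of_nonneg_left ?_ zero_le_two
          refine (Finset.sum_sq_le_sum_mul_sum_of_sq_le_mul (r := fun n => ‖a n‖)
            (f := fun n : ℕ => (n : ℝ)⁻¹) (g := fun n : ℕ => n * ‖a n‖ ^ 2) _
            (fun n _ => by positivity) (fun n _ => by positivity) fun n hn => ?_).trans ?_
          · have : (n : ℝ) ≠ 0 := by
              rw [Finset.mem_Icc] at hn
              exact_mod_cast (by omega : n ≠ 0)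
            exact le_of_eq (by field_simp)
          · exact mul_le_mul_of_nonneg_right (sum_inv_Icc_le le_rfl)
              (Finset.sum_nonneg fun n _ => by positivity)
  simp only [Finset.sum_add_distrib] at h3
  rw [h5] at h3
  have h7 := (le_abs_self _).trans (h1.trans h3)
  have h8 : ∑ n ∈ Finset.Icc 1 B, ‖a n‖ ^ 2 * (T + 6 * n * l)
      = T * ∑ n ∈ Finset.Icc 1 B, ‖a n‖ ^ 2 + 6 * (l * ∑ n ∈ Finset.Icc 1 B, n * ‖a n‖ ^ 2) := by
    simp only [Finset.mul_sum, ← Finset.sum_add_distrib]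
    exact Finset.sum_congr rfl fun n _ => by ring
  have h9 : ∑ m ∈ Finset.Icc 1 B, m * ‖a m‖ ^ 2 * (2 * l)
      = 2 * (l * ∑ n ∈ Finset.Icc 1 B, n * ‖a n‖ ^ 2) := by
    simp only [Finset.mul_sum]
    exact Finset.sum_congr rfl fun n _ => by ring
  rw [h8]
  linarith

lemma lintegral_exp_neg_mul_Ioi {c : ℝ} (hc : 0 < c) :
    ∫⁻ v in Set.Ioi (0 : ℝ), ENNReal.ofReal (Real.exp (-(c * v))) = ENNReal.ofReal (1 / c) := by
  have h1 := integrableOn_exp_mul_Ioi (neg_lt_zero.2 hc) 0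
  have h2 := integral_exp_mul_Ioi (neg_lt_zero.2 hc) 0
  simp only [neg_mul] at h1 h2
  rw [← MeasureTheory.ofReal_integral_eq_lintegral_ofReal h1
    (Eventually.of_forall fun v => (Real.exp_pos _).le), h2]
  simp

lemma norm_le_of_lintegral_deriv_sq_le {q q' : ℝ → ℂ} (hq : ∀ w, HasDerivAt q (q' w) w)
    (hq' : Continuous q') (hlim : Tendsto q atTop (nhds 0)) {α : ℝ} (hα : 0 < α)
    (h : ∫⁻ v in Set.Ioi (0 : ℝ), ENNReal.ofReal (Real.exp (Real.log 2 * v) * ‖q' v‖ ^ 2)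
      ≤ ENNReal.ofReal (α ^ 2)) {w : ℝ} (hw : 0 ≤ w) : ‖q w‖ ≤ 5 / 4 * α := by
  have hlog : (2 / 3 : ℝ) ≤ Real.log 2 := by linarith [Real.log_two_gt_d9]
  have hpt : ∀ v, ‖q' v‖ₑ ≤ ENNReal.ofReal (α / 2) * ENNReal.ofReal (Real.exp (-(Real.log 2 * v)))
      + ENNReal.ofReal (1 / (2 * α))
        * ENNReal.ofReal (Real.exp (Real.log 2 * v) * ‖q' v‖ ^ 2) := fun v => by
    rw [← ofReal_norm, ← ENNReal.ofReal_mul (by positivity),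
      ← ENNReal.ofReal_mul (by positivity), ← ENNReal.ofReal_add (by positivity) (by positivity)]
    refine ENNReal.ofReal_le_ofReal ?_
    rw [Real.exp_neg]
    set e := Real.exp (Real.log 2 * v) with he
    have he0 : 0 < e := Real.exp_pos _
    have : α / 2 * e⁻¹ + 1 / (2 * α) * (e * ‖q' v‖ ^ 2) - ‖q' v‖
        = (α - e * ‖q' v‖) ^ 2 / (2 * α * e) := by
      field_simp
      ring
    have h2 : 0 ≤ (α - e * ‖q' v‖) ^ 2 / (2 * α * e) := by positivity
    linarith
  have htot : ∫⁻ v in Set.Ioi (0 : ℝ), ‖q' v‖ₑ ≤ ENNReal.ofReal (5 / 4 * α) := by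
    refine (MeasureTheory.lintegral_mono hpt).trans ?_
    rw [MeasureTheory.lintegral_add_left (by fun_prop),
      MeasureTheory.lintegral_const_mul _ (by fun_prop),
      MeasureTheory.lintegral_const_mul _ (by fun_prop), lintegral_exp_neg_mul_Ioi (by linarith)]
    refine (add_le_add_right (mul_le_mul_right h _) _).trans ?_
    rw [← ENNReal.ofReal_mul (by positivity), ← ENNReal.ofReal_mul (by positivity),
      ← ENNReal.ofReal_add (by positivity) (by positivity)]
    refine ENNReal.ofReal_le_ofReal ?_
    have h3 : 1 / Real.log 2 ≤ 3 / 2 := by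
      rw [div_le_iff₀ (by linarith)]; linarith
    have h4 : 1 / (2 * α) * α ^ 2 = α / 2 := by field_simp
    rw [h4]
    nlinarith
  have htot' : ∫⁻ v in Set.Ioi w, ‖q' v‖ₑ ≤ ENNReal.ofReal (5 / 4 * α) :=
    (MeasureTheory.lintegral_mono_set (Set.Ioi_subset_Ioi hw)).trans htot
  have hint : MeasureTheory.IntegrableOn q' (Set.Ioi w) :=
    ⟨hq'.aestronglyMeasurable, htot'.trans_lt ENNReal.ofReal_lt_top⟩
  have hftc := MeasureTheory.integral_Ioi_of_hasDerivAt_of_tendsto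
    (hq w).continuousAt.continuousWithinAt (fun v _ => hq v) hint hlim
  have h5 := (MeasureTheory.enorm_integral_le_lintegral_enorm
    (μ := MeasureTheory.volume.restrict (Set.Ioi w)) q').trans htot'
  rw [hftc, zero_sub, enorm_neg, ← ofReal_norm] at h5
  exact (ENNReal.ofReal_le_ofReal_iff (by positivity)).1 h5

/-- The Dirichlet polynomial `∑_{n ≤ B} a_n n^{-w-it}`. -/
def dampPoly (a : ℕ → ℂ) (B : ℕ) (w t : ℝ) : ℂ :=
  oscPoly (fun n => a n * (Real.exp (-(w * Real.log n)) : ℂ)) B t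

lemma dampPoly_eq (a : ℕ → ℂ) (B : ℕ) (w t : ℝ) :
    dampPoly a B w t
      = ∑ n ∈ Finset.Icc 1 B, a n * (Real.exp (-(w * Real.log n)) : ℂ) * osc n t := rfl

lemma continuous_dampPoly (a : ℕ → ℂ) (B : ℕ) :
    Continuous fun p : ℝ × ℝ => dampPoly a B p.1 p.2 := by
  simp only [dampPoly_eq]
  fun_prop

lemma hasDerivAt_dampPoly (a : ℕ → ℂ) (B : ℕ) (w t : ℝ) :
    HasDerivAt (fun w => dampPoly a B w t)
      (dampPoly (fun n => -(a n * Real.log n)) B w t) w := by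
  simp only [dampPoly_eq]
  refine HasDerivAt.fun_sum fun n _ => ?_
  have h1 : HasDerivAt (fun w : ℝ => Real.exp (-(w * Real.log n)))
      (Real.exp (-(w * Real.log n)) * -(1 * Real.log n)) w :=
    (((hasDerivAt_id w).mul_const (Real.log n)).neg).exp
  have h2 := (h1.ofReal_comp.const_mul (a n)).mul_const (osc n t)
  refine h2.congr_deriv ?_
  push_cast
  ring

lemma tendsto_dampPoly {a : ℕ → ℂ} (ha : a 1 = 0) (B : ℕ) (t : ℝ) :
    Tendsto (fun w => dampPoly a B w t) atTop (nhds 0) := by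
  simp only [dampPoly_eq]
  rw [← Finset.sum_const_zero (s := Finset.Icc 1 B)]
  refine tendsto_finsetSum _ fun n hn => ?_
  rcases eq_or_ne n 1 with rfl | h1
  · simp [ha]
  rw [Finset.mem_Icc] at hn
  have hl : 0 < Real.log n := Real.log_pos (by exact_mod_cast (by omega : 1 < n))
  have h2 : Tendsto (fun w : ℝ => Real.exp (-(w * Real.log n))) atTop (nhds 0) :=
    Real.tendsto_exp_neg_atTop_nhds_zero.comp (tendsto_id.atTop_mul_const hl)
  have h3 : Tendsto (fun w : ℝ => (Real.exp (-(w * Real.log n)) : ℂ)) atTop (nhds ((0 : ℝ) : ℂ)) :=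
    (Complex.continuous_ofReal.tendsto _).comp h2
  simpa using (h3.const_mul (a n)).mul_const (osc n t)

theorem volume_dampPoly_gt_le {a : ℕ → ℂ} (ha : a 1 = 0) (B : ℕ) {T : ℝ} (hT : 0 ≤ T) {α : ℝ}
    (hα : 0 < α) :
    MeasureTheory.volume {t | t ∈ Set.Icc T (2 * T) ∧ ∃ w, 0 ≤ w ∧ 5 / 4 * α < ‖dampPoly a B w t‖}
      ≤ ENNReal.ofReal (2 * (∑ n ∈ Finset.Icc 1 B,
        ‖a n‖ ^ 2 * Real.log n ^ 2 * (T + 6 * n * (1 + Real.log B))) / α ^ 2) := by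
  set V : ℝ := ∑ n ∈ Finset.Icc 1 B,
    ‖a n‖ ^ 2 * Real.log n ^ 2 * (T + 6 * n * (1 + Real.log B)) with hV
  have hlB : 0 ≤ 1 + Real.log B := add_nonneg zero_le_one (Real.log_natCast_nonneg B)
  have hV0 : 0 ≤ V := Finset.sum_nonneg fun n _ => by positivity
  have hlog : (1 / 2 : ℝ) ≤ Real.log 2 := by linarith [Real.log_two_gt_d9]
  set D : ℝ → ℝ → ℂ := fun v t => dampPoly (fun n => -(a n * Real.log n)) B v t with hD
  have hDc : Continuous fun p : ℝ × ℝ => D p.1 p.2 := continuous_dampPoly _ B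
  set G : ℝ → ℝ → ENNReal := fun t v => ENNReal.ofReal (Real.exp (Real.log 2 * v) * ‖D v t‖ ^ 2)
    with hG
  have hGm : Measurable (Function.uncurry G) := by
    have : Continuous fun p : ℝ × ℝ => Real.exp (Real.log 2 * p.2) * ‖D p.2 p.1‖ ^ 2 := by
      have := hDc.comp continuous_swap
      simp only [Function.comp_def, Prod.fst_swap, Prod.snd_swap] at this
      fun_prop
    exact (ENNReal.measurable_ofReal.comp this.measurable)
  have hmean : ∀ v ∈ Set.Ioi (0 : ℝ), ∫⁻ t in Set.Ioc T (2 * T), G t v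
      ≤ ENNReal.ofReal V * ENNReal.ofReal (Real.exp (-(Real.log 2 * v))) := by
    intro v hv
    have hv : 0 < v := hv
    have hcont : Continuous fun t => Real.exp (Real.log 2 * v) * ‖D v t‖ ^ 2 := by
      have := hDc.comp (Continuous.prodMk (continuous_const (y := v)) continuous_id)
      simp only [Function.comp_def, id] at this
      fun_prop
    rw [← MeasureTheory.ofReal_integral_eq_lintegral_ofReal
      ((hcont.integrableOn_Icc).mono_set Set.Ioc_subset_Icc_self)
      (Eventually.of_forall fun t => by positivity),
      ← intervalIntegral.integral_of_le (by linarith), intervalIntegral.integral_const_mul,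
      ← ENNReal.ofReal_mul hV0]
    refine ENNReal.ofReal_le_ofReal ?_
    refine (mul_le_mul_of_nonneg_left (integral_norm_sq_oscPoly_le _ B T)
      (Real.exp_pos _).le).trans ?_
    rw [Finset.mul_sum, hV, Finset.sum_mul]
    refine Finset.sum_le_sum fun n hn => ?_
    rw [Finset.mem_Icc] at hn
    rw [norm_mul, norm_neg, norm_mul, Complex.norm_real, Complex.norm_real,
      Real.norm_eq_abs, Real.norm_eq_abs, Real.abs_exp, mul_pow, mul_pow, sq_abs]
    rcases eq_or_ne n 1 with rfl | h1
    · simp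
    have hn2 : (2 : ℝ) ≤ n := by exact_mod_cast (by omega : 2 ≤ n)
    have hln : Real.log 2 ≤ Real.log n := Real.log_le_log two_pos hn2
    have he : Real.exp (Real.log 2 * v) * Real.exp (-(v * Real.log n)) ^ 2
        ≤ Real.exp (-(Real.log 2 * v)) := by
      rw [sq, ← Real.exp_add, ← Real.exp_add]
      refine Real.exp_le_exp.2 ?_
      nlinarith
    calc _ = (‖a n‖ ^ 2 * Real.log n ^ 2 * (T + 6 * n * (1 + Real.log B)))
          * (Real.exp (Real.log 2 * v) * Real.exp (-(v * Real.log n)) ^ 2) := by ring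
      _ ≤ _ := mul_le_mul_of_nonneg_left he (by positivity)
  have htot : ∫⁻ t in Set.Ioc T (2 * T), ∫⁻ v in Set.Ioi (0 : ℝ), G t v ≤
      ENNReal.ofReal (2 * V) := by
    rw [MeasureTheory.lintegral_lintegral_swap hGm.aemeasurable]
    refine (MeasureTheory.setLIntegral_mono' measurableSet_Ioi hmean).trans ?_
    rw [MeasureTheory.lintegral_const_mul _ (by fun_prop), lintegral_exp_neg_mul_Ioi (by linarith),
      ← ENNReal.ofReal_mul hV0]
    refine ENNReal.ofReal_le_ofReal ?_
    have h3 : 1 / Real.log 2 ≤ 2 := by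
      rw [div_le_iff₀ (by linarith)]; linarith
    nlinarith
  have hsub : {t | t ∈ Set.Icc T (2 * T) ∧ ∃ w, 0 ≤ w ∧ 5 / 4 * α < ‖dampPoly a B w t‖}
      ⊆ {t | ENNReal.ofReal (α ^ 2) ≤ ∫⁻ v in Set.Ioi (0 : ℝ), G t v} ∩ Set.Icc T (2 * T) := by
    rintro t ⟨ht, w, hw, hgt⟩
    refine ⟨?_, ht⟩
    rw [Set.mem_ofPred_eq]
    by_contra! hlt
    have hDt : Continuous fun v => D v t := by
      have := hDc.comp (Continuous.prodMk continuous_id (continuous_const (y := t)))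
      simpa only [Function.comp_def, id] using this
    exact absurd (norm_le_of_lintegral_deriv_sq_le (fun w => hasDerivAt_dampPoly a B w t) hDt
      (tendsto_dampPoly ha B t) hα hlt.le hw) (not_le.2 hgt)
  refine (MeasureTheory.measure_mono hsub).trans ?_
  have hm : Measurable fun t => ∫⁻ v in Set.Ioi (0 : ℝ), G t v := hGm.lintegral_prod_right'
  rw [← MeasureTheory.Measure.restrict_apply (measurableSet_le measurable_const hm),
    MeasureTheory.restrict_Ioc_eq_restrict_Icc.symm]
  have hmarkov := (MeasureTheory.mul_meas_ge_le_lintegral (μ := MeasureTheory.volume.restrict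
    (Set.Ioc T (2 * T))) hm (ENNReal.ofReal (α ^ 2))).trans htot
  rw [ENNReal.ofReal_div_of_pos (by positivity), ENNReal.le_div_iff_mul_le
    (Or.inl (by simp [hα.ne'])) (Or.inl ENNReal.ofReal_ne_top), mul_comm]
  exact hmarkov

lemma tendsto_riemannZeta_horizontal (t : ℝ) :
    Tendsto (fun σ : ℝ => riemannZeta (σ + t * Complex.I)) atTop (nhds 1) := by
  set f : ℕ → ℂ := fun n => (n : ℂ) ^ (-((t : ℂ) * Complex.I)) with hf
  have hterm : ∀ (σ : ℝ) (n : ℕ), LSeries.term f σ n = LSeries.term 1 (σ + t * Complex.I) n := by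
    intro σ n
    rcases eq_or_ne n 0 with rfl | hn
    · simp
    · have h0 : (n : ℂ) ≠ 0 := by exact_mod_cast hn
      have hfn : f n = ((n : ℂ) ^ ((t : ℂ) * Complex.I))⁻¹ := Complex.cpow_neg _ _
      rw [LSeries.term_of_ne_zero hn, LSeries.term_of_ne_zero hn, Complex.cpow_add _ _ h0, hfn]
      simp only [Pi.one_apply]
      field_simp
  have hsum : ∀ σ : ℝ, 1 < σ → LSeriesSummable f σ := by
    intro σ hσ
    have : LSeriesSummable 1 ((σ : ℂ) + t * Complex.I) :=
      LSeriesSummable_one_iff.2 (by simpa using hσ)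
    exact this.congr fun n => (hterm σ n).symm
  have habs : LSeries.abscissaOfAbsConv f < ⊤ :=
    (LSeries.abscissaOfAbsConv_le_of_forall_lt_LSeriesSummable (x := 1) hsum).trans_lt
      (EReal.coe_lt_top _)
  have h := LSeries.tendsto_atTop habs
  have h1 : f 1 = 1 := by simp [hf]
  rw [h1] at h
  refine h.congr' ?_
  filter_upwards [eventually_gt_atTop 1] with σ hσ
  rw [← LSeries_one_eq_riemannZeta (by simpa using hσ)]
  exact tsum_congr (hterm σ)

lemma eq_zero_of_exp_eq_one {h : ℝ → ℂ} {σ : ℝ} (hc : ContinuousOn h (Set.Ici σ))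
    (hexp : ∀ x ∈ Set.Ici σ, Complex.exp (h x) = 1) (hlim : Tendsto h atTop (nhds 0)) :
    h σ = 0 := by
  have hval : ∀ x ∈ Set.Ici σ, ‖h x‖ < 2 * π → h x = 0 := by
    intro x hx hlt
    obtain ⟨n, hn⟩ := Complex.exp_eq_one_iff.1 (hexp x hx)
    have hnorm : ‖h x‖ = |(n : ℝ)| * (2 * π) := by
      rw [hn, norm_mul, Complex.norm_intCast]
      congr 1
      simp [abs_of_pos Real.pi_pos]
    have h1 : |(n : ℝ)| < 1 := by
      rw [hnorm] at hlt
      nlinarith [Real.pi_pos]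
    have h2 : n = 0 := by
      have : |n| < 1 := by exact_mod_cast h1
      exact Int.abs_lt_one_iff.1 this
    rw [hn, h2]
    simp
  by_contra hne
  have h1 : 1 ≤ ‖h σ‖ := by
    by_contra! hlt
    exact hne (hval σ Set.self_mem_Ici (by linarith [Real.pi_gt_three]))
  obtain ⟨b, hb1, hb2⟩ := ((hlim.norm.eventually (gt_mem_nhds (by simp : ‖(0 : ℂ)‖ < 1))).and
    (eventually_ge_atTop σ)).exists
  have hcont : ContinuousOn (fun x => ‖h x‖) (Set.Icc σ b) :=
    (hc.mono Set.Icc_subset_Ici_self).norm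
  obtain ⟨x, hx, hx1⟩ := intermediate_value_Icc' hb2 hcont ⟨hb1.le, h1⟩
  have hx1 : ‖h x‖ = 1 := hx1
  have := hval x hx.1 (by rw [hx1]; linarith [Real.pi_gt_three])
  rw [this] at hx1
  simp at hx1

lemma logZetaRay_unique {σ t : ℝ} {z w : ℂ} (hz : logZetaRay σ t z) (hw : logZetaRay σ t w) :
    z = w := by
  obtain ⟨g, hg, hge, hgl, rfl⟩ := hz
  obtain ⟨f, hf, hfe, hfl, rfl⟩ := hw
  refine sub_eq_zero.1 (eq_zero_of_exp_eq_one (h := fun x => g x - f x) (hg.sub hf)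
    (fun x hx => ?_) (by simpa using hgl.sub hfl))
  rw [Complex.exp_sub, hge x hx, hfe x hx, div_self]
  rw [← hfe x hx]
  exact Complex.exp_ne_zero _

/-- If `ζ e^{-P}` stays close to `1` on the ray, then `log ζ` stays close to `P`. -/
theorem exists_logZetaRay {σ t η : ℝ} (ht : t ≠ 0) {P : ℝ → ℂ} (hPc : Continuous P)
    (hPl : Tendsto P atTop (nhds 0)) (hη : η ≤ 1 / 2)
    (h : ∀ x, σ ≤ x → ‖riemannZeta (x + t * Complex.I) * Complex.exp (-P x) - 1‖ ≤ η) :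
    ∃ z, logZetaRay σ t z ∧ ‖z - P σ‖ ≤ 2 * η := by
  set u : ℝ → ℂ := fun x => riemannZeta (x + t * Complex.I) * Complex.exp (-P x) with hu
  have hucont : Continuous u := by
    refine Continuous.mul ?_ (by fun_prop)
    rw [continuous_iff_continuousAt]
    intro x
    have hne : (x : ℂ) + t * Complex.I ≠ 1 := fun he => ht (by simpa using congrArg Complex.im he)
    have h1 := (differentiableAt_riemannZeta hne).continuousAt
    exact ContinuousAt.comp (f := fun x : ℝ => (x : ℂ) + t * Complex.I) h1 (by fun_prop)
  have hulim : Tendsto u atTop (nhds 1) := by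
    have h1 := (tendsto_riemannZeta_horizontal t).mul
      ((Complex.continuous_exp.tendsto _).comp hPl.neg)
    simpa using h1
  have hslit : ∀ x, σ ≤ x → u x ∈ Complex.slitPlane := fun x hx =>
    Complex.mem_slitPlane_of_norm_lt_one (z := u x - 1) (by linarith [h x hx]) |> fun h => by
      simpa using h
  refine ⟨P σ + Complex.log (u σ), ⟨fun x => P x + Complex.log (u x), ?_, ?_, ?_, rfl⟩, ?_⟩
  · exact hPc.continuousOn.add (hucont.continuousOn.clog fun x hx => hslit x hx)
  · intro x hx
    rw [Complex.exp_add, Complex.exp_log (Complex.slitPlane_ne_zero (hslit x hx)), hu,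
      mul_left_comm, ← Complex.exp_add, add_neg_cancel, Complex.exp_zero, mul_one]
  · have h1 := hPl.add (hulim.clog Complex.one_mem_slitPlane)
    simpa using h1
  · have h1 := h σ le_rfl
    have h2 := Complex.norm_log_one_add_half_le_self (z := u σ - 1) (h1.trans hη)
    rw [add_sub_cancel] at h2
    rw [add_sub_cancel_left]
    have h3 := norm_nonneg (u σ - 1)
    change ‖u σ - 1‖ ≤ η at h1
    linarith

/-- The completely multiplicative function `n ↦ n^{-(σ + it)}`. -/
def zetaChar (σ t : ℝ) (n : ℕ) : ℂ := (((n : ℝ) ^ (-σ) : ℝ) : ℂ) * osc n t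

lemma zetaChar_one (σ t : ℝ) : zetaChar σ t 1 = 1 := by simp [zetaChar, osc_one]

lemma zetaChar_mul (σ t : ℝ) (m n : ℕ) (hm : m ≠ 0) (hn : n ≠ 0) :
    zetaChar σ t (m * n) = zetaChar σ t m * zetaChar σ t n := by
  rw [zetaChar, zetaChar, zetaChar, osc_mul hm hn, Nat.cast_mul,
    Real.mul_rpow (Nat.cast_nonneg _) (Nat.cast_nonneg _), Complex.ofReal_mul]
  ring

/-- The prime-power polynomial approximating `log ζ(σ + it)`. -/
def primePoly (Y : ℕ) (σ t : ℝ) : ℂ := dirPoly logCoeff (zetaChar σ t) Y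

lemma dirPoly_arithTrunc (f : ArithmeticFunction ℝ) (χ : ℕ → ℂ) (Y : ℕ) :
    dirPoly (arithTrunc Y f) χ Y = dirPoly f χ Y :=
  Finset.sum_congr rfl fun n hn => by
    rw [arithTrunc_apply, if_pos (Finset.mem_Icc.1 hn).2]

lemma dirPoly_mollCoeff {Y : ℕ} (hY : 1 ≤ Y) (K N : ℕ) (σ t : ℝ) :
    dirPoly (mollCoeff Y K N) (zetaChar σ t) (N * Y ^ K)
      = dirPoly zetaR (zetaChar σ t) N
        * ∑ k ∈ Finset.range (K + 1), (-primePoly Y σ t) ^ k / k.factorial := by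
  have hneg : ∀ n, Y < n → (-arithTrunc Y logCoeff) n = 0 := fun n hn => by
    rw [ArithmeticFunction.neg_apply, arithTrunc_eq_zero _ hn, neg_zero]
  rw [mollCoeff, dirPoly_mul (zetaChar_mul σ t) (fun n => arithTrunc_eq_zero _)
    (expTrunc_eq_zero_of_lt hY hneg K), dirPoly_arithTrunc,
    dirPoly_expTrunc hY (zetaChar_one σ t) (zetaChar_mul σ t) hneg]
  congr 1
  refine Finset.sum_congr rfl fun k _ => ?_
  have h : dirPoly (-arithTrunc Y logCoeff) (zetaChar σ t) Y = -primePoly Y σ t := by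
    rw [primePoly, ← dirPoly_arithTrunc logCoeff]
    simp [dirPoly]
  rw [h, Complex.real_smul, div_eq_inv_mul]
  push_cast
  rfl

lemma norm_exp_mul_sum_sub_one_le {P : ℂ} {K : ℕ} (hP : ‖P‖ ≤ K / 20) :
    ‖Complex.exp P * ∑ k ∈ Finset.range (K + 1), (-P) ^ k / k.factorial - 1‖
      ≤ Real.exp (-K) / 10 := by
  have hsmall : ‖-P‖ / (K + 1).succ ≤ 1 / 2 := by
    rw [norm_neg, div_le_iff₀ (by positivity)]
    push_cast
    linarith [(Nat.cast_nonneg K : (0 : ℝ) ≤ K)]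
  have h1 := Complex.exp_bound' hsmall
  rw [norm_neg] at h1
  have h2 : ‖P‖ ^ (K + 1) / (K + 1).factorial ≤ Real.exp K * (Real.exp (-(5 / 2) * K) / 20) := by
    calc ‖P‖ ^ (K + 1) / (K + 1).factorial ≤ (K / 20 : ℝ) ^ (K + 1) / (K + 1).factorial := by
          gcongr
      _ = (K : ℝ) ^ (K + 1) / (K + 1).factorial * ((1 / 20) ^ K / 20) := by
          rw [div_pow, one_div, inv_pow, pow_succ (20 : ℝ)]; field_simp
      _ ≤ Real.exp K * (Real.exp (-(5 / 2) * K) / 20) := by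
          gcongr
          · exact Real.pow_div_factorial_le_exp _ (Nat.cast_nonneg K) _
          · have h5 : Real.exp (5 / 2) ≤ 20 := by
              have h : Real.exp (5 / 2) ^ 2 ≤ 20 ^ 2 := by
                rw [← Real.exp_nat_mul]
                have : ((2 : ℕ) : ℝ) * (5 / 2) = ((5 : ℕ) : ℝ) * 1 := by norm_num
                rw [this, Real.exp_nat_mul]
                calc Real.exp 1 ^ 5 ≤ 2.7182818286 ^ 5 :=
                      pow_le_pow_left₀ (Real.exp_pos 1).le Real.exp_one_lt_d9.le 5
                  _ ≤ _ := by norm_num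
              exact le_of_sq_le_sq h (by norm_num)
            rw [mul_comm, Real.exp_nat_mul]
            refine pow_le_pow_left₀ (by norm_num) ?_ K
            rw [Real.exp_neg, ← one_div]
            exact one_div_le_one_div_of_le (Real.exp_pos _) h5
  have h3 : Complex.exp P * ∑ k ∈ Finset.range (K + 1), (-P) ^ k / k.factorial - 1
      = -(Complex.exp P * (Complex.exp (-P)
        - ∑ k ∈ Finset.range (K + 1), (-P) ^ k / k.factorial)) := by
    rw [mul_sub, ← Complex.exp_add, add_neg_cancel, Complex.exp_zero]
    ring
  have h4 : ‖Complex.exp P‖ ≤ Real.exp (K / 20) := (Complex.norm_exp_le_exp_norm P).trans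
    (Real.exp_le_exp.2 hP)
  rw [h3, norm_neg, norm_mul]
  calc ‖Complex.exp P‖ * ‖Complex.exp (-P)
        - ∑ k ∈ Finset.range (K + 1), (-P) ^ k / k.factorial‖
      ≤ Real.exp (K / 20) * (Real.exp K * (Real.exp (-(5 / 2) * K) / 20) * 2) := by
        gcongr
        exact h1.trans (by gcongr)
    _ = Real.exp (K / 20 + K + -(5 / 2) * K) / 10 := by
        rw [Real.exp_add, Real.exp_add]; ring
    _ ≤ Real.exp (-K) / 10 := by
        gcongr
        linarith [(Nat.cast_nonneg K : (0 : ℝ) ≤ K)]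

lemma norm_mul_exp_neg_sub_one_le {z D P M : ℂ} {e ε r κ : ℝ} (hz : ‖z - D‖ ≤ e)
    (hF : ‖D * M - 1‖ ≤ ε) (hP : ‖P‖ ≤ r) (hM : ‖Complex.exp P * M - 1‖ ≤ κ) (hκ : κ ≤ 1 / 2) :
    ‖z * Complex.exp (-P) - 1‖ ≤ 2 * (ε + κ) + e * Real.exp r := by
  set d : ℂ := Complex.exp P * M - 1 with hd
  have hd1 : 1 / 2 ≤ ‖1 + d‖ := by
    have := norm_sub_norm_le (1 : ℂ) (-d)
    rw [norm_one, norm_neg, sub_neg_eq_add] at this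
    linarith
  have hne : 1 + d ≠ 0 := norm_pos_iff.1 (by linarith)
  have hPM : Complex.exp (-P) * (1 + d) = M := by
    rw [hd, add_sub_cancel, ← mul_assoc, ← Complex.exp_add, neg_add_cancel, Complex.exp_zero,
      one_mul]
  have hkey : z * Complex.exp (-P) - 1
      = ((D * M - 1) - d) / (1 + d) + (z - D) * Complex.exp (-P) := by
    rw [← hPM]
    field_simp
    ring
  rw [hkey]
  refine (norm_add_le _ _).trans (add_le_add ?_ ?_)
  · rw [norm_div, div_le_iff₀ (by linarith)]
    have h1 := norm_sub_le (D * M - 1) d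
    have h2 := norm_nonneg (D * M - 1)
    have h3 := norm_nonneg d
    nlinarith
  · rw [norm_mul]
    gcongr
    · exact (norm_nonneg _).trans hz
    · exact (Complex.norm_exp_le_exp_norm _).trans (Real.exp_le_exp.2 (by rwa [norm_neg]))

lemma continuous_primePoly (Y : ℕ) (t : ℝ) : Continuous fun σ => primePoly Y σ t := by
  unfold primePoly dirPoly zetaChar
  refine continuous_finsetSum _ fun n hn => ?_
  have h0 : (n : ℝ) ≠ 0 := by
    have := (Finset.mem_Icc.1 hn).1
    exact_mod_cast (by omega : n ≠ 0)
  have h1 : Continuous fun σ : ℝ => (n : ℝ) ^ (-σ) :=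
    Continuous.rpow continuous_const (by fun_prop) fun _ => Or.inl h0
  fun_prop

lemma tendsto_primePoly (Y : ℕ) (t : ℝ) :
    Tendsto (fun σ => primePoly Y σ t) atTop (nhds 0) := by
  unfold primePoly dirPoly zetaChar
  rw [← Finset.sum_const_zero (ι := ℕ) (M := ℂ) (s := Finset.Icc 1 Y)]
  refine tendsto_finsetSum _ fun n hn => ?_
  have hn1 := (Finset.mem_Icc.1 hn).1
  rcases hn1.eq_or_lt with rfl | hn2
  · simp [logCoeff_one]
  · have h1 : (1 : ℝ) < n := by exact_mod_cast hn2
    have h2 : Tendsto (fun σ : ℝ => (n : ℝ) ^ (-σ)) atTop (nhds 0) := by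
      have h3 := (tendsto_rpow_atTop_of_base_lt_one (n : ℝ)⁻¹
        (by linarith [inv_pos.2 (zero_lt_one.trans h1)])
        (inv_lt_one_of_one_lt₀ h1))
      refine h3.congr fun σ => ?_
      rw [Real.inv_rpow (by linarith), Real.rpow_neg (by linarith)]
    have h4 := ((Complex.continuous_ofReal.tendsto _).comp h2).mul_const (osc n t)
    simpa using h4.const_smul (logCoeff n)

/-- If the mollified polynomial is close to `1` to the right of `σ₀` and the prime polynomial is
not too large there, then `log ζ` is well approximated by the prime polynomial. -/
theorem exists_logZetaRay_of_mollified {Y K N : ℕ} (hY : 1 ≤ Y) {σ₀ t e ε : ℝ} (ht : t ≠ 0)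
    (hζ : ∀ σ, σ₀ ≤ σ → ‖riemannZeta (σ + t * Complex.I) - dirPoly zetaR (zetaChar σ t) N‖ ≤ e)
    (hF : ∀ σ, σ₀ ≤ σ → ‖dirPoly (mollCoeff Y K N) (zetaChar σ t) (N * Y ^ K) - 1‖ ≤ ε)
    (hP : ∀ σ, σ₀ ≤ σ → ‖primePoly Y σ t‖ ≤ K / 20)
    (hη : 2 * (ε + Real.exp (-K) / 10) + e * Real.exp (K / 20) ≤ 1 / 2) :
    ∃ z, logZetaRay σ₀ t z ∧ ‖z - primePoly Y σ₀ t‖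
      ≤ 2 * (2 * (ε + Real.exp (-K) / 10) + e * Real.exp (K / 20)) := by
  refine exists_logZetaRay ht (continuous_primePoly Y t) (tendsto_primePoly Y t) hη
    fun σ hσ => ?_
  have h1 := hF σ hσ
  rw [dirPoly_mollCoeff hY] at h1
  refine norm_mul_exp_neg_sub_one_le (hζ σ hσ) h1 (hP σ hσ)
    (norm_exp_mul_sum_sub_one_le (hP σ hσ)) ?_
  have : Real.exp (-K) ≤ 1 := Real.exp_le_one_iff.2 (by simp)
  linarith

lemma rpow_neg_mul_exp {n : ℕ} (hn : n ≠ 0) (σ₀ w : ℝ) :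
    (n : ℝ) ^ (-σ₀) * Real.exp (-(w * Real.log n)) = (n : ℝ) ^ (-(σ₀ + w)) := by
  have hpos : (0 : ℝ) < n := by exact_mod_cast Nat.pos_of_ne_zero hn
  rw [Real.rpow_def_of_pos hpos, Real.rpow_def_of_pos hpos, ← Real.exp_add]
  congr 1
  ring

lemma dampPoly_eq_dirPoly (f : ArithmeticFunction ℝ) (σ₀ w t : ℝ) (B : ℕ) :
    dampPoly (fun n => ((f n * (n : ℝ) ^ (-σ₀) : ℝ) : ℂ)) B w t
      = dirPoly f (zetaChar (σ₀ + w) t) B := by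
  rw [dampPoly_eq]
  refine Finset.sum_congr rfl fun n hn => ?_
  have h0 : n ≠ 0 := by have := (Finset.mem_Icc.1 hn).1; omega
  rw [zetaChar, ← rpow_neg_mul_exp h0, Complex.real_smul]
  push_cast
  ring

lemma rpow_char_mul (s : ℝ) (m n : ℕ) (_ : m ≠ 0) (_ : n ≠ 0) :
    (((m * n : ℕ) : ℝ)) ^ s = (m : ℝ) ^ s * (n : ℝ) ^ s := by
  rw [Nat.cast_mul, Real.mul_rpow (Nat.cast_nonneg _) (Nat.cast_nonneg _)]

/-- A mean value bound, on the whole ray `σ ≥ σ₀`, for Dirichlet polynomials without constant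
term. -/
lemma volume_dirPoly_gt_le {f : ArithmeticFunction ℝ} (hf : f 1 = 0) (B : ℕ) (σ₀ : ℝ) {T : ℝ}
    (hT : 0 ≤ T) {α : ℝ} (hα : 0 < α) :
    MeasureTheory.volume {t | t ∈ Set.Icc T (2 * T) ∧
        ∃ σ, σ₀ ≤ σ ∧ 5 / 4 * α < ‖dirPoly f (zetaChar σ t) B‖}
      ≤ ENNReal.ofReal (2 * (Real.log B ^ 2 * ∑ n ∈ Finset.Icc 1 B,
        f n ^ 2 * (n : ℝ) ^ (-(2 * σ₀)) * (T + 6 * n * (1 + Real.log B))) / α ^ 2) := by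
  set a : ℕ → ℂ := fun n => ((f n * (n : ℝ) ^ (-σ₀) : ℝ) : ℂ) with ha
  have h := volume_dampPoly_gt_le (a := a) (by simp [ha, hf]) B hT hα
  refine (MeasureTheory.measure_mono ?_).trans (h.trans (ENNReal.ofReal_le_ofReal ?_))
  · rintro t ⟨ht, σ, hσ, hlt⟩
    refine ⟨ht, σ - σ₀, sub_nonneg.2 hσ, ?_⟩
    rwa [ha, dampPoly_eq_dirPoly, add_sub_cancel]
  · have hlB : 0 ≤ 1 + Real.log B := add_nonneg zero_le_one (Real.log_natCast_nonneg B)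
    gcongr 2 * ?_ / _
    rw [Finset.mul_sum]
    refine Finset.sum_le_sum fun n hn => ?_
    rw [Finset.mem_Icc] at hn
    have h1 : (1 : ℝ) ≤ n := by exact_mod_cast hn.1
    have hlog : Real.log n ^ 2 ≤ Real.log B ^ 2 := by
      have h2 : Real.log n ≤ Real.log B :=
        Real.log_le_log (by linarith) (by exact_mod_cast hn.2)
      exact pow_le_pow_left₀ (Real.log_nonneg h1) h2 2
    have hnorm : ‖a n‖ ^ 2 = f n ^ 2 * (n : ℝ) ^ (-(2 * σ₀)) := by
      rw [ha, Complex.norm_real, Real.norm_eq_abs, sq_abs, mul_pow,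
        ← Real.rpow_natCast ((n : ℝ) ^ (-σ₀)) 2,
        ← Real.rpow_mul (by linarith)]
      congr 2
      push_cast
      ring
    rw [hnorm]
    calc f n ^ 2 * (n : ℝ) ^ (-(2 * σ₀)) * Real.log n ^ 2 * (T + 6 * n * (1 + Real.log B))
        = Real.log n ^ 2 * (f n ^ 2 * (n : ℝ) ^ (-(2 * σ₀)) * (T + 6 * n * (1 + Real.log B))) := by
          ring
      _ ≤ _ := by gcongr

lemma sum_zetaR_pow_le {s : ℝ} (hs : 1 < s) {B : ℕ} (hB : 1 ≤ B) (k : ℕ) :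
    ∑ n ∈ Finset.Icc 1 B, (zetaR ^ k) n * (n : ℝ) ^ (-s) ≤ (riemannZeta s).re ^ k := by
  have h1 := dirPoly_pow_le (f := zetaR) (χ := fun n : ℕ => (n : ℝ) ^ (-s))
    (fun n => by positivity) (by simp) (rpow_char_mul (-s)) zetaR_nonneg hB k
  refine h1.trans (pow_le_pow_left₀ (dirPoly_nonneg (fun n => by positivity) zetaR_nonneg B) ?_ k)
  refine le_trans (Finset.sum_le_sum fun n _ => ?_) (sum_rpow_neg_le hs (Finset.Icc 1 B))
  rw [smul_eq_mul]
  exact mul_le_of_le_one_left (by positivity) (zetaR_le_one n)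

/-- Large values of the mollified polynomial minus one are rare. -/
theorem volume_mollified_gt_le {Y K N : ℕ} (hY : 1 ≤ Y) (hYN : Y ≤ N) {δ : ℝ} (hδ : 0 < δ)
    (hδ1 : δ ≤ 1) {T : ℝ} (hT : 0 ≤ T) {α : ℝ} (hα : 0 < α) :
    MeasureTheory.volume {t | t ∈ Set.Icc T (2 * T) ∧ ∃ σ, 1 / 2 + δ ≤ σ ∧
        5 / 4 * α < ‖dirPoly (mollCoeff Y K N) (zetaChar σ t) (N * Y ^ K) - 1‖}
      ≤ ENNReal.ofReal (2 * (Real.log (N * Y ^ K : ℕ) ^ 2 *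
        ((T * ((2 : ℝ)⁻¹ ^ K + (Y : ℝ) ^ (-δ)) +
          12 * (1 + Real.log (N * Y ^ K : ℕ)) * ((N * Y ^ K : ℕ) : ℝ) ^ (1 - δ)) *
          (riemannZeta (1 + δ : ℝ)).re ^ 9)) / α ^ 2) := by
  set B : ℕ := N * Y ^ K with hB
  have hB1 : 1 ≤ B := Nat.mul_pos (by omega) (Nat.pow_pos (by omega))
  set f : ArithmeticFunction ℝ := mollCoeff Y K N - 1 with hf
  have hf1 : f 1 = 0 := by
    rw [hf, sub_eq_add_neg, ArithmeticFunction.add_apply, ArithmeticFunction.neg_apply,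
      mollCoeff_one Y K (by omega), ArithmeticFunction.one_one]
    ring
  have hfn : ∀ n, 2 ≤ n → f n = mollCoeff Y K N n := fun n hn => by
    rw [hf, sub_eq_add_neg, ArithmeticFunction.add_apply, ArithmeticFunction.neg_apply,
      ArithmeticFunction.one_apply_ne (by omega), neg_zero, add_zero]
  have hdir : ∀ σ t, dirPoly f (zetaChar σ t) B
      = dirPoly (mollCoeff Y K N) (zetaChar σ t) B - 1 := fun σ t => by
    rw [← dirPoly_one (zetaChar_one σ t) hB1]
    simp [hf, dirPoly, sub_eq_add_neg, add_smul, Finset.sum_add_distrib]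
  have h := volume_dirPoly_gt_le hf1 B (1 / 2 + δ) hT hα
  simp only [hdir] at h
  refine h.trans (ENNReal.ofReal_le_ofReal ?_)
  have hlB : 0 ≤ 1 + Real.log B := add_nonneg zero_le_one (Real.log_natCast_nonneg B)
  have hZ := sum_zetaR_pow_le (s := 1 + δ) (by linarith) hB1 9
  set W : ℝ := T * ((2 : ℝ)⁻¹ ^ K + (Y : ℝ) ^ (-δ)) + 12 * (1 + Real.log B) * (B : ℝ) ^ (1 - δ)
    with hW
  have hW0 : 0 ≤ W := by positivity
  gcongr
  calc _ ≤ ∑ n ∈ Finset.Icc 1 B, W * ((zetaR ^ 9) n * (n : ℝ) ^ (-(1 + δ))) := ?_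
    _ ≤ _ := by
      rw [← Finset.mul_sum]
      gcongr
  refine Finset.sum_le_sum fun n hn => ?_
  rw [Finset.mem_Icc] at hn
  have h9 := arith_pow_nonneg zetaR_nonneg 9 n
  have hn0 : (0 : ℝ) < n := by exact_mod_cast (by omega : 0 < n)
  rcases hn.1.eq_or_lt with h1 | h2
  · rw [← h1, hf1]
    have : 0 ≤ W * ((zetaR ^ 9) 1 * ((1 : ℕ) : ℝ) ^ (-(1 + δ))) := by
      rw [← h1] at h9; positivity
    simpa using this
  have hpow : (n : ℝ) ^ (-(2 * (1 / 2 + δ))) = (n : ℝ) ^ (-(1 + δ)) * (n : ℝ) ^ (-δ) := by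
    rw [← Real.rpow_add hn0]
    congr 1
    ring
  have hinv : (n : ℝ) ^ (-δ) * n = (n : ℝ) ^ (1 - δ) := by
    rw [← Real.rpow_add_one hn0.ne']
    congr 1
    ring
  have hle : (n : ℝ) ^ (1 - δ) ≤ (B : ℝ) ^ (1 - δ) :=
    Real.rpow_le_rpow hn0.le (by exact_mod_cast hn.2) (by linarith)
  have hnδ : (n : ℝ) ^ (-δ) ≤ 1 :=
    Real.rpow_le_one_of_one_le_of_nonpos (by exact_mod_cast hn.1) (by linarith)
  set I : ℝ := (2 : ℝ)⁻¹ ^ K + if Y < n then 1 else 0 with hI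
  have hI2 : I ≤ 2 := by
    have : (2 : ℝ)⁻¹ ^ K ≤ 1 := pow_le_one₀ (by norm_num) (by norm_num)
    rw [hI]; split_ifs <;> linarith
  have hI0 : 0 ≤ I := by rw [hI]; split_ifs <;> positivity
  have hI3 : I * (n : ℝ) ^ (-δ) ≤ (2 : ℝ)⁻¹ ^ K + (Y : ℝ) ^ (-δ) := by
    rw [hI, add_mul]
    refine add_le_add (mul_le_of_le_one_right (by positivity) hnδ) ?_
    split_ifs with hYn
    · rw [one_mul]
      exact Real.rpow_le_rpow_of_nonpos (by exact_mod_cast hY) (by exact_mod_cast hYn.le)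
        (by linarith)
    · rw [zero_mul]; positivity
  have hmain : I * (n : ℝ) ^ (-δ) * (T + 6 * n * (1 + Real.log B)) ≤ W := by
    have e1 : I * (n : ℝ) ^ (-δ) * T ≤ T * ((2 : ℝ)⁻¹ ^ K + (Y : ℝ) ^ (-δ)) := by
      rw [mul_comm T]; gcongr
    have e2 : I * (n : ℝ) ^ (-δ) * (6 * n * (1 + Real.log B))
        ≤ 12 * (1 + Real.log B) * (B : ℝ) ^ (1 - δ) := by
      calc I * (n : ℝ) ^ (-δ) * (6 * n * (1 + Real.log B))
          = 6 * (1 + Real.log B) * I * (n : ℝ) ^ (1 - δ) := by rw [← hinv]; ring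
        _ ≤ 6 * (1 + Real.log B) * 2 * (B : ℝ) ^ (1 - δ) := by gcongr
        _ = _ := by ring
    rw [mul_add]
    exact add_le_add e1 e2
  calc f n ^ 2 * (n : ℝ) ^ (-(2 * (1 / 2 + δ))) * (T + 6 * n * (1 + Real.log B))
      ≤ ((zetaR ^ 9) n * I) * (n : ℝ) ^ (-(2 * (1 / 2 + δ))) * (T + 6 * n * (1 + Real.log B)) := by
        rw [hfn n h2]
        gcongr
        exact mollCoeff_sq_le hYN h2
    _ = (zetaR ^ 9) n * (n : ℝ) ^ (-(1 + δ)) *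
          (I * (n : ℝ) ^ (-δ) * (T + 6 * n * (1 + Real.log B))) := by
        rw [hpow]; ring
    _ ≤ (zetaR ^ 9) n * (n : ℝ) ^ (-(1 + δ)) * W := by gcongr
    _ = _ := by ring

lemma arithTrunc_logCoeff_pow_le (Y k n : ℕ) : (arithTrunc Y logCoeff ^ k) n ≤ k.factorial := by
  refine le_trans ?_ (logCoeff_pow_le k n)
  refine (le_abs_self _).trans (arith_pow_le_pow (fun m => ?_) k n)
  rw [abs_of_nonneg (arithTrunc_nonneg logCoeff_nonneg Y m), arithTrunc_apply]
  split_ifs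
  · exact le_rfl
  · exact logCoeff_nonneg m

lemma sum_arithTrunc_logCoeff_pow_le {s : ℝ} (hs : 1 < s) {Y : ℕ} (k : ℕ) :
    ∑ n ∈ Finset.Icc 1 (Y ^ k), (arithTrunc Y logCoeff ^ k) n * (n : ℝ) ^ (-s)
      ≤ Real.log (riemannZeta s).re ^ k := by
  have h1 := dirPoly_pow (f := arithTrunc Y logCoeff) (χ := fun n : ℕ => (n : ℝ) ^ (-s))
    (by simp) (rpow_char_mul (-s)) (fun n => arithTrunc_eq_zero _) k
  have h0 : ∀ n, 0 ≤ arithTrunc Y logCoeff n := arithTrunc_nonneg logCoeff_nonneg Y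
  refine h1.le.trans (pow_le_pow_left₀ (dirPoly_nonneg (fun n => by positivity) h0 Y) ?_ k)
  refine le_trans (Finset.sum_le_sum fun n hn => ?_)
    (sum_logCoeff_rpow_le hs (Finset.Icc 1 Y))
  rw [arithTrunc_apply, if_pos (Finset.mem_Icc.1 hn).2, smul_eq_mul]

/-- Large values of the prime polynomial to the right of `1/2 + δ` are rare. -/
theorem volume_primePoly_gt_le {Y k : ℕ} (hk : 1 ≤ k) {δ : ℝ} (hδ : 0 < δ)
    {T : ℝ} (hT : 0 ≤ T) (hTY : 6 * (Y ^ k : ℕ) * (1 + Real.log (Y ^ k : ℕ)) ≤ T)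
    {r : ℝ} (hr : 0 < r) :
    MeasureTheory.volume {t | t ∈ Set.Icc T (2 * T) ∧ ∃ σ, 1 / 2 + δ ≤ σ ∧
        r < ‖primePoly Y σ t‖}
      ≤ ENNReal.ofReal (2 * (Real.log (Y ^ k : ℕ) ^ 2 * (2 * T * (k.factorial *
        Real.log (riemannZeta (1 + 2 * δ : ℝ)).re ^ k))) / (4 / 5 * r ^ k) ^ 2) := by
  set B : ℕ := Y ^ k with hB
  set f : ArithmeticFunction ℝ := arithTrunc Y logCoeff ^ k with hf
  have h0 : ∀ n, 0 ≤ f n := arith_pow_nonneg (arithTrunc_nonneg logCoeff_nonneg Y) k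
  have hf1 : f 1 = 0 := by
    have h1 : arithTrunc Y logCoeff 1 = 0 := by
      rw [arithTrunc_apply, logCoeff_one, ite_self]
    rw [hf, arith_pow_apply_one, h1, zero_pow (by omega)]
  have hα : 0 < 4 / 5 * r ^ k := by positivity
  have h := volume_dirPoly_gt_le hf1 B (1 / 2 + δ) hT hα
  refine (MeasureTheory.measure_mono ?_).trans (h.trans (ENNReal.ofReal_le_ofReal ?_))
  · rintro t ⟨ht, σ, hσ, hlt⟩
    refine ⟨ht, σ, hσ, ?_⟩
    rw [hf, hB, dirPoly_pow (zetaChar_one σ t) (zetaChar_mul σ t) (fun n => arithTrunc_eq_zero _),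
      dirPoly_arithTrunc, norm_pow]
    calc 5 / 4 * (4 / 5 * r ^ k) = r ^ k := by ring
      _ < _ := pow_lt_pow_left₀ hlt hr.le (by omega)
  · have hlB : 0 ≤ 1 + Real.log B := add_nonneg zero_le_one (Real.log_natCast_nonneg B)
    have hsum := sum_arithTrunc_logCoeff_pow_le (s := 1 + 2 * δ) (by linarith) (Y := Y) k
    gcongr
    calc _ ≤ ∑ n ∈ Finset.Icc 1 B, 2 * T * (k.factorial * (f n * (n : ℝ) ^ (-(1 + 2 * δ)))) := ?_
      _ ≤ _ := by
        rw [← Finset.mul_sum, ← Finset.mul_sum]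
        gcongr
    refine Finset.sum_le_sum fun n hn => ?_
    rw [Finset.mem_Icc] at hn
    have hnB : (n : ℝ) ≤ B := by exact_mod_cast hn.2
    have hexp : -(2 * (1 / 2 + δ)) = -(1 + 2 * δ) := by ring
    rw [hexp]
    have hfk : f n ≤ k.factorial := arithTrunc_logCoeff_pow_le Y k n
    have hfn := h0 n
    calc f n ^ 2 * (n : ℝ) ^ (-(1 + 2 * δ)) * (T + 6 * n * (1 + Real.log B))
        ≤ (k.factorial * f n) * (n : ℝ) ^ (-(1 + 2 * δ)) * (T + 6 * B * (1 + Real.log B)) := by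
          rw [sq]; gcongr
      _ ≤ (k.factorial * f n) * (n : ℝ) ^ (-(1 + 2 * δ)) * (T + T) := by gcongr
      _ = _ := by ring

/-- Length of the prime polynomial, as a function of `L = log T`. -/
def cutY (L : ℝ) : ℕ := ⌊Real.exp √L⌋₊

/-- Number of terms of the truncated exponential, as a function of `L = log T`. -/
def cutK (θ L : ℝ) : ℕ := ⌊L ^ ((1 / 2 - θ) / 2)⌋₊

/-- Length of the zeta sum, as a function of `L = log T`. -/
def cutN (L : ℝ) : ℕ := ⌈2 * Real.exp L⌉₊

lemma eventually_exp_neg_mul_rpow_le {a c : ℝ} (ha : 0 < a) (hc : 0 < c) (m : ℕ) :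
    ∀ᶠ L : ℝ in atTop, Real.exp (-(c * L ^ a)) ≤ 1 / L ^ m := by
  have h1 := (tendsto_rpow_mul_exp_neg_mul_atTop_nhds_zero (m / a) c hc).comp
    (tendsto_rpow_atTop ha)
  filter_upwards [h1.eventually (gt_mem_nhds zero_lt_one), eventually_gt_atTop 0] with L hL hL0
  simp only [Function.comp_apply] at hL
  rw [← Real.rpow_mul hL0.le, mul_div_cancel₀ _ ha.ne', Real.rpow_natCast, neg_mul] at hL
  rw [le_div_iff₀ (by positivity), mul_comm]
  exact hL.le

lemma eventually_const_le_rpow {a : ℝ} (ha : 0 < a) (C : ℝ) : ∀ᶠ L : ℝ in atTop, C ≤ L ^ a :=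
  (tendsto_rpow_atTop ha).eventually_ge_atTop C

lemma eventually_const_mul_rpow_le {a b : ℝ} (hab : a < b) (C : ℝ) :
    ∀ᶠ L : ℝ in atTop, C * L ^ a ≤ L ^ b := by
  filter_upwards [eventually_const_le_rpow (sub_pos.2 hab) C, eventually_gt_atTop 0] with L hL hL0
  calc C * L ^ a ≤ L ^ (b - a) * L ^ a := by gcongr
    _ = L ^ b := by rw [← Real.rpow_add hL0, sub_add_cancel]

lemma half_le_floor {x : ℝ} (hx : 1 ≤ x) : x / 2 ≤ (⌊x⌋₊ : ℝ) := by
  have h1 := Nat.lt_floor_add_one x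
  have h2 : (1 : ℝ) ≤ (⌊x⌋₊ : ℝ) := by exact_mod_cast Nat.one_le_floor_iff x |>.2 hx
  linarith

lemma one_le_cutY (L : ℝ) : 1 ≤ cutY L :=
  (Nat.one_le_floor_iff _).2 (Real.one_le_exp (Real.sqrt_nonneg L))

lemma cutY_le (L : ℝ) : (cutY L : ℝ) ≤ Real.exp √L := Nat.floor_le (Real.exp_pos _).le

lemma cutY_rpow_neg_le {θ L : ℝ} (hθ : 0 < θ) (hL : 1 ≤ L) :
    (cutY L : ℝ) ^ (-(L ^ (-θ))) ≤ 2 * Real.exp (-(L ^ (1 / 2 - θ))) := by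
  have hL0 : 0 < L := by linarith
  have hδ1 : L ^ (-θ) ≤ 1 := Real.rpow_le_one_of_one_le_of_nonpos hL (by linarith)
  have hδ0 : 0 < L ^ (-θ) := by positivity
  have h1 : Real.exp √L / 2 ≤ cutY L := half_le_floor (Real.one_le_exp (Real.sqrt_nonneg L))
  calc (cutY L : ℝ) ^ (-(L ^ (-θ))) ≤ (Real.exp √L / 2) ^ (-(L ^ (-θ))) :=
        Real.rpow_le_rpow_of_nonpos (by positivity) h1 (by linarith)
    _ = Real.exp (-(L ^ (1 / 2 - θ))) * 2 ^ (L ^ (-θ)) := by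
        rw [Real.div_rpow (Real.exp_pos _).le (by norm_num),
          Real.rpow_neg (by norm_num : (0:ℝ) ≤ 2),
          div_inv_eq_mul, ← Real.exp_mul, Real.sqrt_eq_rpow, mul_neg, ← Real.rpow_add hL0,
          ← sub_eq_add_neg]
    _ ≤ Real.exp (-(L ^ (1 / 2 - θ))) * 2 ^ (1 : ℝ) := by
        gcongr
        norm_num
    _ = _ := by rw [Real.rpow_one]; ring

lemma two_inv_pow_cutK_le (θ : ℝ) {L : ℝ} :
    (2 : ℝ)⁻¹ ^ cutK θ L ≤ 2 * Real.exp (-(1 / 2 * L ^ ((1 / 2 - θ) / 2))) := by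
  have h1 := Nat.lt_floor_add_one (L ^ ((1 / 2 - θ) / 2))
  rw [← cutK] at h1
  have hlog1 : 1 / 2 ≤ Real.log 2 := by linarith [Real.log_two_gt_d9]
  have h2 : (2 : ℝ)⁻¹ ^ (cutK θ L + 1) ≤ Real.exp (-(1 / 2 * L ^ ((1 / 2 - θ) / 2))) := by
    have : (2 : ℝ)⁻¹ = Real.exp (-Real.log 2) := by
      rw [Real.exp_neg, Real.exp_log (by norm_num)]
    rw [this, ← Real.exp_nat_mul, Real.exp_le_exp]
    push_cast
    nlinarith [(Nat.cast_nonneg (cutK θ L) : (0 : ℝ) ≤ cutK θ L)]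
  rw [pow_succ] at h2
  linarith

lemma log_cutY_pow_le (L : ℝ) (k : ℕ) : Real.log ((cutY L ^ k : ℕ) : ℝ) ≤ k * √L := by
  rw [Nat.cast_pow, Real.log_pow]
  gcongr
  have h1 : (0 : ℝ) < cutY L := by exact_mod_cast one_le_cutY L
  calc Real.log (cutY L) ≤ Real.log (Real.exp √L) := Real.log_le_log h1 (cutY_le L)
    _ = √L := Real.log_exp _

lemma cutN_le {L : ℝ} (hL : 0 ≤ L) : (cutN L : ℝ) ≤ 3 * Real.exp L := by
  have h1 := Nat.ceil_lt_add_one (a := 2 * Real.exp L) (by positivity)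
  have h2 := Real.one_le_exp hL
  rw [cutN]
  linarith

lemma le_cutN (L : ℝ) : 2 * Real.exp L ≤ cutN L := Nat.le_ceil _

lemma cutY_le_cutN {L : ℝ} (hL : 1 ≤ L) : cutY L ≤ cutN L := by
  have h1 : Real.exp √L ≤ Real.exp L :=
    Real.exp_le_exp.2 (Real.sqrt_le_iff.2 ⟨by linarith, by nlinarith⟩)
  have h2 : (cutY L : ℝ) ≤ cutN L := by
    linarith [cutY_le L, le_cutN L, Real.exp_pos L]
  exact_mod_cast h2

/-- Length of the mollified polynomial, as a function of `L = log T`. -/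
def cutB (θ L : ℝ) : ℕ := cutN L * cutY L ^ cutK θ L

lemma log_cutB_le {θ L : ℝ} (hL : 1 ≤ L) :
    Real.log (cutB θ L) ≤ L + 2 + L ^ (1 / 2 + (1 / 2 - θ) / 2) := by
  have hL0 : 0 < L := by linarith
  have hN : (0 : ℝ) < cutN L := by linarith [le_cutN L, Real.exp_pos L]
  have hY : (0 : ℝ) < ((cutY L ^ cutK θ L : ℕ) : ℝ) := by
    exact_mod_cast Nat.pow_pos (one_le_cutY L)
  rw [cutB, Nat.cast_mul, Real.log_mul hN.ne' hY.ne']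
  refine add_le_add ?_ ?_
  · calc Real.log (cutN L) ≤ Real.log (3 * Real.exp L) := Real.log_le_log hN (cutN_le hL0.le)
      _ = Real.log 3 + L := by rw [Real.log_mul (by norm_num) (Real.exp_pos L).ne', Real.log_exp]
      _ ≤ L + 2 := by
        have := Real.log_le_sub_one_of_pos (show (0 : ℝ) < 3 by norm_num)
        linarith
  · refine (log_cutY_pow_le L _).trans ?_
    rw [Real.rpow_add hL0, ← Real.sqrt_eq_rpow, mul_comm]
    gcongr
    exact Nat.floor_le (by positivity)

section Parameters

variable {θ : ℝ}

lemma eventually_log_cutB_le (hθ0 : 0 < θ) :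
    ∀ᶠ L : ℝ in atTop, Real.log (cutB θ L) ≤ 2 * L := by
  have h1 := eventually_const_mul_rpow_le (a := 1 / 2 + (1 / 2 - θ) / 2) (b := 1)
    (by linarith) 2
  filter_upwards [h1, eventually_ge_atTop 4] with L h1 hL
  rw [Real.rpow_one] at h1
  linarith [log_cutB_le (θ := θ) (L := L) (by linarith)]

lemma eventually_cutB_rpow_le (hθ0 : 0 < θ) (hθ1 : θ < 1 / 2) :
    ∀ᶠ L : ℝ in atTop, (cutB θ L : ℝ) ^ (1 - L ^ (-θ))
      ≤ Real.exp L * Real.exp (-(1 / 2 * L ^ (1 - θ))) := by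
  have h1 := eventually_const_mul_rpow_le (a := 1 / 2 + (1 / 2 - θ) / 2) (b := 1 - θ)
    (by linarith) 4
  have h2 := eventually_const_le_rpow (a := 1 - θ) (by linarith) 8
  filter_upwards [h1, h2, eventually_ge_atTop 1] with L h1 h2 hL
  have hL0 : 0 < L := by linarith
  have hN : (0 : ℝ) < cutN L := by linarith [le_cutN L, Real.exp_pos L]
  have hB : (0 : ℝ) < cutB θ L := by
    rw [cutB]; push_cast
    have : (0 : ℝ) < cutY L := by exact_mod_cast one_le_cutY L
    positivity
  have hδ1 : L ^ (-θ) ≤ 1 := Real.rpow_le_one_of_one_le_of_nonpos hL (by linarith)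
  have hδ0 : 0 < L ^ (-θ) := by positivity
  have hmul : L * L ^ (-θ) = L ^ (1 - θ) := by
    rw [sub_eq_add_neg, Real.rpow_add hL0, Real.rpow_one]
  rw [Real.rpow_def_of_pos hB, ← Real.exp_add, Real.exp_le_exp]
  set R : ℝ := L ^ (1 / 2 + (1 / 2 - θ) / 2) with hR
  have hR0 : 0 ≤ R := by positivity
  calc Real.log (cutB θ L) * (1 - L ^ (-θ)) ≤ (L + 2 + R) * (1 - L ^ (-θ)) := by
        have := log_cutB_le (θ := θ) hL
        gcongr
    _ ≤ L - L ^ (1 - θ) + 2 + R := by rw [← hmul]; nlinarith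
    _ ≤ _ := by linarith

/-- All the errors in the mean value bound for the mollified polynomial are negligible. -/
lemma eventually_mollified_error_le (hθ0 : 0 < θ) (hθ1 : θ < 1 / 2) :
    ∀ᶠ L : ℝ in atTop,
      Real.exp L * ((2 : ℝ)⁻¹ ^ cutK θ L + (cutY L : ℝ) ^ (-(L ^ (-θ)))) +
          12 * (1 + Real.log (cutB θ L)) * (cutB θ L : ℝ) ^ (1 - L ^ (-θ))
        ≤ Real.exp L / L ^ 20 := by
  filter_upwards [eventually_log_cutB_le hθ0, eventually_cutB_rpow_le hθ0 hθ1,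
    eventually_exp_neg_mul_rpow_le (a := (1 / 2 - θ) / 2) (c := 1 / 2) (by linarith)
      (by norm_num) 24,
    eventually_exp_neg_mul_rpow_le (a := 1 / 2 - θ) (c := 1) (by linarith) (by norm_num) 24,
    eventually_exp_neg_mul_rpow_le (a := 1 - θ) (c := 1 / 2) (by linarith) (by norm_num) 24,
    eventually_ge_atTop 100] with L h1 h2 h3 h4 h5 hL
  have hL0 : 0 < L := by linarith
  have h6 := two_inv_pow_cutK_le θ (L := L)
  have h7 := cutY_rpow_neg_le hθ0 (L := L) (by linarith)
  rw [one_mul] at h4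
  set E := Real.exp L with hE
  have hE0 : 0 < E := Real.exp_pos L
  have h24 : 1 / L ^ 24 ≤ 1 / (10000 * L * L ^ 20) := by
    refine one_div_le_one_div_of_le (by positivity) ?_
    have : L ^ 24 = L ^ 3 * (L * L ^ 20) := by ring
    rw [this, mul_assoc]
    gcongr
    nlinarith [sq_nonneg (L - 100), mul_pos hL0 hL0]
  set u : ℝ := 1 / (10000 * L * L ^ 20) with hu
  have hu0 : 0 < u := by positivity
  calc E * ((2 : ℝ)⁻¹ ^ cutK θ L + (cutY L : ℝ) ^ (-(L ^ (-θ)))) +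
          12 * (1 + Real.log (cutB θ L)) * (cutB θ L : ℝ) ^ (1 - L ^ (-θ))
      ≤ E * (2 * u + 2 * u) + 12 * (1 + 2 * L) * (E * u) := by
        have h8 : (cutB θ L : ℝ) ^ (1 - L ^ (-θ)) ≤ E * u := h2.trans (by gcongr; linarith)
        have h9 := Real.log_natCast_nonneg (cutB θ L)
        gcongr <;> linarith
    _ = E * (u * (16 + 24 * L)) := by ring
    _ ≤ E * (1 / L ^ 20) := by
        gcongr
        rw [hu, div_mul_eq_mul_div, div_le_div_iff₀ (by positivity) (by positivity)]
        have : 0 < L ^ 20 := by positivity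
        nlinarith
    _ = _ := by ring

end Parameters

lemma norm_zeta_sub_dirPoly_le {L σ t : ℝ} (hL : 0 ≤ L) (hσ : 1 / 2 ≤ σ)
    (ht : t ∈ Set.Icc (Real.exp L) (2 * Real.exp L)) :
    ‖riemannZeta (σ + t * Complex.I) - dirPoly zetaR (zetaChar σ t) (cutN L)‖
      ≤ 6 * Real.exp (-(L / 2)) := by
  have hE := Real.exp_pos L
  have hE1 := Real.one_le_exp hL
  have ht0 : 0 < t := hE.trans_le ht.1
  have hN1 : 2 * Real.exp L ≤ (cutN L + 1 : ℕ) := by push_cast; linarith [le_cutN L]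
  have hN2 : ((cutN L + 1 : ℕ) : ℝ) ≤ 4 * Real.exp L := by push_cast; linarith [cutN_le hL]
  have h := norm_zeta_sub_sum_le (σ := σ) (t := t) (by linarith) ht0 (N := cutN L + 1)
    (by linarith [ht.2])
  have hsum : ∑ n ∈ Finset.Ico 1 (cutN L + 1), (n : ℂ) ^ (-((σ : ℂ) + t * Complex.I))
      = dirPoly zetaR (zetaChar σ t) (cutN L) := by
    refine Finset.sum_congr rfl fun n hn => ?_
    have h0 : n ≠ 0 := by have := (Finset.mem_Ico.1 hn).1; omega
    rw [zetaR_apply h0, one_smul, zetaChar, natCast_cpow_neg_eq_osc h0]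
  rw [hsum] at h
  refine h.trans ?_
  set lN : ℝ := Real.log (cutN L + 1 : ℕ) with hlN
  have hl1 : L ≤ lN := by
    rw [hlN, Real.le_log_iff_exp_le (by linarith)]
    linarith
  have hl2 : lN ≤ L + 2 * Real.log 2 := by
    have h4 : Real.log 4 = 2 * Real.log 2 := by
      rw [show (4 : ℝ) = 2 ^ 2 by norm_num, Real.log_pow]; norm_num
    calc lN ≤ Real.log (4 * Real.exp L) := Real.log_le_log (by linarith) hN2
      _ = L + 2 * Real.log 2 := by
        rw [Real.log_mul (by norm_num) hE.ne', Real.log_exp, h4]; ring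
  have e1 : Real.exp ((1 - σ) * lN) / t ≤ 2 * Real.exp (-(L / 2)) := by
    calc Real.exp ((1 - σ) * lN) / t ≤ Real.exp (L / 2 + Real.log 2) / Real.exp L := by
          gcongr
          · nlinarith
          · exact ht.1
      _ = 2 * Real.exp (-(L / 2)) := by
          rw [← Real.exp_sub, show L / 2 + Real.log 2 - L = Real.log 2 + -(L / 2) by ring,
            Real.exp_add, Real.exp_log (by norm_num)]
  have e2 : Real.exp (-σ * lN) ≤ Real.exp (-(L / 2)) := by
    rw [Real.exp_le_exp]; nlinarith
  linarith

section

variable {θ : ℝ}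

lemma eventually_delta_zeta_bounds (hθ0 : 0 < θ) :
    ∀ᶠ L : ℝ in atTop, (riemannZeta (1 + L ^ (-θ) : ℝ)).re ≤ 2 * L ^ θ ∧
      1 / 4 * L ^ θ ≤ (riemannZeta (1 + 2 * L ^ (-θ) : ℝ)).re ∧
      (riemannZeta (1 + 2 * L ^ (-θ) : ℝ)).re ≤ L ^ θ := by
  have h1 : Tendsto (fun L : ℝ => L ^ (-θ)) atTop (nhdsWithin 0 (Set.Ioi 0)) :=
    tendsto_nhdsWithin_iff.2 ⟨tendsto_rpow_neg_atTop hθ0, by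
      filter_upwards [eventually_gt_atTop 0] with L hL
      exact Real.rpow_pos_of_pos hL _⟩
  have h2 : Tendsto (fun L : ℝ => 2 * L ^ (-θ)) atTop (nhdsWithin 0 (Set.Ioi 0)) :=
    tendsto_nhdsWithin_iff.2 ⟨by simpa using (tendsto_rpow_neg_atTop hθ0).const_mul 2, by
      filter_upwards [eventually_gt_atTop 0] with L hL
      exact mul_pos two_pos (Real.rpow_pos_of_pos hL _)⟩
  filter_upwards [h1.eventually eventually_zeta_bounds, h2.eventually eventually_zeta_bounds,
    eventually_gt_atTop 0] with L h1 h2 hL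
  have hinv : L ^ (-θ) = (L ^ θ)⁻¹ := Real.rpow_neg hL.le θ
  have hpos : 0 < L ^ θ := Real.rpow_pos_of_pos hL θ
  rw [hinv] at h1 h2 ⊢
  refine ⟨h1.2.trans_eq (by field_simp), le_of_eq_of_le ?_ h2.1, h2.2.trans_eq (by field_simp)⟩
  field_simp
  norm_num

lemma eventually_volume_mollified_le (hθ0 : 0 < θ) (hθ1 : θ < 1 / 2) :
    ∀ᶠ L : ℝ in atTop,
      MeasureTheory.volume {t | t ∈ Set.Icc (Real.exp L) (2 * Real.exp L) ∧
        ∃ σ, 1 / 2 + L ^ (-θ) ≤ σ ∧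
        1 / L < ‖dirPoly (mollCoeff (cutY L) (cutK θ L) (cutN L)) (zetaChar σ t) (cutB θ L) - 1‖}
      ≤ ENNReal.ofReal (Real.exp L / L) := by
  filter_upwards [eventually_log_cutB_le hθ0, eventually_mollified_error_le hθ0 hθ1,
    eventually_delta_zeta_bounds hθ0, eventually_ge_atTop 100] with L h1 h2 h3 hL
  have hL0 : 0 < L := by linarith
  have hδ0 : 0 < L ^ (-θ) := by positivity
  have h := volume_mollified_gt_le (K := cutK θ L) (one_le_cutY L)
    (cutY_le_cutN (L := L) (by linarith)) hδ0
    (Real.rpow_le_one_of_one_le_of_nonpos (by linarith) (by linarith)) (Real.exp_pos L).le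
    (α := 4 / 5 / L) (by positivity)
  rw [← cutB, show 5 / 4 * (4 / 5 / L) = 1 / L by ring] at h
  refine h.trans (ENNReal.ofReal_le_ofReal ?_)
  have hθL : L ^ θ ≤ L := by
    conv_rhs => rw [← Real.rpow_one L]
    exact Real.rpow_le_rpow_of_exponent_le (by linarith) (by linarith)
  have hζ0 : 0 ≤ (riemannZeta (1 + L ^ (-θ) : ℝ)).re :=
    (hasSum_rpow_neg (by linarith)).nonneg fun n => by positivity
  have hζ : (riemannZeta (1 + L ^ (-θ) : ℝ)).re ≤ 2 * L := by linarith [h3.1]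
  have hlog := Real.log_natCast_nonneg (cutB θ L)
  calc _ ≤ 2 * ((2 * L) ^ 2 * (Real.exp L / L ^ 20 * (2 * L) ^ 9)) / (4 / 5 / L) ^ 2 := by
        gcongr
    _ = 6400 * Real.exp L / L ^ 7 := by field_simp; ring
    _ ≤ Real.exp L / L := by
        rw [div_le_div_iff₀ (by positivity) (by positivity)]
        have h6 : (6400 : ℝ) ≤ L ^ 6 := by
          calc (6400 : ℝ) ≤ 100 ^ 6 := by norm_num
            _ ≤ L ^ 6 := by gcongr
        calc 6400 * Real.exp L * L ≤ L ^ 6 * Real.exp L * L := by gcongr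
          _ = _ := by ring

lemma eventually_cutY_pow_le (k : ℕ) :
    ∀ᶠ L : ℝ in atTop,
      6 * ((cutY L ^ k : ℕ) : ℝ) * (1 + Real.log ((cutY L ^ k : ℕ) : ℝ)) ≤ Real.exp L := by
  have h1 := eventually_const_mul_rpow_le (a := 1 / 2) (b := 1) (by norm_num) (4 * k)
  filter_upwards [h1, eventually_ge_atTop 4] with L h1 hL
  rw [Real.rpow_one, ← Real.sqrt_eq_rpow] at h1
  have h2 : ((cutY L ^ k : ℕ) : ℝ) ≤ Real.exp (k * √L) := by
    rw [Nat.cast_pow, Real.exp_nat_mul]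
    exact pow_le_pow_left₀ (Nat.cast_nonneg _) (cutY_le L) k
  have h3 := log_cutY_pow_le L k
  have h4 := Real.add_one_le_exp (k * √L)
  have h5 := Real.log_natCast_nonneg (cutY L ^ k)
  have h6 : (6 : ℝ) ≤ Real.exp 2 := by
    rw [show (2 : ℝ) = ((2 : ℕ) : ℝ) * 1 by norm_num, Real.exp_nat_mul]
    nlinarith [Real.exp_one_gt_d9]
  calc 6 * ((cutY L ^ k : ℕ) : ℝ) * (1 + Real.log ((cutY L ^ k : ℕ) : ℝ))
      ≤ Real.exp 2 * Real.exp (k * √L) * Real.exp (k * √L) := by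
        gcongr
        linarith
    _ = Real.exp (2 + k * √L + k * √L) := by rw [Real.exp_add, Real.exp_add]
    _ ≤ Real.exp L := by rw [Real.exp_le_exp]; linarith

lemma eventually_volume_primePoly_le (hθ0 : 0 < θ) (hθ1 : θ < 1 / 2) :
    ∀ᶠ L : ℝ in atTop,
      MeasureTheory.volume {t | t ∈ Set.Icc (Real.exp L) (2 * Real.exp L) ∧
        ∃ σ, 1 / 2 + L ^ (-θ) ≤ σ ∧ (cutK θ L : ℝ) / 20 < ‖primePoly (cutY L) σ t‖}
      ≤ ENNReal.ofReal (Real.exp L / L) := by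
  set β : ℝ := (1 / 2 - θ) / 2 with hβ
  have hβ0 : 0 < β := by rw [hβ]; linarith
  obtain ⟨k, hk⟩ := exists_nat_ge (3 / (2 * β))
  have hk3 : 3 ≤ 2 * β * k := by rwa [div_le_iff₀' (by positivity)] at hk
  have hk1 : 1 ≤ k := by
    rcases Nat.eq_zero_or_pos k with rfl | h
    · norm_num at hk3
    · exact h
  set C : ℝ := 2 * k ^ 2 * 2 * k.factorial * (25 / 16) * 1600 ^ k with hC
  have hC0 : 0 < C := by positivity
  have hlog := (Real.isLittleO_pow_log_id_atTop (n := k)).bound (inv_pos.2 hC0)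
  filter_upwards [hlog, eventually_cutY_pow_le k, eventually_delta_zeta_bounds hθ0,
    eventually_const_le_rpow hβ0 1, eventually_const_le_rpow hθ0 4, eventually_ge_atTop 3]
    with L hlog h1 h2 h3 h4 hL
  have hL0 : 0 < L := by linarith
  have hδ0 : 0 < L ^ (-θ) := by positivity
  have hl0 : 0 ≤ Real.log L := Real.log_nonneg (by linarith)
  have hKl : L ^ β / 2 ≤ cutK θ L := half_le_floor h3
  have hr : 0 < (cutK θ L : ℝ) / 20 := by linarith
  have h := volume_primePoly_gt_le (Y := cutY L) hk1 hδ0 (Real.exp_pos L).le h1 hr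
  refine h.trans (ENNReal.ofReal_le_ofReal ?_)
  set Z := (riemannZeta (1 + 2 * L ^ (-θ) : ℝ)).re with hZ
  have hZ1 : 1 ≤ Z := by linarith [h2.2.1]
  have hlogZ0 : 0 ≤ Real.log Z := Real.log_nonneg hZ1
  have hlogZ : Real.log Z ≤ Real.log L := by
    calc Real.log Z ≤ Real.log (L ^ θ) := Real.log_le_log (by linarith) h2.2.2
      _ = θ * Real.log L := Real.log_rpow hL0 θ
      _ ≤ _ := by nlinarith
  have hlY := log_cutY_pow_le L k
  have hlY0 := Real.log_natCast_nonneg (cutY L ^ k)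
  have hlk : Real.log L ^ k ≤ C⁻¹ * L := by
    simpa [abs_of_nonneg hl0, abs_of_pos hL0] using hlog
  have hL3 : L ^ 3 ≤ (L ^ β) ^ (2 * k) := by
    rw [← Real.rpow_natCast (L ^ β), ← Real.rpow_mul hL0.le, ← Real.rpow_natCast L 3]
    refine Real.rpow_le_rpow_of_exponent_le (by linarith) ?_
    push_cast
    linarith
  have hden : (16 / 25 : ℝ) * (L ^ 3 / 1600 ^ k) ≤ (4 / 5 * ((cutK θ L : ℝ) / 20) ^ k) ^ 2 := by
    rw [mul_pow, ← pow_mul, mul_comm k 2]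
    have : L ^ 3 / 1600 ^ k ≤ ((cutK θ L : ℝ) / 20) ^ (2 * k) := by
      calc L ^ 3 / 1600 ^ k ≤ (L ^ β) ^ (2 * k) / 1600 ^ k := by gcongr
        _ = (L ^ β / 40) ^ (2 * k) := by
          rw [div_pow, pow_mul 40]; norm_num
        _ ≤ _ := by
          gcongr ?_ ^ _
          linarith
    calc (16 / 25 : ℝ) * (L ^ 3 / 1600 ^ k) = (4 / 5) ^ 2 * (L ^ 3 / 1600 ^ k) := by norm_num
      _ ≤ _ := by gcongr
  calc _ ≤ 2 * ((k * √L) ^ 2 * (2 * Real.exp L * (k.factorial * (C⁻¹ * L))))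
        / ((16 / 25 : ℝ) * (L ^ 3 / 1600 ^ k)) := by
        gcongr
        exact (pow_le_pow_left₀ hlogZ0 hlogZ k).trans hlk
    _ = C * C⁻¹ * (Real.exp L / L) := by
        rw [mul_pow, Real.sq_sqrt hL0.le, hC]
        field_simp
    _ = _ := by rw [mul_inv_cancel₀ hC0.ne', one_mul]

/-- Off a set of small measure, `log ζ(σ + it)` is well approximated by a prime polynomial. -/
theorem eventually_volume_not_logZetaRay_le (hθ0 : 0 < θ) (hθ1 : θ < 1 / 2) :
    ∀ᶠ L : ℝ in atTop,
      MeasureTheory.volume {t | t ∈ Set.Icc (Real.exp L) (2 * Real.exp L) ∧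
        ¬ ∃ z, logZetaRay (1 / 2 + L ^ (-θ)) t z ∧
          ‖z - primePoly (cutY L) (1 / 2 + L ^ (-θ)) t‖ ≤ 6 / L}
      ≤ ENNReal.ofReal (2 * Real.exp L / L) := by
  filter_upwards [eventually_volume_mollified_le hθ0 hθ1, eventually_volume_primePoly_le hθ0 hθ1,
    eventually_exp_neg_mul_rpow_le (a := (1 / 2 - θ) / 2) (c := 1 / 2) (by linarith)
      (by norm_num) 2,
    eventually_exp_neg_mul_rpow_le (a := 1) (c := 9 / 20) (by norm_num) (by norm_num) 2,
    eventually_ge_atTop 100] with L h1 h2 h3 h4 hL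
  have hL0 : 0 < L := by linarith
  refine (MeasureTheory.measure_mono ?_).trans ((MeasureTheory.measure_union_le _ _).trans
    ((add_le_add h1 h2).trans_eq ?_))
  swap
  · rw [← ENNReal.ofReal_add (by positivity) (by positivity)]
    congr 1
    ring
  rintro t ⟨ht, hno⟩
  by_contra hnot
  rw [Set.mem_union, not_or, Set.mem_ofPred_eq, Set.mem_ofPred_eq] at hnot
  have hF : ∀ σ, 1 / 2 + L ^ (-θ) ≤ σ →
      ‖dirPoly (mollCoeff (cutY L) (cutK θ L) (cutN L)) (zetaChar σ t) (cutB θ L) - 1‖ ≤ 1 / L :=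
    fun σ hσ => not_lt.1 fun h => hnot.1 ⟨ht, σ, hσ, h⟩
  have hP : ∀ σ, 1 / 2 + L ^ (-θ) ≤ σ → ‖primePoly (cutY L) σ t‖ ≤ cutK θ L / 20 :=
    fun σ hσ => not_lt.1 fun h => hnot.2 ⟨ht, σ, hσ, h⟩
  have hδ0 : 0 < L ^ (-θ) := by positivity
  have hK : (cutK θ L : ℝ) ≤ L := by
    refine (Nat.floor_le (by positivity)).trans ?_
    conv_rhs => rw [← Real.rpow_one L]
    exact Real.rpow_le_rpow_of_exponent_le (by linarith) (by linarith)
  have hexpK : Real.exp (-(cutK θ L : ℝ)) / 10 ≤ 2 / L ^ 2 := by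
    have e1 : Real.exp (-(cutK θ L : ℝ)) ≤ (2 : ℝ)⁻¹ ^ cutK θ L := by
      rw [show -(cutK θ L : ℝ) = (cutK θ L : ℝ) * (-1) by ring, Real.exp_nat_mul]
      refine pow_le_pow_left₀ (Real.exp_pos _).le ?_ _
      rw [Real.exp_neg]
      exact inv_anti₀ (by norm_num) (by linarith [Real.exp_one_gt_d9])
    have e2 := two_inv_pow_cutK_le θ (L := L)
    have e3 := Real.exp_pos (-(cutK θ L : ℝ))
    calc Real.exp (-(cutK θ L : ℝ)) / 10 ≤ 2 * (1 / L ^ 2) := by linarith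
      _ = _ := by ring
  have herr : 6 * Real.exp (-(L / 2)) * Real.exp (cutK θ L / 20) ≤ 6 / L ^ 2 := by
    rw [Real.rpow_one] at h4
    calc 6 * Real.exp (-(L / 2)) * Real.exp (cutK θ L / 20)
        = 6 * Real.exp (-(L / 2) + cutK θ L / 20) := by rw [Real.exp_add]; ring
      _ ≤ 6 * Real.exp (-(9 / 20 * L)) := by
        gcongr
        linarith
      _ ≤ 6 * (1 / L ^ 2) := by gcongr
      _ = _ := by ring
  have hη : 2 * (1 / L + Real.exp (-(cutK θ L : ℝ)) / 10)
      + 6 * Real.exp (-(L / 2)) * Real.exp (cutK θ L / 20) ≤ 3 / L := by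
    have e1 : 10 / L ^ 2 ≤ 1 / L := by
      rw [div_le_div_iff₀ (by positivity) (by positivity)]; nlinarith
    calc _ ≤ 2 * (1 / L + 2 / L ^ 2) + 6 / L ^ 2 := by gcongr
      _ = 2 / L + 10 / L ^ 2 := by ring
      _ ≤ 2 / L + 1 / L := by gcongr
      _ = _ := by ring
  have hη2 : 3 / L ≤ 1 / 2 := by
    rw [div_le_div_iff₀ hL0 (by norm_num)]; linarith
  obtain ⟨z, hz, hzP⟩ := exists_logZetaRay_of_mollified (one_le_cutY L)
    ((Real.exp_pos L).trans_le ht.1).ne'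
    (fun σ hσ => norm_zeta_sub_dirPoly_le hL0.le (by linarith) ht) hF hP (hη.trans hη2)
  refine hno ⟨z, hz, hzP.trans ?_⟩
  calc _ ≤ 2 * (3 / L) := by gcongr
    _ = _ := by ring

end

section
variable {θ : ℝ}

lemma eventually_sqLogSum_bounds (hθ0 : 0 < θ) (hθ1 : θ < 1 / 2) : ∀ᶠ L : ℝ in atTop,
    θ / 4 * Real.log L ≤ sqLogSum (1 + 2 * L ^ (-θ)) ∧
    sqLogSum (1 + 2 * L ^ (-θ)) ≤ Real.log L ∧
    Real.log (riemannZeta (1 + 2 * L ^ (-θ) : ℝ)).re ≤ Real.log L := by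
  filter_upwards [eventually_delta_zeta_bounds hθ0, eventually_gt_atTop 1,
    Real.tendsto_log_atTop.eventually_ge_atTop (4 * Real.log 2 / θ)] with L h1 hL h2
  obtain ⟨-, h1, h3⟩ := h1
  have hL0 : 0 < L := by linarith
  have hs : 1 < 1 + 2 * L ^ (-θ) := by have : 0 < L ^ (-θ) := by positivity
                                       linarith
  have hlog : Real.log (riemannZeta (1 + 2 * L ^ (-θ) : ℝ)).re ≤ Real.log L := by
    have h5 := Real.log_le_log (lt_of_lt_of_le (by positivity) h1) h3
    rw [Real.log_rpow hL0] at h5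
    nlinarith [Real.log_pos hL]
  refine ⟨?_, (sqLogSum_le hs).trans hlog, hlog⟩
  have h4 := log_zeta_le_two_mul_sqLogSum hs
  have h5 := Real.log_le_log (by positivity) h1
  rw [Real.log_mul (by norm_num) (by positivity), Real.log_rpow hL0,
    show (1 / 4 : ℝ) = (2 ^ 2)⁻¹ by norm_num, Real.log_inv, Real.log_pow] at h5
  rw [div_le_iff₀ hθ0] at h2
  have h6 := h5.trans h4
  push_cast at h6
  linarith

lemma tendsto_sqLogSum_atTop (hθ0 : 0 < θ) (hθ1 : θ < 1 / 2) :
    Tendsto (fun L : ℝ => sqLogSum (1 + 2 * L ^ (-θ))) atTop atTop :=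
  tendsto_atTop_mono' _ ((eventually_sqLogSum_bounds hθ0 hθ1).mono fun _ h => h.1)
    (Real.tendsto_log_atTop.const_mul_atTop (by positivity))

lemma eventually_sqLogSum_pow_le (hθ0 : 0 < θ) (hθ1 : θ < 1 / 2) (k : ℕ) :
    ∀ᶠ L : ℝ in atTop, sqLogSum (1 + 2 * L ^ (-θ)) ^ k ≤ L := by
  filter_upwards [eventually_sqLogSum_bounds hθ0 hθ1, eventually_gt_atTop 1,
    (Real.isLittleO_pow_log_id_atTop (n := k)).bound one_pos] with L h1 hL h2
  have hlog := Real.log_pos hL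
  rw [one_mul, Real.norm_of_nonneg (by positivity), id, Real.norm_of_nonneg (by linarith)] at h2
  refine (pow_le_pow_left₀ (le_trans (by positivity) h1.1) h1.2.1 k).trans h2

/-- The truncation of `sqLogSum` to `n ≤ cutY L`. -/
def varSum (θ L : ℝ) : ℝ :=
  ∑ n ∈ Finset.Icc 1 (cutY L), logCoeff n ^ 2 * (n : ℝ) ^ (-(1 + 2 * L ^ (-θ)))

lemma eventually_sqLogSum_sub_varSum_le (hθ0 : 0 < θ) (hθ1 : θ < 1 / 2) :
    ∀ᶠ L : ℝ in atTop, 0 ≤ sqLogSum (1 + 2 * L ^ (-θ)) - varSum θ L ∧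
      sqLogSum (1 + 2 * L ^ (-θ)) - varSum θ L ≤ 1 / L := by
  filter_upwards [eventually_delta_zeta_bounds hθ0, eventually_ge_atTop 4,
    eventually_exp_neg_mul_rpow_le (a := 1 / 2 - θ) (by linarith) one_pos 3] with L h1 hL h2
  have hL0 : 0 < L := by linarith
  have h3 := sqLogSum_sub_le (δ := L ^ (-θ)) (by positivity) (one_le_cutY L)
  refine ⟨h3.1, h3.2.trans ?_⟩
  rw [one_mul] at h2
  have h4 : L ^ θ ≤ L := by
    calc L ^ θ ≤ L ^ (1 : ℝ) := Real.rpow_le_rpow_of_exponent_le (by linarith) (by linarith)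
      _ = L := Real.rpow_one L
  calc (cutY L : ℝ) ^ (-(L ^ (-θ))) * (riemannZeta (1 + L ^ (-θ) : ℝ)).re
      ≤ (2 * (1 / L ^ 3)) * (2 * L) := by
        refine mul_le_mul ((cutY_rpow_neg_le hθ0 (by linarith)).trans (by linarith))
          (h1.1.trans (by linarith)) ?_ (by positivity)
        exact (hasSum_rpow_neg (by linarith [Real.rpow_pos_of_pos hL0 (-θ)])).nonneg
          fun n => by positivity
    _ = 4 / L ^ 2 := by field_simp; ring
    _ ≤ 1 / L := by
        rw [div_le_div_iff₀ (by positivity) hL0]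
        nlinarith

end

lemma norm_exp_mul_I_sub_taylor_le (x : ℝ) (n : ℕ) :
    ‖Complex.exp (x * Complex.I) - ∑ j ∈ Finset.range n, ((x : ℂ) * Complex.I) ^ j / j.factorial‖
      ≤ |x| ^ n / n.factorial := by
  set R : ℕ → ℝ → ℂ := fun n x =>
    Complex.exp (x * Complex.I) - ∑ j ∈ Finset.range n, ((x : ℂ) * Complex.I) ^ j / j.factorial
    with hR
  have hder : ∀ n x, HasDerivAt (R (n + 1)) (Complex.I * R n x) x := by
    intro n x
    have h1 : HasDerivAt (fun x : ℝ => (x : ℂ) * Complex.I) Complex.I x := by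
      simpa using (Complex.ofRealCLM.hasDerivAt (x := x)).mul_const Complex.I
    have h2 := h1.cexp
    have h3 : ∀ j : ℕ, HasDerivAt (fun x : ℝ => ((x : ℂ) * Complex.I) ^ j / (j.factorial : ℂ))
        (j * ((x : ℂ) * Complex.I) ^ (j - 1) * Complex.I / j.factorial) x := fun j =>
      (h1.pow j).div_const _
    have h4 := h2.sub (HasDerivAt.fun_sum fun j (_ : j ∈ Finset.range (n + 1)) => h3 j)
    refine h4.congr_deriv ?_
    rw [Finset.sum_range_succ', hR]
    simp only [Nat.cast_zero, zero_mul, zero_div, add_zero, add_tsub_cancel_right, mul_sub,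
      Finset.mul_sum]
    congr 1
    · ring
    · refine Finset.sum_congr rfl fun j _ => ?_
      rw [Nat.factorial_succ, Nat.cast_mul]
      have e1 : ((j.factorial : ℕ) : ℂ) ≠ 0 := by exact_mod_cast j.factorial_ne_zero
      have e2 : ((j + 1 : ℕ) : ℂ) ≠ 0 := by exact_mod_cast j.succ_ne_zero
      field_simp
  have hpos : ∀ n (x : ℝ), 0 ≤ x → ‖R n x‖ ≤ x ^ n / n.factorial := by
    intro n
    induction n with
    | zero => intro x _; simp [hR, Complex.norm_exp_ofReal_mul_I]
    | succ n ih =>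
      intro x hx
      refine image_norm_le_of_norm_deriv_right_le_deriv_boundary (a := 0) (b := x)
        (f' := fun y => Complex.I * R n y) (B := fun y => y ^ (n + 1) / (n + 1).factorial)
        (B' := fun y => y ^ n / n.factorial)
        (fun y _ => (hder n y).continuousAt.continuousWithinAt)
        (fun y _ => (hder n y).hasDerivWithinAt) ?_ (fun y => ?_) (fun y hy => ?_) ⟨hx, le_rfl⟩
      · simp [hR, Finset.sum_range_succ']
      · refine ((hasDerivAt_pow (n + 1) y).div_const _).congr_deriv ?_
        rw [Nat.factorial_succ, Nat.cast_mul]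
        have e1 : ((n.factorial : ℕ) : ℝ) ≠ 0 := by exact_mod_cast n.factorial_ne_zero
        have e2 : ((n + 1 : ℕ) : ℝ) ≠ 0 := by exact_mod_cast n.succ_ne_zero
        simp only [add_tsub_cancel_right]
        field_simp
      · rw [norm_mul, Complex.norm_I, one_mul]
        exact ih y hy.1
  rcases le_total 0 x with hx | hx
  · rw [abs_of_nonneg hx]
    exact hpos n x hx
  · have h1 := hpos n (-x) (by linarith)
    have h2 : R n (-x) = (starRingEnd ℂ) (R n x) := by
      simp [hR, ← Complex.exp_conj]
    rw [h2, Complex.norm_conj] at h1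
    rwa [abs_of_nonpos hx]

lemma ofReal_inner_pow (w p : ℂ) (j : ℕ) :
    ((inner ℝ w p : ℝ) : ℂ) ^ j = ∑ k ∈ Finset.range (j + 1),
      (2⁻¹ ^ j * (starRingEnd ℂ) w ^ k * w ^ (j - k) * j.choose k) *
        (p ^ k * (starRingEnd ℂ) p ^ (j - k)) := by
  have h : ((inner ℝ w p : ℝ) : ℂ)
      = 2⁻¹ * ((starRingEnd ℂ) w * p + w * (starRingEnd ℂ) p) := by
    rw [Complex.inner, Complex.re_eq_add_conj]
    simp only [map_mul, Complex.conj_conj]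
    ring
  rw [h, mul_pow, add_pow, Finset.mul_sum]
  refine Finset.sum_congr rfl fun k _ => ?_
  rw [mul_pow, mul_pow]
  ring

section
open MeasureTheory

variable {Ω Ω₁ Ω₂ : Type*} [MeasurableSpace Ω] [MeasurableSpace Ω₁] [MeasurableSpace Ω₂]

lemma integrable_of_bdd_measurable {μ : Measure Ω} [IsFiniteMeasure μ] {f : Ω → ℂ}
    (hf : Measurable f) {C : ℝ} (hC : ∀ ω, ‖f ω‖ ≤ C) : Integrable f μ :=
  Integrable.of_bound hf.aestronglyMeasurable C (Eventually.of_forall hC)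

lemma integrable_pow_mul_conj_pow {μ : Measure Ω} [IsFiniteMeasure μ] {P : Ω → ℂ}
    (hP : Measurable P) {C : ℝ} (hC : ∀ ω, ‖P ω‖ ≤ C) (j k : ℕ) :
    Integrable (fun ω => P ω ^ j * (starRingEnd ℂ) (P ω) ^ k) μ := by
  refine integrable_of_bdd_measurable (C := C ^ j * C ^ k)
    ((hP.pow_const j).mul ((Complex.continuous_conj.measurable.comp hP).pow_const k)) fun ω => ?_
  rw [norm_mul, norm_pow, norm_pow, Complex.norm_conj]
  have := (norm_nonneg _).trans (hC ω)
  gcongr <;> exact hC ω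

lemma integral_inner_pow {μ : Measure Ω} [IsFiniteMeasure μ] {P : Ω → ℂ}
    (hP : Measurable P) {C : ℝ} (hC : ∀ ω, ‖P ω‖ ≤ C) (w : ℂ) (j : ℕ) :
    ∫ ω, ((inner ℝ w (P ω) : ℝ) : ℂ) ^ j ∂μ = ∑ k ∈ Finset.range (j + 1),
      (2⁻¹ ^ j * (starRingEnd ℂ) w ^ k * w ^ (j - k) * j.choose k) *
        ∫ ω, P ω ^ k * (starRingEnd ℂ) (P ω) ^ (j - k) ∂μ := by
  simp_rw [ofReal_inner_pow]
  rw [integral_finsetSum _ fun k _ => (integrable_pow_mul_conj_pow hP hC _ _).const_mul _]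
  exact Finset.sum_congr rfl fun k _ => integral_const_mul _ _

lemma norm_integral_inner_pow_sub_le {μ₁ : Measure Ω₁} {μ₂ : Measure Ω₂} [IsFiniteMeasure μ₁]
    [IsFiniteMeasure μ₂] {P₁ : Ω₁ → ℂ} {P₂ : Ω₂ → ℂ} (hP₁ : Measurable P₁) (hP₂ : Measurable P₂)
    {C₁ C₂ : ℝ} (hC₁ : ∀ ω, ‖P₁ ω‖ ≤ C₁) (hC₂ : ∀ ω, ‖P₂ ω‖ ≤ C₂) {N : ℕ} {M : ℝ}
    (hM : ∀ j k, j + k ≤ N → ‖(∫ ω, P₁ ω ^ j * (starRingEnd ℂ) (P₁ ω) ^ k ∂μ₁) -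
      ∫ ω, P₂ ω ^ j * (starRingEnd ℂ) (P₂ ω) ^ k ∂μ₂‖ ≤ M) (w : ℂ) {j : ℕ} (hj : j ≤ N) :
    ‖(∫ ω, ((inner ℝ w (P₁ ω) : ℝ) : ℂ) ^ j ∂μ₁) - ∫ ω, ((inner ℝ w (P₂ ω) : ℝ) : ℂ) ^ j ∂μ₂‖
      ≤ ‖w‖ ^ j * M := by
  rw [integral_inner_pow hP₁ hC₁, integral_inner_pow hP₂ hC₂, ← Finset.sum_sub_distrib]
  simp_rw [← mul_sub]
  refine (norm_sum_le _ _).trans ?_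
  calc _ ≤ ∑ k ∈ Finset.range (j + 1), (2⁻¹ ^ j * ‖w‖ ^ j * (j.choose k : ℝ)) * M := by
        refine Finset.sum_le_sum fun k hk => ?_
        have hkj : k ≤ j := Finset.mem_range_succ_iff.1 hk
        rw [norm_mul]
        refine mul_le_mul (le_of_eq ?_) (hM _ _ (by omega)) (norm_nonneg _) (by positivity)
        simp only [norm_mul, norm_pow, Complex.norm_conj, norm_inv, Complex.norm_ofNat,
          Complex.norm_natCast]
        rw [mul_assoc (2⁻¹ ^ j), ← pow_add, Nat.add_sub_cancel' hkj]
    _ = ‖w‖ ^ j * M := by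
        rw [← Finset.sum_mul, ← Finset.mul_sum]
        have h : ∑ k ∈ Finset.range (j + 1), (j.choose k : ℝ) = 2 ^ j := by
          exact_mod_cast Nat.sum_range_choose j
        have h2 : (2⁻¹ : ℝ) ^ j * 2 ^ j = 1 := by rw [← mul_pow]; norm_num
        rw [h]
        linear_combination (‖w‖ ^ j * M) * h2

lemma norm_integral_exp_sub_taylor_le {μ : Measure Ω} [IsFiniteMeasure μ] {P : Ω → ℂ}
    (hP : Measurable P) {C : ℝ} (hC : ∀ ω, ‖P ω‖ ≤ C) (m : ℕ) (w : ℂ) :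
    ‖(∫ ω, Complex.exp ((inner ℝ w (P ω) : ℝ) * Complex.I) ∂μ) -
        ∑ j ∈ Finset.range (2 * m), Complex.I ^ j / j.factorial *
          ∫ ω, ((inner ℝ w (P ω) : ℝ) : ℂ) ^ j ∂μ‖
      ≤ ‖w‖ ^ (2 * m) / (2 * m).factorial *
        ‖∫ ω, P ω ^ m * (starRingEnd ℂ) (P ω) ^ m ∂μ‖ := by
  have hX : Measurable fun ω => inner ℝ w (P ω) := by fun_prop
  have hXb : ∀ ω, |inner ℝ w (P ω)| ≤ ‖w‖ * C := fun ω =>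
    (abs_real_inner_le_norm _ _).trans (by gcongr; exact hC ω)
  have hint : ∀ j : ℕ, Integrable (fun ω => ((inner ℝ w (P ω) : ℝ) : ℂ) ^ j) μ := fun j =>
    integrable_of_bdd_measurable (C := (‖w‖ * C) ^ j) (by fun_prop) fun ω => by
      rw [norm_pow, Complex.norm_real, Real.norm_eq_abs]
      gcongr
      exact hXb ω
  have hexp : Integrable (fun ω => Complex.exp ((inner ℝ w (P ω) : ℝ) * Complex.I)) μ :=
    integrable_of_bdd_measurable (C := 1) (by fun_prop) fun ω => by
      rw [Complex.norm_exp_ofReal_mul_I]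
  simp_rw [← integral_const_mul]
  rw [← integral_finsetSum _ fun j _ => (hint j).const_mul _,
    ← integral_sub hexp (integrable_finsetSum _ fun j _ => (hint j).const_mul _)]
  have hsq : ∀ ω, P ω ^ m * (starRingEnd ℂ) (P ω) ^ m = ((‖P ω‖ ^ (2 * m) : ℝ) : ℂ) := by
    intro ω
    rw [← mul_pow, Complex.mul_conj, Complex.normSq_eq_norm_sq, pow_mul]
    push_cast
    rfl
  simp_rw [hsq]
  rw [integral_complex_ofReal, Complex.norm_real,
    Real.norm_of_nonneg (integral_nonneg fun ω => by positivity), ← integral_const_mul]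
  refine norm_integral_le_of_norm_le ?_ (Eventually.of_forall fun ω => ?_)
  · refine Integrable.const_mul ?_ _
    refine Integrable.of_bound (by fun_prop) (C ^ (2 * m)) (Eventually.of_forall fun ω => ?_)
    rw [norm_pow, norm_norm]
    gcongr
    exact hC ω
  · have h := norm_exp_mul_I_sub_taylor_le (inner ℝ w (P ω)) (2 * m)
    have e : ∑ j ∈ Finset.range (2 * m), (((inner ℝ w (P ω) : ℝ) : ℂ) * Complex.I) ^ j / j.factorial
        = ∑ j ∈ Finset.range (2 * m),
          Complex.I ^ j / j.factorial * ((inner ℝ w (P ω) : ℝ) : ℂ) ^ j :=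
      Finset.sum_congr rfl fun j _ => by rw [mul_pow]; ring
    rw [e] at h
    refine h.trans ?_
    rw [div_mul_eq_mul_div, ← mul_pow]
    gcongr
    exact abs_real_inner_le_norm _ _

theorem norm_integral_exp_inner_sub_le {μ₁ : Measure Ω₁} {μ₂ : Measure Ω₂} [IsFiniteMeasure μ₁]
    [IsFiniteMeasure μ₂] {P₁ : Ω₁ → ℂ} {P₂ : Ω₂ → ℂ} (hP₁ : Measurable P₁) (hP₂ : Measurable P₂)
    {C₁ C₂ : ℝ} (hC₁ : ∀ ω, ‖P₁ ω‖ ≤ C₁) (hC₂ : ∀ ω, ‖P₂ ω‖ ≤ C₂) {m : ℕ} {M V : ℝ}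
    (hM : ∀ j k, j + k ≤ 2 * m → ‖(∫ ω, P₁ ω ^ j * (starRingEnd ℂ) (P₁ ω) ^ k ∂μ₁) -
      ∫ ω, P₂ ω ^ j * (starRingEnd ℂ) (P₂ ω) ^ k ∂μ₂‖ ≤ M)
    (hV : ‖∫ ω, P₂ ω ^ m * (starRingEnd ℂ) (P₂ ω) ^ m ∂μ₂‖ ≤ V) (w : ℂ) :
    ‖(∫ ω, Complex.exp ((inner ℝ w (P₁ ω) : ℝ) * Complex.I) ∂μ₁) -
        ∫ ω, Complex.exp ((inner ℝ w (P₂ ω) : ℝ) * Complex.I) ∂μ₂‖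
      ≤ M * Real.exp ‖w‖ + 2 * (‖w‖ ^ (2 * m) / (2 * m).factorial * V) := by
  have h1 := norm_integral_exp_sub_taylor_le (μ := μ₁) hP₁ hC₁ m w
  have h2 := norm_integral_exp_sub_taylor_le (μ := μ₂) hP₂ hC₂ m w
  have hV1 : ‖∫ ω, P₁ ω ^ m * (starRingEnd ℂ) (P₁ ω) ^ m ∂μ₁‖ ≤ V + M := by
    have := norm_add_le (∫ ω, P₂ ω ^ m * (starRingEnd ℂ) (P₂ ω) ^ m ∂μ₂)
      ((∫ ω, P₁ ω ^ m * (starRingEnd ℂ) (P₁ ω) ^ m ∂μ₁) -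
      ∫ ω, P₂ ω ^ m * (starRingEnd ℂ) (P₂ ω) ^ m ∂μ₂)
    rw [add_sub_cancel] at this
    exact this.trans (add_le_add hV (hM m m (by omega)))
  have hM0 : 0 ≤ M := (norm_nonneg _).trans (hM 0 0 (by omega))
  set S₁ := ∑ j ∈ Finset.range (2 * m), Complex.I ^ j / j.factorial *
          ∫ ω, ((inner ℝ w (P₁ ω) : ℝ) : ℂ) ^ j ∂μ₁
  set S₂ := ∑ j ∈ Finset.range (2 * m), Complex.I ^ j / j.factorial *
          ∫ ω, ((inner ℝ w (P₂ ω) : ℝ) : ℂ) ^ j ∂μ₂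
  have h3 : ‖S₁ - S₂‖ ≤ ∑ j ∈ Finset.range (2 * m), ‖w‖ ^ j / j.factorial * M := by
    rw [← Finset.sum_sub_distrib]
    simp_rw [← mul_sub]
    refine (norm_sum_le _ _).trans (Finset.sum_le_sum fun j hj => ?_)
    rw [norm_mul, norm_div, norm_pow, Complex.norm_I, one_pow, Complex.norm_natCast,
      div_mul_eq_mul_div, div_mul_eq_mul_div, one_mul]
    gcongr
    exact norm_integral_inner_pow_sub_le hP₁ hP₂ hC₁ hC₂ hM w (Finset.mem_range.1 hj).le
  have h4 : (∑ j ∈ Finset.range (2 * m), ‖w‖ ^ j / j.factorial * M)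
      + ‖w‖ ^ (2 * m) / (2 * m).factorial * M ≤ M * Real.exp ‖w‖ := by
    rw [← Finset.sum_mul, ← add_mul, ← Finset.sum_range_succ
      (fun j => ‖w‖ ^ j / (j.factorial : ℝ)), mul_comm]
    gcongr
    exact Real.sum_le_exp_of_nonneg (norm_nonneg w) _
  have h5 := norm_sub_le_norm_sub_add_norm_sub
    (∫ ω, Complex.exp ((inner ℝ w (P₁ ω) : ℝ) * Complex.I) ∂μ₁) S₁
    (∫ ω, Complex.exp ((inner ℝ w (P₂ ω) : ℝ) * Complex.I) ∂μ₂)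
  have h6 := norm_sub_le_norm_sub_add_norm_sub S₁ S₂
    (∫ ω, Complex.exp ((inner ℝ w (P₂ ω) : ℝ) * Complex.I) ∂μ₂)
  rw [norm_sub_rev] at h2
  have h7 : ‖w‖ ^ (2 * m) / (2 * m).factorial *
      ‖∫ ω, P₁ ω ^ m * (starRingEnd ℂ) (P₁ ω) ^ m ∂μ₁‖ ≤
      ‖w‖ ^ (2 * m) / (2 * m).factorial * (V + M) := by gcongr
  have h8 : ‖w‖ ^ (2 * m) / (2 * m).factorial *
      ‖∫ ω, P₂ ω ^ m * (starRingEnd ℂ) (P₂ ω) ^ m ∂μ₂‖ ≤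
      ‖w‖ ^ (2 * m) / (2 * m).factorial * V := by gcongr
  linarith

end

section
open MeasureTheory

/-- The completely multiplicative function `n ↦ ∏ x_p ^ {v_p(n)}` attached to independent
uniform points `x_p` of the circle, for `p ∈ s`. -/
def torusChar (s : Finset ℕ) (x : s → UnitAddCircle) (n : ℕ) : ℂ :=
  ∏ p : s, fourier (n.factorization p : ℤ) (x p)

/-- The uniform probability measure on the torus indexed by `s`. -/
def torusMeasure (s : Finset ℕ) : Measure (s → UnitAddCircle) :=
  Measure.pi fun _ => AddCircle.haarAddCircle

instance (s : Finset ℕ) : IsProbabilityMeasure (torusMeasure s) := by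
  unfold torusMeasure
  infer_instance

lemma torusChar_one (s : Finset ℕ) (x : s → UnitAddCircle) : torusChar s x 1 = 1 := by
  simp [torusChar]

lemma torusChar_mul (s : Finset ℕ) (x : s → UnitAddCircle) {m n : ℕ} (hm : m ≠ 0) (hn : n ≠ 0) :
    torusChar s x (m * n) = torusChar s x m * torusChar s x n := by
  rw [torusChar, torusChar, torusChar, ← Finset.prod_mul_distrib]
  refine Finset.prod_congr rfl fun p _ => ?_
  rw [Nat.factorization_mul hm hn, Finsupp.add_apply, Nat.cast_add, fourier_add]

lemma norm_torusChar (s : Finset ℕ) (x : s → UnitAddCircle) (n : ℕ) : ‖torusChar s x n‖ = 1 := by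
  rw [torusChar, norm_prod]
  exact Finset.prod_eq_one fun p _ => Circle.norm_coe _

lemma continuous_torusChar (s : Finset ℕ) (n : ℕ) : Continuous fun x => torusChar s x n := by
  unfold torusChar
  exact continuous_finsetProd _ fun p _ => (map_continuous _).comp (continuous_apply p)

lemma integral_fourier (k : ℤ) :
    ∫ x : UnitAddCircle, fourier k x ∂AddCircle.haarAddCircle = if k = 0 then 1 else 0 := by
  have h := congrFun (fourierCoeff_fourier (T := (1 : ℝ)) k) 0
  rw [fourierCoeff] at h
  simp only [neg_zero, fourier_zero, one_smul] at h
  rw [h, Pi.single_apply]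
  simp [eq_comm]

lemma integral_torusChar_mul_conj {s : Finset ℕ} {m n : ℕ} (hm : m ≠ 0) (hn : n ≠ 0)
    (hms : m.primeFactors ⊆ s) (hns : n.primeFactors ⊆ s) :
    ∫ x, torusChar s x m * (starRingEnd ℂ) (torusChar s x n) ∂torusMeasure s
      = if m = n then 1 else 0 := by
  have h : ∀ x : s → UnitAddCircle, torusChar s x m * (starRingEnd ℂ) (torusChar s x n)
      = ∏ p : s, fourier ((m.factorization p : ℤ) - n.factorization p) (x p) := by
    intro x
    rw [torusChar, torusChar, map_prod, ← Finset.prod_mul_distrib]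
    refine Finset.prod_congr rfl fun p _ => ?_
    rw [sub_eq_add_neg, fourier_add, fourier_neg]
  simp_rw [h]
  rw [torusMeasure, integral_fintype_prod_eq_prod
    (f := fun (p : s) x => fourier ((m.factorization p : ℤ) - n.factorization p) x)]
  simp_rw [integral_fourier]
  split_ifs with hmn
  · subst hmn
    simp
  · by_contra hne
    refine hmn (Nat.eq_of_factorization_eq hm hn fun p => ?_)
    by_cases hp : p ∈ s
    · have h2 := Finset.prod_ne_zero_iff.1 hne ⟨p, hp⟩ (Finset.mem_univ _)
      have h3 : ((m.factorization p : ℤ) - n.factorization p) = 0 := by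
        by_contra h4
        exact h2 (if_neg h4)
      omega
    · rw [Finsupp.notMem_support_iff.1 fun h => hp (hms h),
        Finsupp.notMem_support_iff.1 fun h => hp (hns h)]

/-- The random analogue of `zetaChar`. -/
def randChar (s : Finset ℕ) (σ : ℝ) (x : s → UnitAddCircle) (n : ℕ) : ℂ :=
  (((n : ℝ) ^ (-σ) : ℝ) : ℂ) * torusChar s x n

lemma randChar_one (s : Finset ℕ) (σ : ℝ) (x : s → UnitAddCircle) : randChar s σ x 1 = 1 := by
  simp [randChar, torusChar_one]

lemma randChar_mul (s : Finset ℕ) (σ : ℝ) (x : s → UnitAddCircle) (m n : ℕ) (hm : m ≠ 0)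
    (hn : n ≠ 0) : randChar s σ x (m * n) = randChar s σ x m * randChar s σ x n := by
  rw [randChar, randChar, randChar, torusChar_mul s x hm hn, Nat.cast_mul,
    Real.mul_rpow (Nat.cast_nonneg _) (Nat.cast_nonneg _), Complex.ofReal_mul]
  ring

lemma continuous_randChar (s : Finset ℕ) (σ : ℝ) (n : ℕ) :
    Continuous fun x => randChar s σ x n :=
  continuous_const.mul (continuous_torusChar s n)

lemma continuous_dirPoly_randChar (f : ArithmeticFunction ℝ) (s : Finset ℕ) (σ : ℝ) (B : ℕ) :
    Continuous fun x => dirPoly f (randChar s σ x) B :=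
  continuous_finsetSum _ fun n _ => (continuous_randChar s σ n).const_smul (f n)

lemma integral_dirPoly_randChar_mul_conj (f g : ArithmeticFunction ℝ) {s : Finset ℕ} {B : ℕ}
    (hs : ∀ p, p.Prime → p ≤ B → p ∈ s) (σ : ℝ) :
    ∫ x, dirPoly f (randChar s σ x) B * (starRingEnd ℂ) (dirPoly g (randChar s σ x) B)
      ∂torusMeasure s
      = ∑ n ∈ Finset.Icc 1 B, ((f n * (n : ℝ) ^ (-σ) : ℝ) : ℂ) *
          (starRingEnd ℂ) ((g n * (n : ℝ) ^ (-σ) : ℝ) : ℂ) := by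
  have hsub : ∀ n ∈ Finset.Icc 1 B, n.primeFactors ⊆ s := fun n hn p hp =>
    hs p (Nat.prime_of_mem_primeFactors hp)
      ((Nat.le_of_mem_primeFactors hp).trans (Finset.mem_Icc.1 hn).2)
  have h : ∀ x : s → UnitAddCircle,
      dirPoly f (randChar s σ x) B * (starRingEnd ℂ) (dirPoly g (randChar s σ x) B)
      = ∑ m ∈ Finset.Icc 1 B, ∑ n ∈ Finset.Icc 1 B,
        (((f m * (m : ℝ) ^ (-σ) : ℝ) : ℂ) * (starRingEnd ℂ) ((g n * (n : ℝ) ^ (-σ) : ℝ) : ℂ)) *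
          (torusChar s x m * (starRingEnd ℂ) (torusChar s x n)) := by
    intro x
    rw [dirPoly, dirPoly, map_sum, Finset.sum_mul_sum]
    refine Finset.sum_congr rfl fun m _ => Finset.sum_congr rfl fun n _ => ?_
    simp only [randChar, Complex.real_smul, map_mul, Complex.conj_ofReal, Complex.ofReal_mul]
    ring
  simp_rw [h]
  have hint : ∀ m n, Integrable (fun x => (((f m * (m : ℝ) ^ (-σ) : ℝ) : ℂ) *
      (starRingEnd ℂ) ((g n * (n : ℝ) ^ (-σ) : ℝ) : ℂ)) *
          (torusChar s x m * (starRingEnd ℂ) (torusChar s x n))) (torusMeasure s) := fun m n => by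
    refine Integrable.const_mul (integrable_of_bdd_measurable (C := 1) ?_ fun x => ?_) _
    · exact ((continuous_torusChar s m).mul
        (Complex.continuous_conj.comp (continuous_torusChar s n))).measurable
    · rw [norm_mul, Complex.norm_conj, norm_torusChar, norm_torusChar, one_mul]
  rw [integral_finsetSum _ fun m _ => integrable_finsetSum _ fun n _ => hint m n]
  refine Finset.sum_congr rfl fun m hm => ?_
  rw [integral_finsetSum _ fun n _ => hint m n, Finset.sum_eq_single m]
  · rw [integral_const_mul, integral_torusChar_mul_conj (by have := Finset.mem_Icc.1 hm; omega)
      (by have := Finset.mem_Icc.1 hm; omega) (hsub m hm) (hsub m hm), if_pos rfl, mul_one]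
  · intro n hn hnm
    rw [integral_const_mul, integral_torusChar_mul_conj (by have := Finset.mem_Icc.1 hm; omega)
      (by have := Finset.mem_Icc.1 hn; omega) (hsub m hm) (hsub n hn), if_neg hnm.symm, mul_zero]
  · exact fun h => absurd hm h

/-- The random analogue of `primePoly`. -/
def randPoly (s : Finset ℕ) (Y : ℕ) (σ : ℝ) (x : s → UnitAddCircle) : ℂ :=
  dirPoly logCoeff (randChar s σ x) Y

lemma dirPoly_logCoeff_pow {χ : ℕ → ℂ} (h1 : χ 1 = 1)
    (hχ : ∀ m n, m ≠ 0 → n ≠ 0 → χ (m * n) = χ m * χ n) {Y : ℕ} (hY : 1 ≤ Y) {j N : ℕ}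
    (hj : j ≤ N) :
    dirPoly logCoeff χ Y ^ j = dirPoly (arithTrunc Y logCoeff ^ j) χ (Y ^ N) := by
  have hf : ∀ n, Y < n → arithTrunc Y logCoeff n = 0 := fun n => arithTrunc_eq_zero _
  rw [dirPoly_eq_of_le (Nat.pow_le_pow_right hY hj) (arith_pow_eq_zero_of_lt hf j),
    dirPoly_pow h1 hχ hf, dirPoly_arithTrunc]

/-- Lebesgue measure on `[T, 2 * T]`, normalized. -/
def timeMeasure (T : ℝ) : Measure ℝ :=
  ENNReal.ofReal T⁻¹ • (volume.restrict (Set.Icc T (2 * T)))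

lemma isProbabilityMeasure_timeMeasure {T : ℝ} (hT : 0 < T) :
    IsProbabilityMeasure (timeMeasure T) := by
  constructor
  rw [timeMeasure, Measure.smul_apply, Measure.restrict_apply_univ, Real.volume_Icc, smul_eq_mul,
    ← ENNReal.ofReal_mul (by positivity), show T⁻¹ * (2 * T - T) = 1 by field_simp; ring,
    ENNReal.ofReal_one]

lemma integral_timeMeasure {T : ℝ} (hT : 0 < T) (f : ℝ → ℂ) :
    ∫ t, f t ∂timeMeasure T = (T : ℂ)⁻¹ * ∫ t in T..(2 * T), f t := by
  rw [timeMeasure, integral_smul_measure, ENNReal.toReal_ofReal (by positivity),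
    integral_Icc_eq_integral_Ioc, intervalIntegral.integral_of_le (by linarith),
    Complex.real_smul, Complex.ofReal_inv]

lemma dirPoly_zetaChar_eq_oscPoly (f : ArithmeticFunction ℝ) (σ t : ℝ) (B : ℕ) :
    dirPoly f (zetaChar σ t) B = oscPoly (fun n => ((f n * (n : ℝ) ^ (-σ) : ℝ) : ℂ)) B t :=
  Finset.sum_congr rfl fun n _ => by
    simp only [zetaChar, Complex.real_smul, Complex.ofReal_mul, mul_assoc]

lemma sum_arithTrunc_logCoeff_pow_le_pow {Y : ℕ} (hY : 1 ≤ Y) {σ : ℝ} (hσ : 0 ≤ σ) {j N : ℕ}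
    (hj : j ≤ N) :
    ∑ n ∈ Finset.Icc 1 (Y ^ N),
      ‖(((arithTrunc Y logCoeff ^ j) n * (n : ℝ) ^ (-σ) : ℝ) : ℂ)‖ ≤ (Y : ℝ) ^ j := by
  have hf : ∀ n, Y < n → arithTrunc Y logCoeff n = 0 := fun n => arithTrunc_eq_zero _
  have h0 := fun n => arith_pow_nonneg (arithTrunc_nonneg logCoeff_nonneg Y) j n
  have h1 : ((1 : ℕ) : ℝ) ^ (-σ) = 1 := by simp
  have h2 : ∀ m n : ℕ, m ≠ 0 → n ≠ 0 →
      ((m * n : ℕ) : ℝ) ^ (-σ) = (m : ℝ) ^ (-σ) * (n : ℝ) ^ (-σ) := fun m n _ _ => by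
    rw [Nat.cast_mul, Real.mul_rpow (Nat.cast_nonneg _) (Nat.cast_nonneg _)]
  have h3 := dirPoly_pow (χ := fun n : ℕ => (n : ℝ) ^ (-σ)) h1 h2 hf j
  rw [← dirPoly_eq_of_le (Nat.pow_le_pow_right hY hj) (arith_pow_eq_zero_of_lt hf j)] at h3
  calc _ = dirPoly (arithTrunc Y logCoeff ^ j) (fun n : ℕ => (n : ℝ) ^ (-σ)) (Y ^ N) := by
        refine Finset.sum_congr rfl fun n _ => ?_
        rw [Complex.norm_real, Real.norm_of_nonneg (mul_nonneg (h0 n) (by positivity)), smul_eq_mul]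
    _ = dirPoly (arithTrunc Y logCoeff) (fun n : ℕ => (n : ℝ) ^ (-σ)) Y ^ j := h3
    _ ≤ (Y : ℝ) ^ j := by
        refine pow_le_pow_left₀ (dirPoly_nonneg (fun n => by positivity)
          (arithTrunc_nonneg logCoeff_nonneg Y) Y) ?_ j
        calc _ ≤ ∑ n ∈ Finset.Icc 1 Y, (1 : ℝ) := by
              refine Finset.sum_le_sum fun n hn => ?_
              have hn1 : (1 : ℝ) ≤ n := by exact_mod_cast (Finset.mem_Icc.1 hn).1
              rw [smul_eq_mul, arithTrunc_apply, if_pos (Finset.mem_Icc.1 hn).2]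
              exact mul_le_one₀ (logCoeff_le_one n) (by positivity)
                (Real.rpow_le_one_of_one_le_of_nonpos hn1 (by linarith))
          _ = Y := by simp

theorem norm_integral_primePoly_sub_le {s : Finset ℕ} {Y : ℕ} (hY : 1 ≤ Y) {σ : ℝ} (hσ : 0 ≤ σ)
    {N : ℕ} (hs : ∀ p, p.Prime → p ≤ Y ^ N → p ∈ s) {T : ℝ} (hT : 0 < T) {j k : ℕ}
    (hjk : j + k ≤ N) :
    ‖(∫ t, primePoly Y σ t ^ j * (starRingEnd ℂ) (primePoly Y σ t) ^ k ∂timeMeasure T) -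
      ∫ x, randPoly s Y σ x ^ j * (starRingEnd ℂ) (randPoly s Y σ x) ^ k ∂torusMeasure s‖
      ≤ 2 * (Y : ℝ) ^ (2 * N) / T := by
  simp_rw [← map_pow, primePoly, randPoly,
    dirPoly_logCoeff_pow (zetaChar_one _ _) (zetaChar_mul _ _) hY (show j ≤ N by omega),
    dirPoly_logCoeff_pow (zetaChar_one _ _) (zetaChar_mul _ _) hY (show k ≤ N by omega),
    dirPoly_logCoeff_pow (randChar_one _ _ _) (randChar_mul _ _ _) hY (show j ≤ N by omega),
    dirPoly_logCoeff_pow (randChar_one _ _ _) (randChar_mul _ _ _) hY (show k ≤ N by omega)]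
  rw [integral_dirPoly_randChar_mul_conj _ _ hs, integral_timeMeasure hT]
  simp_rw [dirPoly_zetaChar_eq_oscPoly]
  have h := norm_integral_oscPoly_mul_conj_sub_le'
    (fun n => (((arithTrunc Y logCoeff ^ j) n * (n : ℝ) ^ (-σ) : ℝ) : ℂ))
    (fun n => (((arithTrunc Y logCoeff ^ k) n * (n : ℝ) ^ (-σ) : ℝ) : ℂ)) (Y ^ N) T
  have hT' : (T : ℂ) ≠ 0 := by exact_mod_cast hT.ne'
  set I := ∫ t in T..(2 * T), oscPoly
    (fun n => (((arithTrunc Y logCoeff ^ j) n * (n : ℝ) ^ (-σ) : ℝ) : ℂ)) (Y ^ N) t *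
    (starRingEnd ℂ) (oscPoly
      (fun n => (((arithTrunc Y logCoeff ^ k) n * (n : ℝ) ^ (-σ) : ℝ) : ℂ)) (Y ^ N) t)
  set D := ∑ n ∈ Finset.Icc 1 (Y ^ N),
    (((arithTrunc Y logCoeff ^ j) n * (n : ℝ) ^ (-σ) : ℝ) : ℂ) *
    (starRingEnd ℂ) (((arithTrunc Y logCoeff ^ k) n * (n : ℝ) ^ (-σ) : ℝ) : ℂ)
  have e : (T : ℂ)⁻¹ * I - D = (T : ℂ)⁻¹ * (I - T * D) := by field_simp
  rw [e, norm_mul, norm_inv, Complex.norm_real, Real.norm_of_nonneg hT.le, le_div_iff₀ hT,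
    mul_right_comm, inv_mul_cancel₀ hT.ne', one_mul]
  refine h.trans ?_
  have hY' : (1 : ℝ) ≤ Y := by exact_mod_cast hY
  calc _ ≤ 2 * ((Y ^ N : ℕ) : ℝ) * ((Y : ℝ) ^ j * (Y : ℝ) ^ k) := by
        gcongr
        · exact sum_arithTrunc_logCoeff_pow_le_pow hY hσ (by omega)
        · exact sum_arithTrunc_logCoeff_pow_le_pow hY hσ (by omega)
    _ = 2 * ((Y : ℝ) ^ N * (Y : ℝ) ^ (j + k)) := by push_cast; ring
    _ ≤ 2 * ((Y : ℝ) ^ N * (Y : ℝ) ^ N) := by gcongr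
    _ = _ := by ring

theorem norm_integral_randPoly_pow_le {s : Finset ℕ} {Y : ℕ} (hY : 1 ≤ Y) {σ : ℝ}
    (hσ : 1 / 2 < σ) {m : ℕ} (hs : ∀ p, p.Prime → p ≤ Y ^ m → p ∈ s) :
    ‖∫ x, randPoly s Y σ x ^ m * (starRingEnd ℂ) (randPoly s Y σ x) ^ m ∂torusMeasure s‖
      ≤ m.factorial * Real.log (riemannZeta (2 * σ : ℝ)).re ^ m := by
  simp_rw [← map_pow, randPoly,
    dirPoly_logCoeff_pow (randChar_one _ _ _) (randChar_mul _ _ _) hY (le_refl m)]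
  rw [integral_dirPoly_randChar_mul_conj _ _ hs]
  have h0 := fun n => arith_pow_nonneg (arithTrunc_nonneg logCoeff_nonneg Y) m n
  refine (norm_sum_le _ _).trans ?_
  refine le_trans ?_ (mul_le_mul_of_nonneg_left
    (sum_arithTrunc_logCoeff_pow_le (s := 2 * σ) (by linarith) (Y := Y) m) (by positivity))
  rw [Finset.mul_sum]
  refine Finset.sum_le_sum fun n hn => ?_
  have hn0 : (0 : ℝ) < n := by
    have := Finset.mem_Icc.1 hn
    exact_mod_cast this.1
  rw [Complex.conj_ofReal, ← Complex.ofReal_mul, Complex.norm_real,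
    Real.norm_of_nonneg (mul_self_nonneg _)]
  calc _ = (arithTrunc Y logCoeff ^ m) n * ((arithTrunc Y logCoeff ^ m) n *
        ((n : ℝ) ^ (-σ) * (n : ℝ) ^ (-σ))) := by ring
    _ ≤ m.factorial * ((arithTrunc Y logCoeff ^ m) n * ((n : ℝ) ^ (-σ) * (n : ℝ) ^ (-σ))) := by
        gcongr
        · exact mul_nonneg (h0 n) (by positivity)
        · exact arithTrunc_logCoeff_pow_le Y m n
    _ = _ := by rw [← Real.rpow_add hn0]; ring_nf

end

section
open MeasureTheory

variable {θ : ℝ}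

lemma eventually_sqLogSum_pow_le_rpow (hθ0 : 0 < θ) (hθ1 : θ < 1 / 2) (k : ℕ) {ε : ℝ}
    (hε : 0 < ε) : ∀ᶠ L : ℝ in atTop, sqLogSum (1 + 2 * L ^ (-θ)) ^ k ≤ L ^ ε := by
  filter_upwards [eventually_sqLogSum_bounds hθ0 hθ1, eventually_gt_atTop 1,
    (isLittleO_log_rpow_rpow_atTop (k : ℝ) hε).bound one_pos] with L h1 hL h2
  have hlog := Real.log_pos hL
  rw [one_mul, Real.norm_of_nonneg (by positivity), Real.norm_of_nonneg (by positivity),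
    Real.rpow_natCast] at h2
  exact (pow_le_pow_left₀ (le_trans (by positivity) h1.1) h1.2.1 k).trans h2

lemma pow_div_factorial_le_exp_sub {x : ℝ} (hx : 0 ≤ x) (m : ℕ) :
    x ^ m / m.factorial ≤ Real.exp (8 * x - 2 * m) := by
  have h1 := Real.pow_div_factorial_le_exp (8 * x) (by positivity) m
  have h2 : Real.exp (2 * m) ≤ 8 ^ m := by
    rw [mul_comm, Real.exp_nat_mul]
    gcongr
    have := Real.exp_one_lt_d9
    have h3 : Real.exp 2 = Real.exp 1 * Real.exp 1 := by rw [← Real.exp_add]; norm_num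
    have h4 := Real.exp_pos 1
    rw [h3]
    nlinarith
  rw [Real.exp_sub, le_div_iff₀ (Real.exp_pos _)]
  calc x ^ m / m.factorial * Real.exp (2 * m) ≤ x ^ m / m.factorial * 8 ^ m := by gcongr
    _ = (8 * x) ^ m / m.factorial := by rw [mul_pow]; ring
    _ ≤ _ := h1

lemma eventually_cutY_pow_div_exp_le (hθ0 : 0 < θ) (hθ1 : θ < 1 / 2) :
    ∀ᶠ L : ℝ in atTop, 2 * (cutY L : ℝ) ^ (2 * (2 * cutK θ L)) / Real.exp L * Real.exp √L
      ≤ 2 * Real.exp (-(L / 2)) := by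
  filter_upwards [eventually_const_mul_rpow_le (a := 1 / 2 + (1 / 2 - θ) / 2) (b := 1)
    (by linarith) 16, eventually_ge_atTop 16] with L h1 hL
  have hL0 : 0 < L := by linarith
  rw [Real.rpow_one, Real.rpow_add hL0, ← Real.sqrt_eq_rpow] at h1
  have hm : (cutK θ L : ℝ) ≤ L ^ ((1 / 2 - θ) / 2) := Nat.floor_le (by positivity)
  have hsq : √L * 4 ≤ L := by
    have h4 : 4 ≤ √L := Real.le_sqrt_of_sq_le (by linarith)
    nlinarith [Real.mul_self_sqrt hL0.le]
  calc _ ≤ 2 * Real.exp √L ^ (2 * (2 * cutK θ L)) / Real.exp L * Real.exp √L := by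
        gcongr
        exact cutY_le L
    _ = 2 * Real.exp (4 * (√L * cutK θ L) - L + √L) := by
        rw [← Real.exp_nat_mul, mul_div_assoc, ← Real.exp_sub, mul_assoc, ← Real.exp_add]
        push_cast
        ring_nf
    _ ≤ 2 * Real.exp (-(L / 2)) := by
        gcongr
        have : √L * cutK θ L ≤ √L * L ^ ((1 / 2 - θ) / 2) := by gcongr
        linarith

lemma norm_dirPoly_le {f : ArithmeticFunction ℝ} {χ : ℕ → ℂ} {g : ℕ → ℝ} (h : ∀ n, ‖χ n‖ = g n)
    {B : ℕ} : ‖dirPoly f χ B‖ ≤ ∑ n ∈ Finset.Icc 1 B, ‖f n‖ * g n := by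
  rw [dirPoly]
  refine (norm_sum_le _ _).trans (Finset.sum_le_sum fun n _ => ?_)
  rw [norm_smul, h]

/-- The primes entering the random model, as a function of `L = log T`. -/
def cutPrimes (θ L : ℝ) : Finset ℕ := Nat.primesBelow (cutY L ^ (2 * cutK θ L) + 1)

theorem eventually_norm_charFun_primePoly_sub_le (hθ0 : 0 < θ) (hθ1 : θ < 1 / 2) :
    ∀ᶠ L : ℝ in atTop, ∀ w : ℂ, ‖w‖ ≤ sqLogSum (1 + 2 * L ^ (-θ)) ^ 4 →
      ‖(∫ t, Complex.exp ((inner ℝ w (primePoly (cutY L) (1 / 2 + L ^ (-θ)) t) : ℝ) * Complex.I)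
          ∂timeMeasure (Real.exp L)) -
        ∫ x, Complex.exp ((inner ℝ w (randPoly (cutPrimes θ L) (cutY L) (1 / 2 + L ^ (-θ)) x) : ℝ)
          * Complex.I) ∂torusMeasure (cutPrimes θ L)‖ ≤ 1 / L := by
  have hβ : 0 < (1 / 2 - θ) / 2 := by linarith
  filter_upwards [eventually_sqLogSum_bounds hθ0 hθ1, eventually_ge_atTop 4,
    (tendsto_sqLogSum_atTop hθ0 hθ1).eventually_ge_atTop (4 / θ),
    eventually_cutY_pow_div_exp_le hθ0 hθ1,
    eventually_sqLogSum_pow_le_rpow hθ0 hθ1 4 (ε := 1 / 2) (by norm_num),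
    eventually_sqLogSum_pow_le_rpow hθ0 hθ1 10 (ε := (1 / 2 - θ) / 2 / 2) (by linarith),
    eventually_const_mul_rpow_le (a := (1 / 2 - θ) / 2 / 2) (b := (1 / 2 - θ) / 2) (by linarith) 16,
    eventually_exp_neg_mul_rpow_le (a := 1) (c := 1 / 2) one_pos (by norm_num) 2,
    eventually_exp_neg_mul_rpow_le (a := (1 / 2 - θ) / 2) (c := 1 / 2) hβ (by norm_num) 2,
    eventually_const_le_rpow hβ 1]
    with L hψ hL hψ1 hM hψ4 hψ10 hβ2 he1 he2 hLβ w hw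
  set ψ := sqLogSum (1 + 2 * L ^ (-θ))
  set m := cutK θ L
  have hL0 : 0 < L := by linarith
  have hψ0 : 0 < ψ := lt_of_lt_of_le (by positivity) hψ1
  have hδ0 : 0 < L ^ (-θ) := by positivity
  have hlogL : 0 < Real.log L := Real.log_pos (by linarith)
  have hprob := isProbabilityMeasure_timeMeasure (Real.exp_pos L)
  have hmemb : ∀ N ≤ 2 * m, ∀ p, p.Prime → p ≤ cutY L ^ N → p ∈ cutPrimes θ L :=
    fun N hN p hp hpN => Nat.mem_primesBelow.2
      ⟨Nat.lt_succ_of_le (hpN.trans (Nat.pow_le_pow_right (one_le_cutY L) hN)), hp⟩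
  have hPm : Measurable (primePoly (cutY L) (1 / 2 + L ^ (-θ))) := by
    have : primePoly (cutY L) (1 / 2 + L ^ (-θ)) = oscPoly _ (cutY L) :=
      funext fun t => dirPoly_zetaChar_eq_oscPoly _ _ t _
    rw [this]
    exact (continuous_oscPoly _ _).measurable
  have hRc := continuous_dirPoly_randChar logCoeff (cutPrimes θ L) (1 / 2 + L ^ (-θ)) (cutY L)
  obtain ⟨C₁, hC₁⟩ : ∃ C, ∀ t, ‖primePoly (cutY L) (1 / 2 + L ^ (-θ)) t‖ ≤ C :=
    ⟨_, fun t => norm_dirPoly_le fun n => by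
      rw [zetaChar, norm_mul, norm_osc, mul_one]⟩
  obtain ⟨C₂, hC₂⟩ : ∃ C, ∀ x, ‖randPoly (cutPrimes θ L) (cutY L) (1 / 2 + L ^ (-θ)) x‖ ≤ C :=
    ⟨_, fun x => norm_dirPoly_le fun n => by
      rw [randChar, norm_mul, norm_torusChar, mul_one]⟩
  have hlogζ : 0 ≤ Real.log (riemannZeta (1 + 2 * L ^ (-θ) : ℝ)).re :=
    hψ0.le.trans (sqLogSum_le (by linarith))
  have hV := norm_integral_randPoly_pow_le (one_le_cutY L) (σ := 1 / 2 + L ^ (-θ)) (by linarith)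
    (hmemb m (by omega))
  rw [show 2 * (1 / 2 + L ^ (-θ)) = 1 + 2 * L ^ (-θ) by ring] at hV
  have h := norm_integral_exp_inner_sub_le hPm hRc.measurable hC₁ hC₂ (fun j k hjk =>
    norm_integral_primePoly_sub_le (one_le_cutY L) (σ := 1 / 2 + L ^ (-θ)) (by positivity)
      (hmemb (2 * m) le_rfl) (Real.exp_pos L) hjk) hV w
  refine h.trans ?_
  have hlogψ : Real.log L ≤ ψ ^ 2 := by
    have h1 := hψ.1
    rw [div_le_iff₀ hθ0] at hψ1
    nlinarith
  have e1 : 2 * (cutY L : ℝ) ^ (2 * (2 * m)) / Real.exp L * Real.exp ‖w‖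
      ≤ 2 * (1 / L ^ 2) := by
    rw [← Real.sqrt_eq_rpow] at hψ4
    rw [Real.rpow_one] at he1
    calc _ ≤ 2 * (cutY L : ℝ) ^ (2 * (2 * m)) / Real.exp L * Real.exp √L := by
          gcongr
          exact hw.trans hψ4
      _ ≤ _ := hM
      _ ≤ _ := by
          gcongr
          rwa [div_eq_inv_mul, ← one_div]
  have e2 : ‖w‖ ^ (2 * m) / (2 * m).factorial *
      (m.factorial * Real.log (riemannZeta (1 + 2 * L ^ (-θ) : ℝ)).re ^ m) ≤ 1 / L ^ 2 := by
    have hfac : (m.factorial : ℝ) * m.factorial ≤ (2 * m).factorial := by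
      have := Nat.le_of_dvd (Nat.factorial_pos _)
        (Nat.factorial_mul_factorial_dvd_factorial_add m m)
      rw [← two_mul] at this
      exact_mod_cast this
    have hm0 : (0 : ℝ) < m.factorial := by exact_mod_cast m.factorial_pos
    calc _ ≤ (ψ ^ 4) ^ (2 * m) / (m.factorial * m.factorial) * (m.factorial * (ψ ^ 2) ^ m) := by
          gcongr
          exact hψ.2.2.trans hlogψ
      _ = (ψ ^ 10) ^ m / m.factorial := by
          field_simp
          ring
      _ ≤ Real.exp (8 * ψ ^ 10 - 2 * m) := pow_div_factorial_le_exp_sub (by positivity) m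
      _ ≤ Real.exp (-(1 / 2 * L ^ ((1 / 2 - θ) / 2))) := by
          have := half_le_floor hLβ
          gcongr
          change _ ≤ (m : ℝ) at this
          linarith
      _ ≤ _ := he2
  calc _ ≤ 2 * (1 / L ^ 2) + 2 * (1 / L ^ 2) := by gcongr
    _ = 4 / L ^ 2 := by ring
    _ ≤ 1 / L := by
        rw [div_le_div_iff₀ (by positivity) hL0]
        nlinarith

end

lemma sum_Icc_eq_sum_prime_pow {E : Type*} [AddCommMonoid E] {F : ℕ → E} {Y : ℕ}
    (hF : ∀ n, F n ≠ 0 → n ≤ Y ∧ IsPrimePow n) {s : Finset ℕ} (hs : ∀ p ∈ s, p.Prime)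
    (hsY : ∀ p, p.Prime → p ≤ Y → p ∈ s) :
    ∑ n ∈ Finset.Icc 1 Y, F n = ∑ p ∈ s, ∑ k ∈ Finset.Icc 1 Y, F (p ^ k) := by
  rw [← Finset.sum_product']
  refine (Finset.sum_bij_ne_zero (fun x _ _ => x.1 ^ x.2) ?_ ?_ ?_ ?_).symm
  · intro x hx h
    have h1 := (Finset.mem_product.1 hx).1
    exact Finset.mem_Icc.2 ⟨Nat.pow_pos (hs _ h1).pos, (hF _ h).1⟩
  · rintro ⟨p, k⟩ hx _ ⟨q, l⟩ hy _ h
    obtain ⟨h1, h2⟩ := Finset.mem_product.1 hx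
    obtain ⟨h3, h4⟩ := Finset.mem_product.1 hy
    simp only [Finset.mem_Icc] at h1 h2 h3 h4 h
    obtain ⟨k, rfl⟩ := Nat.exists_eq_succ_of_ne_zero (show k ≠ 0 by omega)
    obtain ⟨l, rfl⟩ := Nat.exists_eq_succ_of_ne_zero (show l ≠ 0 by omega)
    obtain ⟨e1, e2⟩ := Nat.Prime.pow_inj (hs _ h1) (hs _ h3) h
    simp [e1, e2]
  · intro n hn h
    obtain ⟨hnY, hpp⟩ := hF n h
    obtain ⟨p, k, hp, hk, rfl⟩ := (isPrimePow_nat_iff n).1 hpp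
    have hkY : k ≤ Y := (Nat.lt_pow_self hp.one_lt).le.trans hnY
    exact ⟨(p, k), Finset.mem_product.2
      ⟨hsY p hp ((Nat.le_self_pow hk.ne' p).trans hnY), Finset.mem_Icc.2 ⟨hk, hkY⟩⟩, h, rfl⟩
  · intro x _ _
    rfl

/-- The coefficient of `x ^ k` in the local factor at `p` of `randPoly`. -/
def localCoeff (Y : ℕ) (σ : ℝ) (p k : ℕ) : ℝ :=
  arithTrunc Y logCoeff (p ^ k) * ((p ^ k : ℕ) : ℝ) ^ (-σ)

/-- The local factor at `p` of `randPoly`. -/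
def localPoly (Y : ℕ) (σ : ℝ) (p : ℕ) (x : UnitAddCircle) : ℂ :=
  ∑ k ∈ Finset.Icc 1 Y, (localCoeff Y σ p k : ℂ) * fourier (k : ℤ) x

/-- The variance of the local factor at `p` of `randPoly`. -/
def localVar (Y : ℕ) (σ : ℝ) (p : ℕ) : ℝ := ∑ k ∈ Finset.Icc 1 Y, localCoeff Y σ p k ^ 2

lemma torusChar_prime_pow {s : Finset ℕ} (x : s → UnitAddCircle) (p : s) (hp : (p : ℕ).Prime)
    (k : ℕ) : torusChar s x ((p : ℕ) ^ k) = fourier (k : ℤ) (x p) := by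
  rw [torusChar, Finset.prod_eq_single p]
  · rw [hp.factorization_pow, Finsupp.single_eq_same]
  · intro q _ hq
    rw [hp.factorization_pow, Finsupp.single_eq_of_ne (fun h => hq (Subtype.ext h))]
    simp
  · exact fun h => absurd (Finset.mem_univ _) h

lemma randPoly_eq_sum_localPoly {s : Finset ℕ} {Y : ℕ} (hs : ∀ p ∈ s, p.Prime)
    (hsY : ∀ p, p.Prime → p ≤ Y → p ∈ s) (σ : ℝ) (x : s → UnitAddCircle) :
    randPoly s Y σ x = ∑ p : s, localPoly Y σ p (x p) := by
  rw [randPoly, ← dirPoly_arithTrunc, dirPoly, sum_Icc_eq_sum_prime_pow _ hs hsY,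
    ← Finset.sum_coe_sort s]
  · refine Finset.sum_congr rfl fun p _ => Finset.sum_congr rfl fun k _ => ?_
    rw [randChar, torusChar_prime_pow x p (hs p p.2), localCoeff, Complex.real_smul,
      Complex.ofReal_mul, mul_assoc]
  · intro n hn
    have h1 : arithTrunc Y logCoeff n ≠ 0 := fun h => hn (by rw [h, zero_smul])
    rw [arithTrunc_apply] at h1
    split_ifs at h1 with h2
    · exact ⟨h2, isPrimePow_of_logCoeff_ne_zero h1⟩
    · exact absurd rfl h1

lemma sum_localVar {s : Finset ℕ} {Y : ℕ} (hs : ∀ p ∈ s, p.Prime)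
    (hsY : ∀ p, p.Prime → p ≤ Y → p ∈ s) (σ : ℝ) :
    ∑ p ∈ s, localVar Y σ p
      = ∑ n ∈ Finset.Icc 1 Y, logCoeff n ^ 2 * (n : ℝ) ^ (-(2 * σ)) := by
  have h1 : ∀ n ∈ Finset.Icc 1 Y, logCoeff n ^ 2 * (n : ℝ) ^ (-(2 * σ))
      = (arithTrunc Y logCoeff n * (n : ℝ) ^ (-σ)) ^ 2 := fun n hn => by
    have hn0 : (0 : ℝ) < n := by exact_mod_cast (Finset.mem_Icc.1 hn).1
    rw [arithTrunc_apply, if_pos (Finset.mem_Icc.1 hn).2, mul_pow, ← Real.rpow_natCast (_ ^ (-σ)),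
      ← Real.rpow_mul hn0.le]
    congr 2
    push_cast
    ring
  rw [Finset.sum_congr rfl h1, sum_Icc_eq_sum_prime_pow _ hs hsY]
  · rfl
  · intro n hn
    have h1 : arithTrunc Y logCoeff n ≠ 0 := fun h => hn (by rw [h]; simp)
    rw [arithTrunc_apply] at h1
    split_ifs at h1 with h2
    · exact ⟨h2, isPrimePow_of_logCoeff_ne_zero h1⟩
    · exact absurd rfl h1

section
open MeasureTheory

lemma continuous_localPoly (Y : ℕ) (σ : ℝ) (p : ℕ) : Continuous (localPoly Y σ p) :=
  continuous_finsetSum _ fun _ _ => continuous_const.mul (map_continuous _)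

lemma localCoeff_nonneg (Y : ℕ) (σ : ℝ) (p k : ℕ) : 0 ≤ localCoeff Y σ p k :=
  mul_nonneg (arithTrunc_nonneg logCoeff_nonneg Y _) (by positivity)

lemma localCoeff_le (Y : ℕ) (σ : ℝ) (p k : ℕ) : localCoeff Y σ p k ≤ ((p : ℝ) ^ (-σ)) ^ k := by
  have h : (((p ^ k : ℕ) : ℝ)) ^ (-σ) = ((p : ℝ) ^ (-σ)) ^ k := by
    rw [Nat.cast_pow, ← Real.rpow_natCast, ← Real.rpow_natCast, ← Real.rpow_mul (Nat.cast_nonneg _),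
      ← Real.rpow_mul (Nat.cast_nonneg _), mul_comm]
  rw [localCoeff, h]
  refine mul_le_of_le_one_left (by positivity) ?_
  rw [arithTrunc_apply]
  split_ifs
  exacts [logCoeff_le_one _, zero_le_one]

lemma localCoeff_eq_zero {Y p : ℕ} (h : Y < p) (σ : ℝ) {k : ℕ} (hk : k ≠ 0) :
    localCoeff Y σ p k = 0 := by
  rw [localCoeff, arithTrunc_eq_zero _ (h.trans_le (Nat.le_self_pow hk p)), zero_mul]

lemma prime_rpow_neg_le {p : ℕ} (hp : p.Prime) {σ : ℝ} (hσ : 1 / 2 ≤ σ) :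
    (p : ℝ) ^ (-σ) ≤ 3 / 4 := by
  have hp2 : (2 : ℝ) ≤ p := by exact_mod_cast hp.two_le
  calc (p : ℝ) ^ (-σ) ≤ (2 : ℝ) ^ (-(1 / 2) : ℝ) :=
        (Real.rpow_le_rpow_of_nonpos two_pos hp2 (by linarith)).trans
          (Real.rpow_le_rpow_of_exponent_le one_le_two (by linarith))
    _ = (√2)⁻¹ := by rw [Real.rpow_neg two_pos.le, Real.sqrt_eq_rpow]
    _ ≤ 3 / 4 := by
        rw [inv_le_comm₀ (by positivity) (by norm_num)]
        exact Real.le_sqrt_of_sq_le (by norm_num)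

lemma sum_localCoeff_le {p : ℕ} (hp : p.Prime) {σ : ℝ} (hσ : 1 / 2 ≤ σ) (Y : ℕ) :
    ∑ k ∈ Finset.Icc 1 Y, localCoeff Y σ p k ≤ 4 * (p : ℝ) ^ (-σ) := by
  set q := (p : ℝ) ^ (-σ)
  have hq0 : 0 ≤ q := by positivity
  have hq1 : q ≤ 3 / 4 := prime_rpow_neg_le hp hσ
  have h1 : ∀ Y : ℕ, ∑ k ∈ Finset.Icc 1 Y, q ^ k ≤ 4 * q - 4 * q ^ (Y + 1) := by
    intro Y
    induction Y with
    | zero => simp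
    | succ n ih =>
      rw [Finset.sum_Icc_succ_top (by omega)]
      have : q ^ (n + 1 + 1) ≤ 3 / 4 * q ^ (n + 1) := by
        rw [pow_succ _ (n + 1), mul_comm]
        gcongr
      linarith
  calc _ ≤ ∑ k ∈ Finset.Icc 1 Y, q ^ k := Finset.sum_le_sum fun k _ => localCoeff_le Y σ p k
    _ ≤ 4 * q := by linarith [h1 Y, pow_nonneg hq0 (Y + 1)]

lemma norm_localPoly_le {p : ℕ} (hp : p.Prime) {σ : ℝ} (hσ : 1 / 2 ≤ σ) (Y : ℕ)
    (x : UnitAddCircle) : ‖localPoly Y σ p x‖ ≤ 4 * (p : ℝ) ^ (-σ) := by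
  refine le_trans ((norm_sum_le _ _).trans (Finset.sum_le_sum fun k _ => ?_))
    (sum_localCoeff_le hp hσ Y)
  rw [norm_mul, Complex.norm_real, Real.norm_of_nonneg (localCoeff_nonneg Y σ p k),
    show ‖fourier (k : ℤ) x‖ = 1 from Circle.norm_coe _, mul_one]

lemma localVar_nonneg (Y : ℕ) (σ : ℝ) (p : ℕ) : 0 ≤ localVar Y σ p :=
  Finset.sum_nonneg fun _ _ => sq_nonneg _

lemma localVar_le {p : ℕ} (hp : p.Prime) {σ : ℝ} (hσ : 1 / 2 ≤ σ) (Y : ℕ) :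
    localVar Y σ p ≤ 16 * ((p : ℝ) ^ (-σ)) ^ 2 := by
  calc localVar Y σ p ≤ (∑ k ∈ Finset.Icc 1 Y, localCoeff Y σ p k) ^ 2 :=
        Finset.sum_sq_le_sq_sum_of_nonneg fun k _ => localCoeff_nonneg Y σ p k
    _ ≤ (4 * (p : ℝ) ^ (-σ)) ^ 2 := by
        gcongr
        · exact Finset.sum_nonneg fun k _ => localCoeff_nonneg Y σ p k
        · exact sum_localCoeff_le hp hσ Y
    _ = _ := by ring

lemma le_localVar {p : ℕ} (hp : p.Prime) (σ : ℝ) {Y : ℕ} (hpY : p ≤ Y) :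
    ((p : ℝ) ^ (-σ)) ^ 2 ≤ localVar Y σ p := by
  have h1 : localCoeff Y σ p 1 = (p : ℝ) ^ (-σ) := by
    have h := logCoeff_prime_pow hp one_ne_zero
    rw [localCoeff, arithTrunc_apply, if_pos (by simpa using hpY), h]
    simp
  rw [← h1]
  exact Finset.single_le_sum (f := fun k => localCoeff Y σ p k ^ 2) (fun k _ => sq_nonneg _)
    (Finset.mem_Icc.2 ⟨le_rfl, hp.one_le.trans hpY⟩)

lemma integrable_fourier (k : ℤ) :
    Integrable (fun x : UnitAddCircle => (fourier k x : ℂ)) AddCircle.haarAddCircle :=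
  integrable_of_bdd_measurable (map_continuous _).measurable (C := 1)
    fun _ => (Circle.norm_coe _).le

lemma integral_localPoly (Y : ℕ) (σ : ℝ) (p : ℕ) :
    ∫ x, localPoly Y σ p x ∂AddCircle.haarAddCircle = 0 := by
  have h : ∀ x, localPoly Y σ p x
      = ∑ k ∈ Finset.Icc 1 Y, (localCoeff Y σ p k : ℂ) * fourier (k : ℤ) x := fun _ => rfl
  simp_rw [h]
  rw [integral_finsetSum _ fun k _ => (integrable_fourier _).const_mul _]
  refine Finset.sum_eq_zero fun k hk => ?_
  have := Finset.mem_Icc.1 hk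
  rw [integral_const_mul, integral_fourier, if_neg (by omega), mul_zero]

lemma integral_localPoly_sq (Y : ℕ) (σ : ℝ) (p : ℕ) :
    ∫ x, localPoly Y σ p x ^ 2 ∂AddCircle.haarAddCircle = 0 := by
  have h : ∀ x, localPoly Y σ p x ^ 2 = ∑ k ∈ Finset.Icc 1 Y, ∑ l ∈ Finset.Icc 1 Y,
      ((localCoeff Y σ p k : ℂ) * localCoeff Y σ p l) * fourier ((k : ℤ) + l) x := fun x => by
    rw [localPoly, sq, Finset.sum_mul_sum]
    refine Finset.sum_congr rfl fun k _ => Finset.sum_congr rfl fun l _ => ?_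
    rw [fourier_add]
    ring
  simp_rw [h]
  rw [integral_finsetSum _ fun k _ => integrable_finsetSum _ fun l _ =>
    (integrable_fourier _).const_mul _]
  refine Finset.sum_eq_zero fun k hk => ?_
  rw [integral_finsetSum _ fun l _ => (integrable_fourier _).const_mul _]
  refine Finset.sum_eq_zero fun l _ => ?_
  have := Finset.mem_Icc.1 hk
  rw [integral_const_mul, integral_fourier, if_neg (by omega), mul_zero]

lemma integral_localPoly_mul_conj (Y : ℕ) (σ : ℝ) (p : ℕ) :
    ∫ x, localPoly Y σ p x * (starRingEnd ℂ) (localPoly Y σ p x) ∂AddCircle.haarAddCircle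
      = localVar Y σ p := by
  have h : ∀ x, localPoly Y σ p x * (starRingEnd ℂ) (localPoly Y σ p x)
      = ∑ k ∈ Finset.Icc 1 Y, ∑ l ∈ Finset.Icc 1 Y,
        ((localCoeff Y σ p k : ℂ) * localCoeff Y σ p l) * fourier ((k : ℤ) + -l) x := fun x => by
    rw [localPoly, map_sum, Finset.sum_mul_sum]
    refine Finset.sum_congr rfl fun k _ => Finset.sum_congr rfl fun l _ => ?_
    rw [fourier_add, fourier_neg, map_mul, Complex.conj_ofReal]
    ring
  simp_rw [h]
  rw [integral_finsetSum _ fun k _ => integrable_finsetSum _ fun l _ =>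
    (integrable_fourier _).const_mul _, localVar, Complex.ofReal_sum]
  refine Finset.sum_congr rfl fun k hk => ?_
  rw [integral_finsetSum _ fun l _ => (integrable_fourier _).const_mul _,
    Finset.sum_eq_single k]
  · rw [integral_const_mul, integral_fourier, if_pos (by omega), mul_one, sq, Complex.ofReal_mul]
  · intro l _ hl
    rw [integral_const_mul, integral_fourier, if_neg (by omega), mul_zero]
  · exact fun h => absurd hk h

variable {Ω : Type*} [MeasurableSpace Ω]

lemma norm_integral_exp_inner_sub_quadratic_le {μ : Measure Ω} [IsProbabilityMeasure μ]
    {P : Ω → ℂ} (hP : Measurable P) {C : ℝ} (hC : ∀ ω, ‖P ω‖ ≤ C) {v : ℝ}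
    (h1 : ∫ ω, P ω ∂μ = 0) (h2 : ∫ ω, P ω ^ 2 ∂μ = 0)
    (h3 : ∫ ω, P ω * (starRingEnd ℂ) (P ω) ∂μ = v) (w : ℂ) :
    ‖(∫ ω, Complex.exp ((inner ℝ w (P ω) : ℝ) * Complex.I) ∂μ) - (1 - ‖w‖ ^ 2 * v / 4 : ℝ)‖
      ≤ (‖w‖ * C) ^ 3 / 6 := by
  have hconj : ∀ n : ℕ, ∫ ω, (starRingEnd ℂ) (P ω) ^ n ∂μ = (starRingEnd ℂ) (∫ ω, P ω ^ n ∂μ) :=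
    fun n => by simp_rw [← map_pow]; exact integral_conj
  have m1 := integral_inner_pow (μ := μ) hP hC w 1
  have m2 := integral_inner_pow (μ := μ) hP hC w 2
  have c1 := hconj 1
  have c2 := hconj 2
  simp only [pow_one] at c1
  simp only [Finset.sum_range_succ, Finset.range_zero, Finset.sum_empty, pow_zero, pow_one,
    Nat.sub_zero, Nat.sub_self, one_mul, mul_one, zero_add, c1, h1, map_zero, mul_zero,
    add_zero, c2, h2, h3, Nat.choose_one_right, Nat.reduceSub] at m1 m2
  have hX : Measurable fun ω => inner ℝ w (P ω) := by fun_prop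
  have hXb : ∀ ω, |inner ℝ w (P ω)| ≤ ‖w‖ * C := fun ω =>
    (abs_real_inner_le_norm _ _).trans (by gcongr; exact hC ω)
  have hint : ∀ j : ℕ, Integrable (fun ω => ((inner ℝ w (P ω) : ℝ) : ℂ) ^ j) μ := fun j =>
    integrable_of_bdd_measurable (C := (‖w‖ * C) ^ j) (by fun_prop) fun ω => by
      rw [norm_pow, Complex.norm_real, Real.norm_eq_abs]
      gcongr
      exact hXb ω
  have hexp : Integrable (fun ω => Complex.exp ((inner ℝ w (P ω) : ℝ) * Complex.I)) μ :=
    integrable_of_bdd_measurable (C := 1) (by fun_prop) fun ω => by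
      rw [Complex.norm_exp_ofReal_mul_I]
  have hw : (starRingEnd ℂ) w * w = ((‖w‖ ^ 2 : ℝ) : ℂ) := by
    rw [mul_comm, Complex.mul_conj, Complex.normSq_eq_norm_sq]
  have hT : ∫ ω, ∑ j ∈ Finset.range 3,
      Complex.I ^ j / j.factorial * ((inner ℝ w (P ω) : ℝ) : ℂ) ^ j ∂μ
      = (1 - ‖w‖ ^ 2 * v / 4 : ℝ) := by
    rw [integral_finsetSum _ fun j _ => (hint j).const_mul _]
    simp only [integral_const_mul, Finset.sum_range_succ, Finset.range_zero, Finset.sum_empty,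
      pow_one, m1, m2, pow_zero, integral_const, probReal_univ, one_smul]
    push_cast at hw ⊢
    simp only [Nat.factorial, Complex.I_sq]
    push_cast
    linear_combination (-(v : ℂ) / 4) * hw
  rw [← hT, ← integral_sub hexp (integrable_finsetSum _ fun j _ => (hint j).const_mul _)]
  have hb : ∀ ω, ‖Complex.exp ((inner ℝ w (P ω) : ℝ) * Complex.I) - ∑ j ∈ Finset.range 3,
      Complex.I ^ j / j.factorial * ((inner ℝ w (P ω) : ℝ) : ℂ) ^ j‖ ≤ (‖w‖ * C) ^ 3 / 6 := by
    intro ω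
    have h := norm_exp_mul_I_sub_taylor_le (inner ℝ w (P ω)) 3
    have e : ∑ j ∈ Finset.range 3, (((inner ℝ w (P ω) : ℝ) : ℂ) * Complex.I) ^ j / j.factorial
        = ∑ j ∈ Finset.range 3, Complex.I ^ j / j.factorial * ((inner ℝ w (P ω) : ℝ) : ℂ) ^ j :=
      Finset.sum_congr rfl fun j _ => by rw [mul_pow]; ring
    rw [e, show ((Nat.factorial 3 : ℕ) : ℝ) = 6 by norm_num [Nat.factorial]] at h
    refine h.trans ?_
    gcongr
    exact hXb ω
  simpa using norm_integral_le_of_norm_le_const (μ := μ) (Eventually.of_forall hb)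

end

section
open MeasureTheory

/-- The characteristic function of the local factor at `p` of `randPoly`. -/
def localCharFun (Y : ℕ) (σ : ℝ) (p : ℕ) (w : ℂ) : ℂ :=
  ∫ x, Complex.exp ((inner ℝ w (localPoly Y σ p x) : ℝ) * Complex.I) ∂AddCircle.haarAddCircle

lemma integral_exp_inner_randPoly {s : Finset ℕ} {Y : ℕ} (hs : ∀ p ∈ s, p.Prime)
    (hsY : ∀ p, p.Prime → p ≤ Y → p ∈ s) (σ : ℝ) (w : ℂ) :
    ∫ x, Complex.exp ((inner ℝ w (randPoly s Y σ x) : ℝ) * Complex.I) ∂torusMeasure s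
      = ∏ p ∈ s, localCharFun Y σ p w := by
  have h : ∀ x, Complex.exp ((inner ℝ w (randPoly s Y σ x) : ℝ) * Complex.I)
      = ∏ p : s, Complex.exp ((inner ℝ w (localPoly Y σ p (x p)) : ℝ) * Complex.I) := fun x => by
    rw [randPoly_eq_sum_localPoly hs hsY, inner_sum, Complex.ofReal_sum, Finset.sum_mul,
      Complex.exp_sum]
  simp_rw [h]
  rw [torusMeasure, integral_fintype_prod_eq_prod (f := fun (p : s) x =>
    Complex.exp ((inner ℝ w (localPoly Y σ p x) : ℝ) * Complex.I)), ← Finset.prod_coe_sort s]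
  rfl

lemma norm_localCharFun_le_one (Y : ℕ) (σ : ℝ) (p : ℕ) (w : ℂ) :
    ‖localCharFun Y σ p w‖ ≤ 1 := by
  have h : ∀ x, ‖Complex.exp ((inner ℝ w (localPoly Y σ p x) : ℝ) * Complex.I)‖ ≤ 1 :=
    fun x => (Complex.norm_exp_ofReal_mul_I _).le
  simpa [localCharFun] using
    norm_integral_le_of_norm_le_const (μ := AddCircle.haarAddCircle) (Eventually.of_forall h)

lemma norm_localCharFun_sub_le {p : ℕ} (hp : p.Prime) {σ : ℝ} (hσ : 1 / 2 ≤ σ) (Y : ℕ) (w : ℂ) :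
    ‖localCharFun Y σ p w - (1 - ‖w‖ ^ 2 * localVar Y σ p / 4 : ℝ)‖
      ≤ 32 / 3 * (‖w‖ * (p : ℝ) ^ (-σ)) ^ 3 := by
  refine (norm_integral_exp_inner_sub_quadratic_le (continuous_localPoly Y σ p).measurable
    (norm_localPoly_le hp hσ Y) (integral_localPoly Y σ p) (integral_localPoly_sq Y σ p)
    (integral_localPoly_mul_conj Y σ p) w).trans (le_of_eq ?_)
  ring

lemma localPoly_eq_zero {Y p : ℕ} (h : Y < p) (σ : ℝ) (x : UnitAddCircle) :
    localPoly Y σ p x = 0 :=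
  Finset.sum_eq_zero fun k hk => by
    rw [localCoeff_eq_zero h σ (by have := Finset.mem_Icc.1 hk; omega), Complex.ofReal_zero,
      zero_mul]

lemma localVar_eq_zero {Y p : ℕ} (h : Y < p) (σ : ℝ) : localVar Y σ p = 0 :=
  Finset.sum_eq_zero fun k hk => by
    rw [localCoeff_eq_zero h σ (by have := Finset.mem_Icc.1 hk; omega), zero_pow two_ne_zero]

lemma localCharFun_eq_one {Y p : ℕ} (h : Y < p) (σ : ℝ) (w : ℂ) : localCharFun Y σ p w = 1 := by
  simp_rw [localCharFun, localPoly_eq_zero h]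
  simp

lemma norm_localCharFun_le {p : ℕ} (hp : p.Prime) {σ : ℝ} (hσ : 1 / 2 ≤ σ) (Y : ℕ) {w : ℂ}
    (hw : ‖w‖ * (p : ℝ) ^ (-σ) ≤ 1 / 100) :
    ‖localCharFun Y σ p w‖ ≤ Real.exp (-(‖w‖ ^ 2 * localVar Y σ p / 8)) := by
  rcases lt_or_ge Y p with h | h
  · rw [localCharFun_eq_one h, localVar_eq_zero h]
    simp
  have h1 := norm_localCharFun_sub_le hp hσ Y w
  have h2 := le_localVar hp σ h
  have h3 := localVar_le hp hσ Y
  set u := ‖w‖ * (p : ℝ) ^ (-σ) with hu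
  have hu0 : 0 ≤ u := by positivity
  have h4 : u ^ 2 ≤ ‖w‖ ^ 2 * localVar Y σ p := by
    rw [hu, mul_pow]
    gcongr
  have h5 : ‖w‖ ^ 2 * localVar Y σ p ≤ 16 * u ^ 2 := by
    calc _ ≤ ‖w‖ ^ 2 * (16 * ((p : ℝ) ^ (-σ)) ^ 2) := by gcongr
      _ = _ := by rw [hu]; ring
  have h6 : u ^ 3 ≤ 1 / 100 * u ^ 2 := by
    rw [pow_succ']
    gcongr
  have h7 : u ^ 2 ≤ (1 / 100) ^ 2 := by gcongr
  have h8 := (norm_sub_norm_le _ _).trans h1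
  rw [Complex.norm_real, Real.norm_of_nonneg (by linarith)] at h8
  calc ‖localCharFun Y σ p w‖ ≤ -(‖w‖ ^ 2 * localVar Y σ p / 8) + 1 := by linarith
    _ ≤ _ := Real.add_one_le_exp _

lemma norm_localCharFun_sub_exp_le {p : ℕ} (hp : p.Prime) {σ : ℝ} (hσ : 1 / 2 ≤ σ) (Y : ℕ) {w : ℂ}
    (hw : ‖w‖ * (p : ℝ) ^ (-σ) ≤ 1 / 100) :
    ‖localCharFun Y σ p w - (Real.exp (-(‖w‖ ^ 2 * localVar Y σ p / 4)) : ℝ)‖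
      ≤ 24 * (‖w‖ * (p : ℝ) ^ (-σ)) ^ 3 * Real.exp (-(‖w‖ ^ 2 * localVar Y σ p / 8)) := by
  have h1 := norm_localCharFun_sub_le hp hσ Y w
  have h3 := localVar_le hp hσ Y
  have h0 := localVar_nonneg Y σ p
  set u := ‖w‖ * (p : ℝ) ^ (-σ) with hu
  have hu0 : 0 ≤ u := by positivity
  have h5 : ‖w‖ ^ 2 * localVar Y σ p ≤ 16 * u ^ 2 := by
    calc _ ≤ ‖w‖ ^ 2 * (16 * ((p : ℝ) ^ (-σ)) ^ 2) := by gcongr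
      _ = _ := by rw [hu]; ring
  have h4 : 0 ≤ ‖w‖ ^ 2 * localVar Y σ p := by positivity
  have h7 : u ^ 2 ≤ (1 / 100) ^ 2 := by gcongr
  set A := ‖w‖ ^ 2 * localVar Y σ p
  have h9 : |Real.exp (-(A / 4)) - 1 - -(A / 4)| ≤ (-(A / 4)) ^ 2 :=
    Real.abs_exp_sub_one_sub_id_le (by rw [abs_neg, abs_of_nonneg] <;> linarith)
  have h10 : (-(A / 4)) ^ 2 ≤ u ^ 3 := by
    calc (-(A / 4)) ^ 2 = (A / 4) ^ 2 := by ring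
      _ ≤ (16 * u ^ 2 / 4) ^ 2 := by gcongr
      _ = 16 * u * u ^ 3 := by ring
      _ ≤ 1 * u ^ 3 := by gcongr; linarith
      _ = _ := one_mul _
  have h11 : 1 / 2 ≤ Real.exp (-(A / 8)) := by linarith [Real.add_one_le_exp (-(A / 8))]
  have h12 : ‖((1 - A / 4 : ℝ) : ℂ) - (Real.exp (-(A / 4)) : ℝ)‖ ≤ u ^ 3 := by
    rw [← Complex.ofReal_sub, Complex.norm_real, Real.norm_eq_abs, abs_sub_comm]
    calc _ = |Real.exp (-(A / 4)) - 1 - -(A / 4)| := by congr 1; ring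
      _ ≤ _ := h9.trans h10
  calc _ ≤ 32 / 3 * u ^ 3 + u ^ 3 := (norm_sub_le_norm_sub_add_norm_sub _ _ _).trans
        (add_le_add h1 h12)
    _ ≤ 24 * u ^ 3 * (1 / 2) := by nlinarith [pow_nonneg hu0 3]
    _ ≤ _ := by gcongr

lemma norm_prod_sub_prod_le {ι : Type*} (s : Finset ι) {f g : ι → ℂ} {b e : ι → ℝ}
    (hf : ∀ i ∈ s, ‖f i‖ ≤ b i) (hg : ∀ i ∈ s, ‖g i‖ ≤ b i)
    (hfg : ∀ i ∈ s, ‖f i - g i‖ ≤ e i * b i) :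
    ‖∏ i ∈ s, f i - ∏ i ∈ s, g i‖ ≤ (∑ i ∈ s, e i) * ∏ i ∈ s, b i := by
  induction s using Finset.induction_on with
  | empty => simp
  | insert a s ha ih =>
    rw [Finset.prod_insert ha, Finset.prod_insert ha, Finset.prod_insert ha, Finset.sum_insert ha]
    have h1 := ih (fun i hi => hf i (Finset.mem_insert_of_mem hi))
      (fun i hi => hg i (Finset.mem_insert_of_mem hi))
      fun i hi => hfg i (Finset.mem_insert_of_mem hi)
    have h2 : ‖∏ i ∈ s, f i‖ ≤ ∏ i ∈ s, b i := by
      rw [norm_prod]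
      exact Finset.prod_le_prod (fun _ _ => norm_nonneg _)
        fun i hi => hf i (Finset.mem_insert_of_mem hi)
    have hga := hg a (Finset.mem_insert_self _ _)
    have hfga := hfg a (Finset.mem_insert_self _ _)
    calc _ = ‖(f a - g a) * ∏ i ∈ s, f i + g a * (∏ i ∈ s, f i - ∏ i ∈ s, g i)‖ := by
          congr 1; ring
      _ ≤ e a * b a * ∏ i ∈ s, b i + b a * ((∑ i ∈ s, e i) * ∏ i ∈ s, b i) := by
          refine (norm_add_le _ _).trans (add_le_add ?_ ?_)
          · rw [norm_mul]
            exact mul_le_mul hfga h2 (norm_nonneg _) ((norm_nonneg _).trans hfga)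
          · rw [norm_mul]
            exact mul_le_mul hga h1 (norm_nonneg _) ((norm_nonneg _).trans hga)
      _ = _ := by ring

lemma sum_localVar_le_log {s : Finset ℕ} (hs : ∀ p ∈ s, p.Prime) {σ : ℝ} (hσ : 1 / 2 ≤ σ)
    (Y : ℕ) {W : ℝ} (hW : 1 / 100 ≤ W) (hsW : ∀ p ∈ s, 1 / 100 < W * (p : ℝ) ^ (-σ)) :
    ∑ p ∈ s, localVar Y σ p ≤ 16 * (1 + Real.log (10 ^ 4 * W ^ 2)) := by
  set N := ⌊10 ^ 4 * W ^ 2⌋₊ with hN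
  have hN1 : (1 : ℝ) ≤ 10 ^ 4 * W ^ 2 := by nlinarith
  have h1 : s ⊆ Finset.Icc 1 N := by
    intro p hps
    have hp1 : (1 : ℝ) ≤ p := by exact_mod_cast (hs p hps).one_le
    have hp0 : (0 : ℝ) < p := by linarith
    refine Finset.mem_Icc.2 ⟨(hs p hps).one_le, Nat.le_floor ?_⟩
    have h2 : (p : ℝ) ^ (-σ) ≤ (√p)⁻¹ := by
      rw [Real.sqrt_eq_rpow, ← Real.rpow_neg hp0.le]
      exact Real.rpow_le_rpow_of_exponent_le hp1 (by linarith)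
    have h3 : √p < 100 * W := by
      have hq : 0 < √(p : ℝ) := Real.sqrt_pos.2 hp0
      have h4 : 1 / 100 < W * (√p)⁻¹ := (hsW p hps).trans_le (by gcongr)
      rw [← div_eq_mul_inv, lt_div_iff₀ hq] at h4
      linarith
    calc (p : ℝ) = √p ^ 2 := (Real.sq_sqrt hp0.le).symm
      _ ≤ (100 * W) ^ 2 := by gcongr
      _ = _ := by ring
  calc _ ≤ ∑ p ∈ s, 16 * (p : ℝ)⁻¹ := by
        refine Finset.sum_le_sum fun p hps => ?_
        have hp1 : (1 : ℝ) ≤ p := by exact_mod_cast (hs p hps).one_le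
        refine (localVar_le (hs p hps) hσ Y).trans ?_
        gcongr
        rw [← Real.rpow_natCast, ← Real.rpow_mul (by linarith), ← Real.rpow_neg_one]
        exact Real.rpow_le_rpow_of_exponent_le hp1 (by push_cast; linarith)
    _ ≤ ∑ p ∈ Finset.Icc 1 N, 16 * (p : ℝ)⁻¹ :=
        Finset.sum_le_sum_of_subset_of_nonneg h1 fun _ _ _ => by positivity
    _ = 16 * (harmonic N : ℝ) := by
        rw [harmonic_eq_sum_Icc, ← Finset.mul_sum]
        push_cast
        rfl
    _ ≤ 16 * (1 + Real.log N) := by gcongr; exact harmonic_le_one_add_log N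
    _ ≤ _ := by
        gcongr
        · exact Nat.cast_pos.2 (Nat.floor_pos.2 hN1)
        · exact Nat.floor_le (by positivity)

theorem exists_norm_prod_localCharFun_sub_le : ∃ C : ℝ, 0 < C ∧
    ∀ (s : Finset ℕ) (_ : ∀ p ∈ s, p.Prime) (Y : ℕ) (σ : ℝ) (_ : 1 / 2 ≤ σ) (w : ℂ)
      (_ : 1 / 100 < ‖w‖ →
        32 * (1 + Real.log (10 ^ 4 * ‖w‖ ^ 2)) ≤ ∑ p ∈ s, localVar Y σ p),
      ‖∏ p ∈ s, localCharFun Y σ p w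
        - (Real.exp (-(‖w‖ ^ 2 * (∑ p ∈ s, localVar Y σ p) / 4)) : ℝ)‖
      ≤ C * ‖w‖ ^ 3 * Real.exp (-(‖w‖ ^ 2 * (∑ p ∈ s, localVar Y σ p) / 16)) := by
  set K := (riemannZeta ((3 / 2 : ℝ) : ℂ)).re with hK
  have hK0 : 0 ≤ K := by
    have h := sum_rpow_neg_le (show (1 : ℝ) < 3 / 2 by norm_num) ∅
    rwa [Finset.sum_empty] at h
  refine ⟨24 * K + 2 * 10 ^ 6, by positivity, fun s hs Y σ hσ w hw => ?_⟩
  set S := ∑ p ∈ s, localVar Y σ p with hS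
  have hS0 : 0 ≤ S := Finset.sum_nonneg fun p _ => localVar_nonneg Y σ p
  have hexp : ∀ c : ℝ, ∀ r : Finset ℕ, ∏ p ∈ r, Real.exp (-(‖w‖ ^ 2 * localVar Y σ p / c))
      = Real.exp (-(‖w‖ ^ 2 * (∑ p ∈ r, localVar Y σ p) / c)) := fun c r => by
    rw [← Real.exp_sum, Finset.sum_neg_distrib, Finset.mul_sum, Finset.sum_div]
  rcases le_or_gt ‖w‖ (1 / 100) with hw1 | hw1
  · have hq : ∀ p ∈ s, ‖w‖ * (p : ℝ) ^ (-σ) ≤ 1 / 100 := fun p hp => by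
      have := prime_rpow_neg_le (hs p hp) hσ
      calc _ ≤ (1 / 100 : ℝ) * 1 := by gcongr; linarith
        _ = _ := mul_one _
    have h := norm_prod_sub_prod_le s (f := fun p => localCharFun Y σ p w)
      (g := fun p => ((Real.exp (-(‖w‖ ^ 2 * localVar Y σ p / 4)) : ℝ) : ℂ))
      (b := fun p => Real.exp (-(‖w‖ ^ 2 * localVar Y σ p / 8)))
      (e := fun p => 24 * (‖w‖ * (p : ℝ) ^ (-σ)) ^ 3)
      (fun p hp => norm_localCharFun_le (hs p hp) hσ Y (hq p hp))
      (fun p hp => by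
        rw [Complex.norm_real, Real.norm_of_nonneg (Real.exp_pos _).le, Real.exp_le_exp]
        have := mul_nonneg (sq_nonneg ‖w‖) (localVar_nonneg Y σ p)
        linarith)
      (fun p hp => norm_localCharFun_sub_exp_le (hs p hp) hσ Y (hq p hp))
    rw [← Complex.ofReal_prod, hexp, hexp, ← hS] at h
    refine h.trans ?_
    have hsum : ∑ p ∈ s, 24 * (‖w‖ * (p : ℝ) ^ (-σ)) ^ 3 ≤ 24 * K * ‖w‖ ^ 3 := by
      calc _ ≤ ∑ p ∈ s, 24 * ‖w‖ ^ 3 * (p : ℝ) ^ (-(3 / 2) : ℝ) := by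
            refine Finset.sum_le_sum fun p hp => ?_
            have hp1 : (1 : ℝ) ≤ p := by exact_mod_cast (hs p hp).one_le
            rw [mul_pow, ← mul_assoc, ← Real.rpow_natCast (_ ^ (-σ)),
              ← Real.rpow_mul (by linarith)]
            gcongr
            push_cast
            linarith
        _ = 24 * ‖w‖ ^ 3 * ∑ p ∈ s, (p : ℝ) ^ (-(3 / 2) : ℝ) := by rw [Finset.mul_sum]
        _ ≤ 24 * ‖w‖ ^ 3 * K := by
            gcongr
            exact sum_rpow_neg_le (by norm_num) s
        _ = _ := by ring
    have hmono : Real.exp (-(‖w‖ ^ 2 * S / 8)) ≤ Real.exp (-(‖w‖ ^ 2 * S / 16)) := by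
      rw [Real.exp_le_exp]
      have := mul_nonneg (sq_nonneg ‖w‖) hS0
      linarith
    calc _ ≤ 24 * K * ‖w‖ ^ 3 * Real.exp (-(‖w‖ ^ 2 * S / 16)) := by gcongr
      _ ≤ _ := by gcongr; linarith
  · set G := s.filter (fun p : ℕ => ‖w‖ * (p : ℝ) ^ (-σ) ≤ 1 / 100) with hG
    have hGs : G ⊆ s := Finset.filter_subset _ _
    have hsplit := Finset.sum_sdiff (f := localVar Y σ) hGs
    have hbad : ∑ p ∈ s \ G, localVar Y σ p ≤ 16 * (1 + Real.log (10 ^ 4 * ‖w‖ ^ 2)) :=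
      sum_localVar_le_log (fun p hp => hs p (Finset.mem_sdiff.1 hp).1) hσ Y hw1.le fun p hp => by
        obtain ⟨h1, h2⟩ := Finset.mem_sdiff.1 hp
        exact not_le.1 fun h => h2 (Finset.mem_filter.2 ⟨h1, h⟩)
    have hgood : S / 2 ≤ ∑ p ∈ G, localVar Y σ p := by
      have := hw hw1
      linarith
    have h1 : ‖∏ p ∈ s, localCharFun Y σ p w‖ ≤ Real.exp (-(‖w‖ ^ 2 * S / 16)) := by
      rw [norm_prod, ← Finset.prod_sdiff hGs]
      calc _ ≤ 1 * ∏ p ∈ G, Real.exp (-(‖w‖ ^ 2 * localVar Y σ p / 8)) := by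
            refine mul_le_mul (Finset.prod_le_one (fun _ _ => norm_nonneg _)
                fun p _ => norm_localCharFun_le_one _ _ _ _)
              (Finset.prod_le_prod (fun _ _ => norm_nonneg _) fun p hp => ?_)
              (Finset.prod_nonneg fun _ _ => norm_nonneg _) zero_le_one
            obtain ⟨hps, hp⟩ := Finset.mem_filter.1 hp
            exact norm_localCharFun_le (hs p hps) hσ Y hp
        _ ≤ _ := by
            rw [one_mul, hexp, Real.exp_le_exp]
            have := mul_le_mul_of_nonneg_left hgood (sq_nonneg ‖w‖)
            linarith
    have h2 : ‖((Real.exp (-(‖w‖ ^ 2 * S / 4)) : ℝ) : ℂ)‖ ≤ Real.exp (-(‖w‖ ^ 2 * S / 16)) := by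
      rw [Complex.norm_real, Real.norm_of_nonneg (Real.exp_pos _).le, Real.exp_le_exp]
      have := mul_nonneg (sq_nonneg ‖w‖) hS0
      linarith
    have h3 : (1 / 100 : ℝ) ^ 3 ≤ ‖w‖ ^ 3 := by gcongr
    calc _ ≤ 2 * 1 * Real.exp (-(‖w‖ ^ 2 * S / 16)) := by
          linarith [norm_sub_le (∏ p ∈ s, localCharFun Y σ p w)
            ((Real.exp (-(‖w‖ ^ 2 * S / 4)) : ℝ) : ℂ)]
      _ ≤ (24 * K + 2 * 10 ^ 6) * ‖w‖ ^ 3 * Real.exp (-(‖w‖ ^ 2 * S / 16)) := by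
          gcongr ?_ * _
          have : 0 ≤ 24 * K * ‖w‖ ^ 3 := by positivity
          linarith

end

section
open MeasureTheory
variable {θ : ℝ}

lemma abs_exp_neg_sub_exp_neg_le {a b : ℝ} (ha : 0 ≤ a) (hab : a ≤ b) :
    |Real.exp (-a) - Real.exp (-b)| ≤ b - a := by
  have h1 : Real.exp (-b) ≤ Real.exp (-a) := Real.exp_le_exp.2 (by linarith)
  rw [abs_of_nonneg (by linarith)]
  have h2 := Real.add_one_le_exp (-(b - a))
  have h3 : Real.exp (-b) = Real.exp (-a) * Real.exp (-(b - a)) := by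
    rw [← Real.exp_add]; ring_nf
  have h4 : Real.exp (-a) ≤ 1 := Real.exp_le_one_iff.2 (by linarith)
  rw [h3]
  nlinarith [Real.exp_pos (-a)]

lemma eventually_log_pow_le : ∀ᶠ x : ℝ in atTop,
    32 * (1 + Real.log (10 ^ 4 * x ^ 8)) ≤ x / 2 := by
  have h := Real.isLittleO_log_id_atTop.bound (show (0 : ℝ) < 1 / 1024 by norm_num)
  filter_upwards [h, eventually_ge_atTop (128 * (1 + Real.log (10 ^ 4))), eventually_gt_atTop 1]
    with x hx h1 h2
  rw [Real.norm_of_nonneg (Real.log_nonneg h2.le), id, Real.norm_of_nonneg (by linarith)] at hx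
  rw [Real.log_mul (by norm_num) (by positivity), Real.log_pow x 8, Nat.cast_ofNat]
  generalize Real.log (10 ^ 4) = c at h1 ⊢
  linarith

theorem exists_eventually_norm_charFun_primePoly_sub_exp_le (hθ0 : 0 < θ) (hθ1 : θ < 1 / 2) :
    ∃ C : ℝ, 0 < C ∧
    ∀ᶠ L : ℝ in atTop, ∀ w : ℂ, ‖w‖ ≤ sqLogSum (1 + 2 * L ^ (-θ)) ^ 4 →
      ‖(∫ t, Complex.exp ((inner ℝ w (primePoly (cutY L) (1 / 2 + L ^ (-θ)) t) : ℝ) * Complex.I)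
          ∂timeMeasure (Real.exp L)) -
        (Real.exp (-(‖w‖ ^ 2 * sqLogSum (1 + 2 * L ^ (-θ)) / 4)) : ℝ)‖
      ≤ C * ‖w‖ ^ 3 * Real.exp (-(‖w‖ ^ 2 * sqLogSum (1 + 2 * L ^ (-θ)) / 32))
        + (sqLogSum (1 + 2 * L ^ (-θ)) ^ 20)⁻¹ := by
  obtain ⟨C, hC0, hC⟩ := exists_norm_prod_localCharFun_sub_le
  refine ⟨C, hC0, ?_⟩
  have hβ : 0 < (1 / 2 - θ) / 2 := by linarith
  filter_upwards [eventually_norm_charFun_primePoly_sub_le hθ0 hθ1, eventually_gt_atTop 1,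
    (tendsto_sqLogSum_atTop hθ0 hθ1).eventually_ge_atTop 2,
    (tendsto_sqLogSum_atTop hθ0 hθ1).eventually eventually_log_pow_le,
    eventually_sqLogSum_pow_le hθ0 hθ1 29, eventually_sqLogSum_sub_varSum_le hθ0 hθ1,
    eventually_const_le_rpow hβ 1] with L hchar hL hψ2 hψlog hψL hvar hLβ w hw
  set ψ := sqLogSum (1 + 2 * L ^ (-θ)) with hψ
  have hL0 : 0 < L := by linarith
  have hδ0 : 0 < L ^ (-θ) := by positivity
  have hs : ∀ p ∈ cutPrimes θ L, p.Prime := fun p hp => Nat.prime_of_mem_primesBelow hp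
  have hK : 1 ≤ cutK θ L := Nat.le_floor (by simpa using hLβ)
  have hsY : ∀ p, p.Prime → p ≤ cutY L → p ∈ cutPrimes θ L := fun p hp hpY =>
    Nat.mem_primesBelow.2 ⟨Nat.lt_succ_of_le (hpY.trans (Nat.le_self_pow (by omega) _)), hp⟩
  have hS : ∑ p ∈ cutPrimes θ L, localVar (cutY L) (1 / 2 + L ^ (-θ)) p = varSum θ L := by
    rw [sum_localVar hs hsY, varSum, show 2 * (1 / 2 + L ^ (-θ)) = 1 + 2 * L ^ (-θ) by ring]
  have h1L : 1 / L ≤ 1 := by rw [div_le_one hL0]; exact hL.le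
  have hprod := hC (cutPrimes θ L) hs (cutY L) (1 / 2 + L ^ (-θ)) (by linarith) w (by
    intro hw1
    rw [hS]
    have hmono : Real.log (10 ^ 4 * ‖w‖ ^ 2) ≤ Real.log (10 ^ 4 * ψ ^ 8) := by
      refine Real.log_le_log (by positivity) ?_
      rw [show ψ ^ 8 = (ψ ^ 4) ^ 2 by ring]
      gcongr
    have hS0 : ψ / 2 ≤ varSum θ L := by linarith [hvar.2]
    calc _ ≤ 32 * (1 + Real.log (10 ^ 4 * ψ ^ 8)) := by gcongr
      _ ≤ _ := hψlog.trans hS0)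
  rw [← integral_exp_inner_randPoly hs hsY, hS] at hprod
  have hS1 : ψ / 2 ≤ varSum θ L := by linarith [hvar.2]
  have hw2 : ‖w‖ ^ 2 ≤ ψ ^ 8 := by
    rw [show ψ ^ 8 = (ψ ^ 4) ^ 2 by ring]
    gcongr
  have hgauss : ‖((Real.exp (-(‖w‖ ^ 2 * varSum θ L / 4)) : ℝ) : ℂ)
      - (Real.exp (-(‖w‖ ^ 2 * ψ / 4)) : ℝ)‖ ≤ ψ ^ 8 * (1 / L) / 4 := by
    rw [← Complex.ofReal_sub, Complex.norm_real, Real.norm_eq_abs]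
    have h0 : 0 ≤ varSum θ L := by linarith
    refine (abs_exp_neg_sub_exp_neg_le (by positivity) (by gcongr; linarith [hvar.1])).trans ?_
    calc _ = ‖w‖ ^ 2 * (ψ - varSum θ L) / 4 := by ring
      _ ≤ _ := by gcongr; exacts [hvar.1, hvar.2]
  have hexp : Real.exp (-(‖w‖ ^ 2 * varSum θ L / 16)) ≤ Real.exp (-(‖w‖ ^ 2 * ψ / 32)) := by
    rw [Real.exp_le_exp]
    have := mul_le_mul_of_nonneg_left hS1 (sq_nonneg ‖w‖)
    linarith
  have hfin : 1 / L + ψ ^ 8 * (1 / L) / 4 ≤ (ψ ^ 20)⁻¹ := by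
    have h8 : (1 : ℝ) ≤ ψ ^ 8 := one_le_pow₀ (by linarith)
    rw [show 1 / L + ψ ^ 8 * (1 / L) / 4 = (1 + ψ ^ 8 / 4) / L by ring, div_le_iff₀ hL0,
      ← div_eq_inv_mul, le_div_iff₀ (by positivity)]
    calc (1 + ψ ^ 8 / 4) * ψ ^ 20 ≤ ψ * ψ ^ 8 * ψ ^ 20 := by gcongr; nlinarith
      _ = ψ ^ 29 := by ring
      _ ≤ L := hψL
  calc _ ≤ 1 / L + (C * ‖w‖ ^ 3 * Real.exp (-(‖w‖ ^ 2 * varSum θ L / 16))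
        + ψ ^ 8 * (1 / L) / 4) :=
        (norm_sub_le_norm_sub_add_norm_sub _ _ _).trans (add_le_add (hchar w hw)
          ((norm_sub_le_norm_sub_add_norm_sub _ _ _).trans (add_le_add hprod hgauss)))
    _ ≤ _ := by
        have : C * ‖w‖ ^ 3 * Real.exp (-(‖w‖ ^ 2 * varSum θ L / 16))
            ≤ C * ‖w‖ ^ 3 * Real.exp (-(‖w‖ ^ 2 * ψ / 32)) := by gcongr
        linarith

end

section
open MeasureTheory

lemma integral_exp_neg_mul_sq_norm {b : ℝ} (hb : 0 < b) :
    ∫ z : ℂ, Real.exp (-b * ‖z‖ ^ 2) = π / b := by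
  rw [GaussianFourier.integral_rexp_neg_mul_sq_norm hb, Complex.finrank_real_complex]
  norm_num

lemma integrable_exp_neg_mul_sq_norm {b : ℝ} (hb : 0 < b) :
    Integrable fun z : ℂ => Real.exp (-b * ‖z‖ ^ 2) := by
  by_contra h
  have := integral_exp_neg_mul_sq_norm hb
  rw [integral_undef h] at this
  exact (div_pos Real.pi_pos hb).ne this

lemma integral_exp_inner_mul_exp_neg {b : ℝ} (hb : 0 < b) (w : ℂ) :
    ∫ z : ℂ, Complex.exp ((inner ℝ w z : ℝ) * Complex.I) * (Real.exp (-b * ‖z‖ ^ 2) : ℝ)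
      = (π / b * Real.exp (-‖w‖ ^ 2 / (4 * b)) : ℝ) := by
  have h := GaussianFourier.integral_cexp_neg_mul_sq_norm_add (V := ℂ) (b := (b : ℂ))
    (by simpa using hb) Complex.I w
  rw [Complex.finrank_real_complex, Complex.I_sq, Nat.cast_ofNat, div_self two_ne_zero,
    Complex.cpow_one] at h
  push_cast
  rw [show -(‖w‖ : ℂ) ^ 2 = -1 * ‖w‖ ^ 2 by ring, ← h]
  refine integral_congr_ae (Eventually.of_forall fun z => ?_)
  simp only
  rw [← Complex.exp_add]
  congr 1
  ring

/-- The isotropic Gaussian probability density on the plane with parameter `a`. -/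
def gaussKernel (a : ℝ) (v : ℂ) : ℝ := a / π * Real.exp (-a * ‖v‖ ^ 2)

lemma gaussKernel_nonneg {a : ℝ} (ha : 0 < a) (v : ℂ) : 0 ≤ gaussKernel a v := by
  have := Real.pi_pos
  unfold gaussKernel
  positivity

lemma continuous_gaussKernel (a : ℝ) : Continuous (gaussKernel a) := by
  unfold gaussKernel
  fun_prop

lemma gaussKernel_le {a : ℝ} (ha : 0 < a) (v : ℂ) : gaussKernel a v ≤ a / π := by
  have := Real.pi_pos
  refine mul_le_of_le_one_right (by positivity) (Real.exp_le_one_iff.2 ?_)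
  have := mul_nonneg ha.le (sq_nonneg ‖v‖)
  linarith

lemma integrable_gaussKernel {a : ℝ} (ha : 0 < a) : Integrable (gaussKernel a) :=
  (integrable_exp_neg_mul_sq_norm ha).const_mul _

lemma integral_gaussKernel {a : ℝ} (ha : 0 < a) : ∫ v, gaussKernel a v = 1 := by
  have := Real.pi_pos
  simp_rw [gaussKernel]
  rw [integral_const_mul, integral_exp_neg_mul_sq_norm ha]
  field_simp

lemma lintegral_gaussKernel {a : ℝ} (ha : 0 < a) :
    ∫⁻ v, ENNReal.ofReal (gaussKernel a v) = 1 := by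
  rw [← ofReal_integral_eq_lintegral_ofReal (integrable_gaussKernel ha)
    (Eventually.of_forall (gaussKernel_nonneg ha)), integral_gaussKernel ha, ENNReal.ofReal_one]

lemma lintegral_gaussKernel_tail_le {a : ℝ} (ha : 0 < a) {r : ℝ} (hr : 0 ≤ r) :
    ∫⁻ v in {v : ℂ | r ≤ ‖v‖}, ENNReal.ofReal (gaussKernel a v)
      ≤ ENNReal.ofReal (2 * Real.exp (-(a * r ^ 2 / 2))) := by
  have hπ := Real.pi_pos
  have ha2 : 0 < a / 2 := by linarith
  have hm : MeasurableSet {v : ℂ | r ≤ ‖v‖} := measurableSet_le measurable_const measurable_norm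
  calc _ ≤ ∫⁻ v in {v : ℂ | r ≤ ‖v‖},
          ENNReal.ofReal (2 * Real.exp (-(a * r ^ 2 / 2)) * gaussKernel (a / 2) v) := by
        refine setLIntegral_mono' hm fun v hv => ENNReal.ofReal_le_ofReal ?_
        have hv' : r ^ 2 ≤ ‖v‖ ^ 2 := by
          have : r ≤ ‖v‖ := hv
          gcongr
        calc gaussKernel a v = a / π * Real.exp (-a * ‖v‖ ^ 2) := rfl
          _ ≤ a / π * (Real.exp (-(a * r ^ 2 / 2)) * Real.exp (-(a / 2) * ‖v‖ ^ 2)) := by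
              rw [← Real.exp_add]
              gcongr
              nlinarith
          _ = _ := by rw [gaussKernel]; ring
    _ ≤ ∫⁻ v, ENNReal.ofReal (2 * Real.exp (-(a * r ^ 2 / 2)) * gaussKernel (a / 2) v) :=
        setLIntegral_le_lintegral _ _
    _ = ENNReal.ofReal (2 * Real.exp (-(a * r ^ 2 / 2))) := by
        simp_rw [ENNReal.ofReal_mul (show 0 ≤ 2 * Real.exp (-(a * r ^ 2 / 2)) by positivity)]
        rw [lintegral_const_mul _ (continuous_gaussKernel _).measurable.ennreal_ofReal,
          lintegral_gaussKernel ha2, mul_one]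

/-- The characteristic function of a measure on the plane. -/
def planeCharFun (μ : Measure ℂ) (w : ℂ) : ℂ :=
  ∫ z, Complex.exp ((inner ℝ w z : ℝ) * Complex.I) ∂μ

lemma norm_planeCharFun_le_one (μ : Measure ℂ) [IsProbabilityMeasure μ] (w : ℂ) :
    ‖planeCharFun μ w‖ ≤ 1 := by
  have h : ∀ z, ‖Complex.exp ((inner ℝ w z : ℝ) * Complex.I)‖ ≤ 1 :=
    fun z => (Complex.norm_exp_ofReal_mul_I _).le
  simpa [planeCharFun] using norm_integral_le_of_norm_le_const (μ := μ) (Eventually.of_forall h)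

lemma integrable_exp_inner_mul_exp_neg (μ : Measure ℂ) [IsProbabilityMeasure μ] {b : ℝ}
    (hb : 0 < b) (u : ℂ) :
    Integrable (fun q : ℂ × ℂ => Complex.exp ((inner ℝ (q.1 - u) q.2 : ℝ) * Complex.I)
      * (Real.exp (-b * ‖q.2‖ ^ 2) : ℝ)) (μ.prod volume) := by
  have h1 : Integrable (fun q : ℂ × ℂ => ((1 : ℝ) : ℂ) * ((Real.exp (-b * ‖q.2‖ ^ 2) : ℝ) : ℂ))
      (μ.prod volume) :=
    Integrable.mul_prod (f := fun _ => ((1 : ℝ) : ℂ)) (integrable_const _)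
      (integrable_exp_neg_mul_sq_norm hb).ofReal
  refine h1.mono (by fun_prop) (Eventually.of_forall fun q => ?_)
  rw [norm_mul, norm_mul, Complex.norm_exp_ofReal_mul_I]
  simp

lemma integral_exp_inner_sub_mul (μ : Measure ℂ) (b : ℝ) (u ξ : ℂ) :
    ∫ x, Complex.exp ((inner ℝ (x - u) ξ : ℝ) * Complex.I) * (Real.exp (-b * ‖ξ‖ ^ 2) : ℝ) ∂μ
      = Complex.exp (-(inner ℝ ξ u : ℝ) * Complex.I) * planeCharFun μ ξ
        * (Real.exp (-b * ‖ξ‖ ^ 2) : ℝ) := by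
  rw [integral_mul_const, planeCharFun, ← integral_const_mul]
  congr 2
  funext x
  rw [← Complex.exp_add, real_inner_comm, inner_sub_right]
  congr 1
  push_cast
  ring

lemma integral_gaussKernel_sub (μ : Measure ℂ) [IsProbabilityMeasure μ] {a : ℝ} (ha : 0 < a)
    (u : ℂ) : ((∫ x, gaussKernel a (x - u) ∂μ : ℝ) : ℂ) = ((4 * π ^ 2)⁻¹ : ℝ) *
      ∫ ξ, ∫ x, Complex.exp ((inner ℝ (x - u) ξ : ℝ) * Complex.I)
        * (Real.exp (-(1 / (4 * a)) * ‖ξ‖ ^ 2) : ℝ) ∂μ := by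
  have hπ := Real.pi_pos
  rw [← integral_integral_swap (integrable_exp_inner_mul_exp_neg μ
    (show 0 < 1 / (4 * a) by positivity) u), ← integral_const_mul, ← integral_complex_ofReal]
  refine integral_congr_ae (Eventually.of_forall fun x => ?_)
  simp only
  rw [integral_exp_inner_mul_exp_neg (by positivity), ← Complex.ofReal_mul, gaussKernel]
  congr 1
  rw [show -‖x - u‖ ^ 2 / (4 * (1 / (4 * a))) = -a * ‖x - u‖ ^ 2 by field_simp]
  field_simp

lemma abs_integral_gaussKernel_sub_le (μ ν : Measure ℂ) [IsProbabilityMeasure μ]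
    [IsProbabilityMeasure ν] {a : ℝ} (ha : 0 < a) (u : ℂ) :
    |∫ x, gaussKernel a (x - u) ∂μ - ∫ x, gaussKernel a (x - u) ∂ν| ≤ (4 * π ^ 2)⁻¹ *
      ∫ ξ, ‖planeCharFun μ ξ - planeCharFun ν ξ‖ * Real.exp (-(1 / (4 * a)) * ‖ξ‖ ^ 2) := by
  have hb : 0 < 1 / (4 * a) := by positivity
  rw [← Real.norm_eq_abs, ← Complex.norm_real, Complex.ofReal_sub, integral_gaussKernel_sub μ ha,
    integral_gaussKernel_sub ν ha, ← mul_sub, ← integral_sub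
      (integrable_exp_inner_mul_exp_neg μ hb u).integral_prod_right
      (integrable_exp_inner_mul_exp_neg ν hb u).integral_prod_right, norm_mul, Complex.norm_real,
    Real.norm_of_nonneg (by positivity)]
  gcongr
  refine (norm_integral_le_integral_norm _).trans (le_of_eq ?_)
  congr 1
  funext ξ
  rw [integral_exp_inner_sub_mul, integral_exp_inner_sub_mul, ← sub_mul, ← mul_sub, norm_mul,
    norm_mul, Complex.norm_real, Real.norm_of_nonneg (Real.exp_pos _).le, ← Complex.ofReal_neg,
    Complex.norm_exp_ofReal_mul_I, one_mul]

lemma lintegral_gaussKernel_sub (μ : Measure ℂ) [IsProbabilityMeasure μ] {a : ℝ} (ha : 0 < a)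
    (u : ℂ) : ∫⁻ x, ENNReal.ofReal (gaussKernel a (x - u)) ∂μ
      = ENNReal.ofReal (∫ x, gaussKernel a (x - u) ∂μ) := by
  refine (ofReal_integral_eq_lintegral_ofReal ?_
    (Eventually.of_forall fun x => gaussKernel_nonneg ha _)).symm
  refine Integrable.of_bound
    ((continuous_gaussKernel a).comp (continuous_id.sub continuous_const)).aestronglyMeasurable
    (a / π) (Eventually.of_forall fun x => ?_)
  rw [Real.norm_of_nonneg (gaussKernel_nonneg ha _)]
  exact gaussKernel_le ha _

lemma measurable_gaussKernel_sub (a : ℝ) :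
    Measurable fun q : ℂ × ℂ => ENNReal.ofReal (gaussKernel a (q.1 - q.2)) :=
  ((continuous_gaussKernel a).comp (continuous_fst.sub continuous_snd)).measurable.ennreal_ofReal

lemma setLIntegral_gaussKernel_sub_le {a : ℝ} (x : ℂ) {S : Set ℂ} (hS : MeasurableSet S)
    {r : ℝ} (h : ∀ u ∈ S, r ≤ ‖x - u‖) :
    ∫⁻ u in S, ENNReal.ofReal (gaussKernel a (x - u))
      ≤ ∫⁻ v in {v : ℂ | r ≤ ‖v‖}, ENNReal.ofReal (gaussKernel a v) := by
  have hm : MeasurableSet {v : ℂ | r ≤ ‖v‖} := measurableSet_le measurable_const measurable_norm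
  rw [← lintegral_indicator hS, ← lintegral_indicator hm,
    ← lintegral_sub_left_eq_self (Set.indicator {v : ℂ | r ≤ ‖v‖} _) x]
  refine lintegral_mono fun u => ?_
  by_cases hu : u ∈ S
  · rw [Set.indicator_of_mem hu, Set.indicator_of_mem (show x - u ∈ {v : ℂ | r ≤ ‖v‖} from h u hu)]
  · rw [Set.indicator_of_notMem hu]
    exact zero_le

lemma measure_le_setLIntegral_gaussKernel (μ : Measure ℂ) [IsProbabilityMeasure μ] {a : ℝ}
    (ha : 0 < a) {R R' : Set ℂ} (hR : MeasurableSet R) (hR' : MeasurableSet R') {r : ℝ}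
    (h : ∀ x ∈ R, ∀ u, ‖x - u‖ < r → u ∈ R') :
    μ R ≤ (∫⁻ u in R', ∫⁻ x, ENNReal.ofReal (gaussKernel a (x - u)) ∂μ)
      + ∫⁻ v in {v : ℂ | r ≤ ‖v‖}, ENNReal.ofReal (gaussKernel a v) := by
  set ε := ∫⁻ v in {v : ℂ | r ≤ ‖v‖}, ENNReal.ofReal (gaussKernel a v)
  have hx : ∀ x ∈ R, 1 ≤ (∫⁻ u in R', ENNReal.ofReal (gaussKernel a (x - u))) + ε := by
    intro x hx
    rw [← lintegral_gaussKernel ha, ← lintegral_sub_left_eq_self _ x,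
      ← lintegral_add_compl _ hR']
    gcongr
    exact setLIntegral_gaussKernel_sub_le x hR'.compl fun u hu =>
      not_lt.1 fun h' => hu (h x hx u h')
  calc μ R = ∫⁻ _ in R, 1 ∂μ := by simp
    _ ≤ ∫⁻ x in R, ((∫⁻ u in R', ENNReal.ofReal (gaussKernel a (x - u))) + ε) ∂μ :=
        setLIntegral_mono' hR hx
    _ ≤ ∫⁻ x, ((∫⁻ u in R', ENNReal.ofReal (gaussKernel a (x - u))) + ε) ∂μ :=
        setLIntegral_le_lintegral _ _
    _ = (∫⁻ x, (∫⁻ u in R', ENNReal.ofReal (gaussKernel a (x - u))) ∂μ) + ε := by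
        rw [lintegral_add_right _ measurable_const, lintegral_const, measure_univ, mul_one]
    _ = _ := by rw [lintegral_lintegral_swap (measurable_gaussKernel_sub a).aemeasurable]

lemma setLIntegral_gaussKernel_le_measure (μ : Measure ℂ) [IsProbabilityMeasure μ] {a : ℝ}
    (ha : 0 < a) {R R' : Set ℂ} (hR : MeasurableSet R) (hR' : MeasurableSet R') {r : ℝ}
    (h : ∀ x ∈ R, ∀ u, ‖x - u‖ < r → u ∈ R') :
    ∫⁻ u in R, ∫⁻ x, ENNReal.ofReal (gaussKernel a (x - u)) ∂μ
      ≤ μ R' + ∫⁻ v in {v : ℂ | r ≤ ‖v‖}, ENNReal.ofReal (gaussKernel a v) := by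
  set ε := ∫⁻ v in {v : ℂ | r ≤ ‖v‖}, ENNReal.ofReal (gaussKernel a v)
  have hx : ∀ x, ∫⁻ u in R, ENNReal.ofReal (gaussKernel a (x - u)) ≤ R'.indicator 1 x + ε := by
    intro x
    by_cases hx : x ∈ R'
    · rw [Set.indicator_of_mem hx]
      calc _ ≤ ∫⁻ u, ENNReal.ofReal (gaussKernel a (x - u)) := setLIntegral_le_lintegral _ _
        _ = 1 := by
          rw [lintegral_sub_left_eq_self (fun v => ENNReal.ofReal (gaussKernel a v)) x,
            lintegral_gaussKernel ha]
        _ ≤ _ := le_self_add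
    · rw [Set.indicator_of_notMem hx, zero_add]
      exact setLIntegral_gaussKernel_sub_le x hR fun u hu => not_lt.1 fun h' =>
        hx (h u hu x (by rwa [norm_sub_rev]))
  rw [← lintegral_lintegral_swap (f := fun x u => ENNReal.ofReal (gaussKernel a (x - u)))
    (measurable_gaussKernel_sub a).aemeasurable]
  calc _ ≤ ∫⁻ x, (R'.indicator 1 x + ε) ∂μ := lintegral_mono hx
    _ = _ := by
        rw [lintegral_add_right _ measurable_const, lintegral_const, measure_univ, mul_one,
          lintegral_indicator_one hR']

theorem measure_le_measure_add (μ ν : Measure ℂ) [IsProbabilityMeasure μ]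
    [IsProbabilityMeasure ν] {a : ℝ} (ha : 0 < a) {R R' R'' : Set ℂ} (hR : MeasurableSet R)
    (hR' : MeasurableSet R') (hR'' : MeasurableSet R'') {r : ℝ} (hr : 0 ≤ r)
    (h : ∀ x ∈ R, ∀ u, ‖x - u‖ < r → u ∈ R') (h' : ∀ x ∈ R', ∀ u, ‖x - u‖ < r → u ∈ R'') :
    μ R ≤ ν R'' + ENNReal.ofReal ((4 * π ^ 2)⁻¹ *
        ∫ ξ, ‖planeCharFun μ ξ - planeCharFun ν ξ‖ * Real.exp (-(1 / (4 * a)) * ‖ξ‖ ^ 2))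
        * volume R' + 2 * ENNReal.ofReal (2 * Real.exp (-(a * r ^ 2 / 2))) := by
  set J := (4 * π ^ 2)⁻¹ *
    ∫ ξ, ‖planeCharFun μ ξ - planeCharFun ν ξ‖ * Real.exp (-(1 / (4 * a)) * ‖ξ‖ ^ 2) with hJ
  have hε := lintegral_gaussKernel_tail_le ha hr
  have hpt : ∀ u, ∫⁻ x, ENNReal.ofReal (gaussKernel a (x - u)) ∂μ
      ≤ (∫⁻ x, ENNReal.ofReal (gaussKernel a (x - u)) ∂ν) + ENNReal.ofReal J := by
    intro u
    rw [lintegral_gaussKernel_sub μ ha, lintegral_gaussKernel_sub ν ha]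
    refine le_trans (ENNReal.ofReal_le_ofReal ?_) ENNReal.ofReal_add_le
    linarith [le_abs_self (∫ x, gaussKernel a (x - u) ∂μ - ∫ x, gaussKernel a (x - u) ∂ν),
      abs_integral_gaussKernel_sub_le μ ν ha u]
  calc μ R ≤ _ := measure_le_setLIntegral_gaussKernel μ ha hR hR' h
    _ ≤ (∫⁻ u in R', ((∫⁻ x, ENNReal.ofReal (gaussKernel a (x - u)) ∂ν) + ENNReal.ofReal J)) +
        ENNReal.ofReal (2 * Real.exp (-(a * r ^ 2 / 2))) := by
        gcongr with u
        exact hpt u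
    _ = (∫⁻ u in R', ∫⁻ x, ENNReal.ofReal (gaussKernel a (x - u)) ∂ν)
          + ENNReal.ofReal J * volume R' + ENNReal.ofReal (2 * Real.exp (-(a * r ^ 2 / 2))) := by
        rw [lintegral_add_right _ measurable_const, setLIntegral_const]
    _ ≤ (ν R'' + ENNReal.ofReal (2 * Real.exp (-(a * r ^ 2 / 2))))
          + ENNReal.ofReal J * volume R' + ENNReal.ofReal (2 * Real.exp (-(a * r ^ 2 / 2))) := by
        gcongr
        exact (setLIntegral_gaussKernel_le_measure ν ha hR' hR'' h').trans (by gcongr)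
    _ = _ := by ring

end

section
open MeasureTheory

/-- The standard Gaussian measure on the plane with density `exp (-π ‖z‖ ^ 2)`. -/
def planeGaussian : Measure ℂ :=
  volume.withDensity fun z => ENNReal.ofReal (gaussKernel π z)

lemma gaussKernel_pi (z : ℂ) : gaussKernel π z = Real.exp (-π * ‖z‖ ^ 2) := by
  rw [gaussKernel, div_self Real.pi_ne_zero, one_mul]

instance : IsProbabilityMeasure planeGaussian :=
  ⟨by rw [planeGaussian, withDensity_apply _ MeasurableSet.univ, setLIntegral_univ,
    lintegral_gaussKernel Real.pi_pos]⟩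

lemma planeCharFun_planeGaussian (w : ℂ) :
    planeCharFun planeGaussian w = (Real.exp (-‖w‖ ^ 2 / (4 * π)) : ℝ) := by
  have h := integral_exp_inner_mul_exp_neg Real.pi_pos w
  rw [div_self Real.pi_ne_zero, one_mul] at h
  rw [planeCharFun, planeGaussian, integral_withDensity_eq_integral_toReal_smul
    (continuous_gaussKernel π).measurable.ennreal_ofReal (by simp), ← h]
  refine integral_congr_ae (Eventually.of_forall fun z => ?_)
  simp only
  rw [ENNReal.toReal_ofReal (gaussKernel_nonneg Real.pi_pos z), gaussKernel_pi,
    Complex.real_smul, mul_comm]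

lemma planeGaussian_le_volume (S : Set ℂ) (hS : MeasurableSet S) :
    planeGaussian S ≤ volume S := by
  rw [planeGaussian, withDensity_apply _ hS]
  calc _ ≤ ∫⁻ _ in S, 1 := by
        refine lintegral_mono fun z => ENNReal.ofReal_le_one.2 ?_
        exact (gaussKernel_le Real.pi_pos z).trans_eq (div_self Real.pi_ne_zero)
    _ = _ := by simp

/-- The closed axis-parallel rectangle `[a, b] × [c, d]` in the plane. -/
def planeRect (a b c d : ℝ) : Set ℂ := {z | z.re ∈ Set.Icc a b ∧ z.im ∈ Set.Icc c d}

lemma measurableSet_planeRect (a b c d : ℝ) : MeasurableSet (planeRect a b c d) :=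
  (Complex.measurable_re measurableSet_Icc).inter (Complex.measurable_im measurableSet_Icc)

lemma planeRect_eq_preimage (a b c d : ℝ) :
    planeRect a b c d = Complex.measurableEquivRealProd ⁻¹' (Set.Icc a b ×ˢ Set.Icc c d) := rfl

lemma volume_planeRect (a b c d : ℝ) :
    volume (planeRect a b c d) = ENNReal.ofReal (b - a) * ENNReal.ofReal (d - c) := by
  rw [planeRect_eq_preimage, Complex.volume_preserving_equiv_real_prod.measure_preimage_equiv,
    Measure.volume_eq_prod, Measure.prod_prod, Real.volume_Icc, Real.volume_Icc]

lemma planeGaussian_real_planeRect {a b c d : ℝ} (hab : a ≤ b) (hcd : c ≤ d) :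
    planeGaussian.real (planeRect a b c d)
      = ∫ y in c..d, ∫ x in a..b, Real.exp (-π * (x ^ 2 + y ^ 2)) := by
  have hg : Continuous fun p : ℝ × ℝ => Real.exp (-π * (p.1 ^ 2 + p.2 ^ 2)) := by fun_prop
  have hint : Integrable (fun p : ℝ × ℝ => Real.exp (-π * (p.1 ^ 2 + p.2 ^ 2)))
      ((volume.restrict (Set.Icc a b)).prod (volume.restrict (Set.Icc c d))) := by
    rw [Measure.prod_restrict]
    exact hg.continuousOn.integrableOn_compact (isCompact_Icc.prod isCompact_Icc)
  have h1 : planeGaussian.real (planeRect a b c d)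
      = ∫ z in planeRect a b c d, Real.exp (-π * (z.re ^ 2 + z.im ^ 2)) := by
    rw [measureReal_def, planeGaussian, withDensity_apply _ (measurableSet_planeRect a b c d),
      ← ofReal_integral_eq_lintegral_ofReal (integrable_gaussKernel Real.pi_pos).integrableOn
        (Eventually.of_forall (gaussKernel_nonneg Real.pi_pos)), ENNReal.toReal_ofReal
        (integral_nonneg (gaussKernel_nonneg Real.pi_pos))]
    refine integral_congr_ae (Eventually.of_forall fun z => ?_)
    simp only
    rw [gaussKernel_pi, Complex.sq_norm, Complex.normSq_apply, sq, sq]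
  have h2 := Complex.volume_preserving_equiv_real_prod.setIntegral_preimage_emb
    Complex.measurableEquivRealProd.measurableEmbedding
    (fun p : ℝ × ℝ => Real.exp (-π * (p.1 ^ 2 + p.2 ^ 2))) (Set.Icc a b ×ˢ Set.Icc c d)
  rw [h1, planeRect_eq_preimage]
  refine h2.trans ?_
  rw [Measure.volume_eq_prod, ← Measure.prod_restrict, integral_prod_symm _ hint,
    intervalIntegral.integral_of_le hcd, ← integral_Icc_eq_integral_Ioc]
  refine integral_congr_ae (Eventually.of_forall fun y => ?_)
  simp only
  rw [intervalIntegral.integral_of_le hab, ← integral_Icc_eq_integral_Ioc]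

lemma planeRect_subset {a b c d a' b' c' d' : ℝ} (ha : a' ≤ a) (hb : b ≤ b') (hc : c' ≤ c)
    (hd : d ≤ d') : planeRect a b c d ⊆ planeRect a' b' c' d' := fun _ hz =>
  ⟨⟨ha.trans hz.1.1, hz.1.2.trans hb⟩, ⟨hc.trans hz.2.1, hz.2.2.trans hd⟩⟩

lemma planeGaussian_real_planeRect_le {a b c d t : ℝ} (hab : a ≤ b) (hcd : c ≤ d) (ht : 0 ≤ t) :
    planeGaussian.real (planeRect (a - t) (b + t) (c - t) (d + t))
      ≤ planeGaussian.real (planeRect a b c d) + 2 * t * (b - a + (d - c) + 2 * t) := by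
  have hsub : planeRect a b c d ⊆ planeRect (a - t) (b + t) (c - t) (d + t) :=
    planeRect_subset (by linarith) (by linarith) (by linarith) (by linarith)
  have hm := measurableSet_planeRect a b c d
  have h1 := measureReal_inter_add_sdiff (μ := planeGaussian)
    (s := planeRect (a - t) (b + t) (c - t) (d + t)) hm
  have hv : ∀ a b c d : ℝ, a ≤ b → c ≤ d →
      volume.real (planeRect a b c d) = (b - a) * (d - c) := fun a b c d hab hcd => by
    rw [measureReal_def, volume_planeRect, ENNReal.toReal_mul,
      ENNReal.toReal_ofReal (by linarith), ENNReal.toReal_ofReal (by linarith)]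
  have hfin : ∀ a b c d : ℝ, volume (planeRect a b c d) ≠ ⊤ := fun a b c d => by
    rw [volume_planeRect]
    finiteness
  have h2 := measureReal_inter_add_sdiff (μ := (volume : Measure ℂ))
    (s := planeRect (a - t) (b + t) (c - t) (d + t)) hm (hfin _ _ _ _)
  rw [Set.inter_eq_right.2 hsub] at h1 h2
  have h3 : planeGaussian.real (planeRect (a - t) (b + t) (c - t) (d + t) \ planeRect a b c d)
      ≤ volume.real (planeRect (a - t) (b + t) (c - t) (d + t) \ planeRect a b c d) :=
    ENNReal.toReal_mono (measure_ne_top_of_subset Set.sdiff_subset (hfin _ _ _ _))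
      (planeGaussian_le_volume _ ((measurableSet_planeRect _ _ _ _).diff hm))
  rw [hv a b c d hab hcd, hv _ _ _ _ (by linarith) (by linarith)] at h2
  linarith

end

section
open MeasureTheory

lemma cube_mul_exp_neg_le {b x : ℝ} (hb : 0 < b) (hx : 0 ≤ x) :
    x ^ 3 * Real.exp (-(b * x ^ 2)) ≤ (1 + 8 / b ^ 2) * Real.exp (-(b / 2) * x ^ 2) := by
  have h0 : 0 ≤ b * x ^ 2 / 2 := by positivity
  have h1 := Real.pow_div_factorial_le_exp _ h0 2
  have h2 : 1 ≤ Real.exp (b * x ^ 2 / 2) := Real.one_le_exp h0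
  have h3 : x ^ 3 ≤ (1 + 8 / b ^ 2) * Real.exp (b * x ^ 2 / 2) := by
    have h4 : x ^ 4 = 8 / b ^ 2 * ((b * x ^ 2 / 2) ^ 2 / (Nat.factorial 2 : ℕ)) := by
      rw [show (Nat.factorial 2 : ℕ) = 2 from rfl]
      push_cast
      field_simp
      ring
    have h5 : 8 / b ^ 2 * ((b * x ^ 2 / 2) ^ 2 / (Nat.factorial 2 : ℕ))
        ≤ 8 / b ^ 2 * Real.exp (b * x ^ 2 / 2) := by gcongr
    have h6 : x ^ 3 ≤ 1 + x ^ 4 := by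
      rcases le_total x 1 with h | h
      · nlinarith [pow_le_one₀ hx h (n := 3), pow_nonneg hx 4]
      · nlinarith [pow_nonneg hx 3]
    linarith
  calc x ^ 3 * Real.exp (-(b * x ^ 2))
      ≤ (1 + 8 / b ^ 2) * Real.exp (b * x ^ 2 / 2) * Real.exp (-(b * x ^ 2)) := by gcongr
    _ = _ := by
        rw [mul_assoc, ← Real.exp_add]
        congr 2
        ring

lemma exp_neg_inv_sq_div_four_le {κ : ℝ} (hκ : 0 < κ) :
    Real.exp (-((κ ^ 2)⁻¹ / 4)) ≤ 384 * κ ^ 6 := by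
  have h := Real.pow_div_factorial_le_exp ((κ ^ 2)⁻¹ / 4) (by positivity) 3
  rw [Real.exp_neg]
  calc _ ≤ (((κ ^ 2)⁻¹ / 4) ^ 3 / (Nat.factorial 3 : ℕ))⁻¹ := inv_anti₀ (by positivity) h
    _ = _ := by
        rw [show (Nat.factorial 3 : ℕ) = 6 from rfl]
        push_cast
        field_simp
        norm_num

lemma integral_mul_exp_neg_le {C b κ : ℝ} (hC : 0 ≤ C) (hb : 0 < b) (hκ : 0 < κ) (hκ1 : κ ≤ 1)
    {D : ℂ → ℝ} (hD0 : ∀ ξ, 0 ≤ D ξ) (hD2 : ∀ ξ, D ξ ≤ 2)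
    (hD : ∀ ξ : ℂ, ‖ξ‖ ≤ (κ ^ 3)⁻¹ →
      D ξ ≤ C * κ * ‖ξ‖ ^ 3 * Real.exp (-(b * ‖ξ‖ ^ 2)) + κ ^ 5) :
    ∫ ξ, D ξ * Real.exp (-(κ ^ 4 / 2) * ‖ξ‖ ^ 2)
      ≤ (C * (1 + 8 / b ^ 2) * (2 * π / b) + 3074 * π) * κ := by
  have hπ := Real.pi_pos
  have i1 := (integrable_exp_neg_mul_sq_norm (half_pos hb)).const_mul (C * κ * (1 + 8 / b ^ 2))
  have i2 := (integrable_exp_neg_mul_sq_norm (b := κ ^ 4 / 2) (by positivity)).const_mul (κ ^ 5)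
  have i3 := (integrable_exp_neg_mul_sq_norm (b := κ ^ 4 / 4)
    (by positivity)).const_mul (768 * κ ^ 6)
  have hpt : ∀ ξ : ℂ, D ξ * Real.exp (-(κ ^ 4 / 2) * ‖ξ‖ ^ 2)
      ≤ C * κ * (1 + 8 / b ^ 2) * Real.exp (-(b / 2) * ‖ξ‖ ^ 2)
        + κ ^ 5 * Real.exp (-(κ ^ 4 / 2) * ‖ξ‖ ^ 2)
        + 768 * κ ^ 6 * Real.exp (-(κ ^ 4 / 4) * ‖ξ‖ ^ 2) := by
    intro ξ
    rcases le_or_gt ‖ξ‖ (κ ^ 3)⁻¹ with h | h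
    · have h1 := cube_mul_exp_neg_le hb (norm_nonneg ξ)
      have h2 : Real.exp (-(κ ^ 4 / 2) * ‖ξ‖ ^ 2) ≤ 1 := Real.exp_le_one_iff.2 (by
        have : 0 ≤ κ ^ 4 / 2 * ‖ξ‖ ^ 2 := by positivity
        linarith)
      have h3 : C * κ * ‖ξ‖ ^ 3 * Real.exp (-(b * ‖ξ‖ ^ 2))
          ≤ C * κ * (1 + 8 / b ^ 2) * Real.exp (-(b / 2) * ‖ξ‖ ^ 2) := by
        rw [mul_assoc, mul_assoc (C * κ) (1 + 8 / b ^ 2)]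
        gcongr
      calc _ ≤ (C * κ * (1 + 8 / b ^ 2) * Real.exp (-(b / 2) * ‖ξ‖ ^ 2) + κ ^ 5)
              * Real.exp (-(κ ^ 4 / 2) * ‖ξ‖ ^ 2) := by
            gcongr
            linarith [hD ξ h]
        _ ≤ C * κ * (1 + 8 / b ^ 2) * Real.exp (-(b / 2) * ‖ξ‖ ^ 2)
              + κ ^ 5 * Real.exp (-(κ ^ 4 / 2) * ‖ξ‖ ^ 2) := by
            rw [add_mul]
            exact add_le_add (mul_le_of_le_one_right (by positivity) h2) le_rfl
        _ ≤ _ := le_add_of_nonneg_right (by positivity)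
    · have h1 : Real.exp (-(κ ^ 4 / 2) * ‖ξ‖ ^ 2)
          ≤ Real.exp (-((κ ^ 2)⁻¹ / 4)) * Real.exp (-(κ ^ 4 / 4) * ‖ξ‖ ^ 2) := by
        rw [← Real.exp_add, Real.exp_le_exp]
        have h2 : (κ ^ 2)⁻¹ ≤ κ ^ 4 * ‖ξ‖ ^ 2 := by
          calc (κ ^ 2)⁻¹ = κ ^ 4 * ((κ ^ 3)⁻¹) ^ 2 := by field_simp
            _ ≤ _ := by gcongr
        linarith
      calc _ ≤ 2 * (384 * κ ^ 6 * Real.exp (-(κ ^ 4 / 4) * ‖ξ‖ ^ 2)) := by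
            refine mul_le_mul (hD2 ξ) (h1.trans ?_) (Real.exp_pos _).le zero_le_two
            gcongr
            exact exp_neg_inv_sq_div_four_le hκ
        _ = 768 * κ ^ 6 * Real.exp (-(κ ^ 4 / 4) * ‖ξ‖ ^ 2) := by ring
        _ ≤ _ := le_add_of_nonneg_left (by positivity)
  calc _ ≤ ∫ ξ : ℂ, (C * κ * (1 + 8 / b ^ 2) * Real.exp (-(b / 2) * ‖ξ‖ ^ 2)
        + κ ^ 5 * Real.exp (-(κ ^ 4 / 2) * ‖ξ‖ ^ 2)
        + 768 * κ ^ 6 * Real.exp (-(κ ^ 4 / 4) * ‖ξ‖ ^ 2)) :=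
        integral_mono_of_nonneg
          (Eventually.of_forall fun ξ => mul_nonneg (hD0 ξ) (Real.exp_pos _).le)
          ((i1.add i2).add i3) (Eventually.of_forall hpt)
    _ = C * κ * (1 + 8 / b ^ 2) * (π / (b / 2)) + κ ^ 5 * (π / (κ ^ 4 / 2))
          + 768 * κ ^ 6 * (π / (κ ^ 4 / 4)) := by
        rw [integral_add (by exact i1.add i2) i3, integral_add i1 i2, integral_const_mul,
          integral_const_mul, integral_const_mul, integral_exp_neg_mul_sq_norm (half_pos hb),
          integral_exp_neg_mul_sq_norm (b := κ ^ 4 / 2) (by positivity),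
          integral_exp_neg_mul_sq_norm (b := κ ^ 4 / 4) (by positivity)]
    _ = C * (1 + 8 / b ^ 2) * (2 * π / b) * κ + 2 * π * κ + 3072 * π * κ * κ := by
        field_simp
        ring
    _ ≤ C * (1 + 8 / b ^ 2) * (2 * π / b) * κ + 2 * π * κ + 3072 * π * κ * 1 := by gcongr
    _ = _ := by ring

lemma measureReal_planeRect_le_add {C b κ : ℝ} (hC : 0 ≤ C) (hb : 0 < b) (hκ : 0 < κ)
    (hκ1 : κ ≤ 1) (μ ν : Measure ℂ) [IsProbabilityMeasure μ] [IsProbabilityMeasure ν]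
    (h : ∀ ξ : ℂ, ‖ξ‖ ≤ (κ ^ 3)⁻¹ → ‖planeCharFun μ ξ - planeCharFun ν ξ‖
      ≤ C * κ * ‖ξ‖ ^ 3 * Real.exp (-(b * ‖ξ‖ ^ 2)) + κ ^ 5)
    {M x x' y y' : ℝ} (hx : x ≤ x') (hy : y ≤ y') (hxM : x' - x ≤ M) (hyM : y' - y ≤ M) :
    μ.real (planeRect x x' y y')
      ≤ ν.real (planeRect (x - 2 * κ) (x' + 2 * κ) (y - 2 * κ) (y' + 2 * κ))
        + ((C * (1 + 8 / b ^ 2) * (2 * π / b) + 3074 * π) * (M + 2) ^ 2 + 1536) * κ := by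
  set K := C * (1 + 8 / b ^ 2) * (2 * π / b) + 3074 * π with hK
  have hπ := Real.pi_pos
  have hK0 : 0 ≤ K := by positivity
  have hstep : ∀ p p' q q' : ℝ, ∀ z ∈ planeRect p p' q q', ∀ u : ℂ, ‖z - u‖ < κ →
      u ∈ planeRect (p - κ) (p' + κ) (q - κ) (q' + κ) := by
    intro p p' q q' z hz u hu
    have h1 := abs_le.1 ((Complex.abs_re_le_norm (z - u)).trans hu.le)
    have h2 := abs_le.1 ((Complex.abs_im_le_norm (z - u)).trans hu.le)
    rw [Complex.sub_re] at h1
    rw [Complex.sub_im] at h2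
    obtain ⟨⟨h3, h4⟩, h5, h6⟩ := hz
    exact ⟨⟨by linarith, by linarith⟩, by linarith, by linarith⟩
  have hmain := measure_le_measure_add μ ν (a := (κ ^ 4)⁻¹ / 2) (by positivity)
    (measurableSet_planeRect x x' y y')
    (measurableSet_planeRect (x - κ) (x' + κ) (y - κ) (y' + κ))
    (measurableSet_planeRect (x - κ - κ) (x' + κ + κ) (y - κ - κ) (y' + κ + κ))
    hκ.le (hstep _ _ _ _) (hstep _ _ _ _)
  rw [show 1 / (4 * ((κ ^ 4)⁻¹ / 2)) = κ ^ 4 / 2 by field_simp; norm_num,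
    show (κ ^ 4)⁻¹ / 2 * κ ^ 2 / 2 = (κ ^ 2)⁻¹ / 4 by field_simp; norm_num, volume_planeRect,
    show x - κ - κ = x - 2 * κ by ring, show x' + κ + κ = x' + 2 * κ by ring,
    show y - κ - κ = y - 2 * κ by ring, show y' + κ + κ = y' + 2 * κ by ring] at hmain
  set J := ∫ ξ, ‖planeCharFun μ ξ - planeCharFun ν ξ‖ * Real.exp (-(κ ^ 4 / 2) * ‖ξ‖ ^ 2)
    with hJ
  have hJK : J ≤ K * κ := integral_mul_exp_neg_le hC hb hκ hκ1 (fun _ => norm_nonneg _)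
    (fun ξ => (norm_sub_le _ _).trans (by
      linarith [norm_planeCharFun_le_one μ ξ, norm_planeCharFun_le_one ν ξ])) h
  have hJ0 : 0 ≤ J := integral_nonneg fun ξ => by positivity
  have hreal := ENNReal.toReal_mono (by finiteness) hmain
  rw [ENNReal.toReal_add (by finiteness) (by finiteness),
    ENNReal.toReal_add (by finiteness) (by finiteness), ENNReal.toReal_mul, ENNReal.toReal_mul,
    ENNReal.toReal_mul, ENNReal.toReal_ofReal (by positivity),
    ENNReal.toReal_ofReal (by linarith), ENNReal.toReal_ofReal (by linarith),
    ENNReal.toReal_ofReal (by positivity), ENNReal.toReal_ofNat] at hreal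
  have h1 : (4 * π ^ 2)⁻¹ * J ≤ K * κ :=
    (mul_le_of_le_one_left hJ0 (inv_le_one_of_one_le₀ (by nlinarith [Real.pi_gt_three]))).trans hJK
  have h2 : (x' + κ - (x - κ)) * (y' + κ - (y - κ)) ≤ (M + 2) ^ 2 := by
    rw [sq]
    exact mul_le_mul (by linarith) (by linarith) (by linarith) (by linarith)
  have h3 : (4 * π ^ 2)⁻¹ * J * ((x' + κ - (x - κ)) * (y' + κ - (y - κ)))
      ≤ K * κ * (M + 2) ^ 2 :=
    mul_le_mul h1 h2 (mul_nonneg (by linarith) (by linarith)) (by positivity)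
  have h4 : 2 * (2 * Real.exp (-((κ ^ 2)⁻¹ / 4))) ≤ 1536 * κ := by
    have h5 := exp_neg_inv_sq_div_four_le hκ
    have h6 : κ ^ 6 ≤ κ := pow_le_of_le_one hκ.le hκ1 (by norm_num)
    linarith
  calc _ ≤ _ := hreal
    _ ≤ ν.real (planeRect (x - 2 * κ) (x' + 2 * κ) (y - 2 * κ) (y' + 2 * κ))
        + K * κ * (M + 2) ^ 2 + 1536 * κ := add_le_add (add_le_add le_rfl h3) h4
    _ = _ := by ring

end

section
open MeasureTheory

variable {θ : ℝ}

lemma measureReal_timeMeasure {T : ℝ} (hT : 0 < T) {S : Set ℝ} (hS : MeasurableSet S) :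
    (timeMeasure T).real S = volume.real (S ∩ Set.Icc T (2 * T)) / T := by
  rw [timeMeasure, measureReal_ennreal_smul_apply, ENNReal.toReal_ofReal (by positivity),
    measureReal_restrict_apply hS, inv_mul_eq_div]

/-- The law of the normalized prime polynomial on `[exp L, 2 exp L]`. -/
def primePolyLaw (θ L : ℝ) : Measure ℂ :=
  (timeMeasure (Real.exp L)).map fun t =>
    primePoly (cutY L) (1 / 2 + L ^ (-θ)) t / √(π * sqLogSum (1 + 2 * L ^ (-θ)))

lemma measurable_primePoly (Y : ℕ) (σ : ℝ) : Measurable (primePoly Y σ) := by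
  have : primePoly Y σ = oscPoly _ Y := funext fun t => dirPoly_zetaChar_eq_oscPoly _ _ t _
  rw [this]
  exact (continuous_oscPoly _ _).measurable

lemma isProbabilityMeasure_primePolyLaw (θ L : ℝ) : IsProbabilityMeasure (primePolyLaw θ L) := by
  have := isProbabilityMeasure_timeMeasure (Real.exp_pos L)
  exact Measure.isProbabilityMeasure_map ((measurable_primePoly _ _).div_const _).aemeasurable

lemma planeCharFun_primePolyLaw (θ L : ℝ) (ξ : ℂ) :
    planeCharFun (primePolyLaw θ L) ξ =
      ∫ t, Complex.exp ((inner ℝ ((√(π * sqLogSum (1 + 2 * L ^ (-θ))))⁻¹ • ξ)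
        (primePoly (cutY L) (1 / 2 + L ^ (-θ)) t) : ℝ) * Complex.I) ∂timeMeasure (Real.exp L) := by
  rw [planeCharFun, primePolyLaw, integral_map
    ((measurable_primePoly _ _).div_const _).aemeasurable (by fun_prop)]
  refine integral_congr_ae (Eventually.of_forall fun t => ?_)
  simp only
  rw [div_eq_inv_mul, ← Complex.ofReal_inv, ← Complex.real_smul (x := _⁻¹),
    real_inner_smul_right, real_inner_smul_left]

/-- The rate of convergence `ψ ^ (-3 / 2)`. -/
def cltRate (θ L : ℝ) : ℝ := (√(sqLogSum (1 + 2 * L ^ (-θ))) ^ 3)⁻¹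

lemma exists_eventually_norm_planeCharFun_sub_le (hθ0 : 0 < θ) (hθ1 : θ < 1 / 2) :
    ∃ C : ℝ, 0 < C ∧ ∀ᶠ L : ℝ in atTop, ∀ ξ : ℂ, ‖ξ‖ ≤ (cltRate θ L ^ 3)⁻¹ →
      ‖planeCharFun (primePolyLaw θ L) ξ - planeCharFun planeGaussian ξ‖
        ≤ C * cltRate θ L * ‖ξ‖ ^ 3 * Real.exp (-(1 / (32 * π) * ‖ξ‖ ^ 2))
          + cltRate θ L ^ 5 := by
  obtain ⟨C, hC0, hC⟩ := exists_eventually_norm_charFun_primePoly_sub_exp_le hθ0 hθ1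
  refine ⟨C, hC0, ?_⟩
  filter_upwards [hC, (tendsto_sqLogSum_atTop hθ0 hθ1).eventually_ge_atTop 1] with L h hψ ξ hξ
  rw [planeCharFun_primePolyLaw, planeCharFun_planeGaussian]
  rw [cltRate] at hξ ⊢
  set ψ := sqLogSum (1 + 2 * L ^ (-θ))
  have hπ := Real.pi_pos
  have hsψ : √ψ ^ 2 = ψ := Real.sq_sqrt (by linarith)
  set s := √ψ with hs
  have hs1 : 1 ≤ s := Real.one_le_sqrt.2 hψ
  have hπ1 : 1 ≤ √π := Real.one_le_sqrt.2 (by linarith [Real.pi_gt_three])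
  have hw : ‖(√(π * ψ))⁻¹ • ξ‖ = ‖ξ‖ / (√π * s) := by
    rw [norm_smul, norm_inv, Real.norm_of_nonneg (Real.sqrt_nonneg _), Real.sqrt_mul hπ.le,
      inv_mul_eq_div]
  have hw2 : ‖(√(π * ψ))⁻¹ • ξ‖ ^ 2 * ψ = ‖ξ‖ ^ 2 / π := by
    rw [hw, div_pow, mul_pow, Real.sq_sqrt hπ.le, ← hsψ]
    field_simp
  have hws : ‖(√(π * ψ))⁻¹ • ξ‖ ≤ ‖ξ‖ / s := by
    rw [hw]
    exact div_le_div_of_nonneg_left (norm_nonneg _) (by positivity)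
      (le_mul_of_one_le_left (by positivity) hπ1)
  have h1 := h ((√(π * ψ))⁻¹ • ξ) (hws.trans (by
    rw [div_le_iff₀ (by positivity), ← hsψ]
    refine hξ.trans_eq ?_
    field_simp))
  rw [hw2] at h1
  rw [show -‖ξ‖ ^ 2 / (4 * π) = -(‖ξ‖ ^ 2 / π / 4) by field_simp]
  refine h1.trans (add_le_add ?_ ?_)
  · rw [show 1 / (32 * π) * ‖ξ‖ ^ 2 = ‖ξ‖ ^ 2 / π / 32 by field_simp, mul_assoc C (s ^ 3)⁻¹]
    gcongr
    calc _ ≤ (‖ξ‖ / s) ^ 3 := by gcongr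
      _ = _ := by rw [div_pow, div_eq_inv_mul]
  · rw [inv_pow, ← hsψ, ← pow_mul, ← pow_mul]
    exact inv_anti₀ (by positivity) (pow_le_pow_right₀ hs1 (by norm_num))

lemma abs_measureReal_div_sub_planeGaussian_le {T κ K β a b c d : ℝ} (hT : 0 < T) (hκ : 0 < κ)
    (hκ1 : κ ≤ 1) (hab : 6 * κ ≤ b - a) (hcd : 6 * κ ≤ d - c) {X : ℝ → ℂ} (hX : Measurable X)
    (h1 : ((timeMeasure T).map X).real (planeRect (a - κ) (b + κ) (c - κ) (d + κ))
      ≤ planeGaussian.real (planeRect (a - 3 * κ) (b + 3 * κ) (c - 3 * κ) (d + 3 * κ)) + K * κ)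
    (h2 : planeGaussian.real (planeRect (a + 3 * κ) (b - 3 * κ) (c + 3 * κ) (d - 3 * κ))
      ≤ ((timeMeasure T).map X).real (planeRect (a + κ) (b - κ) (c + κ) (d - κ)) + K * κ)
    {E N : Set ℝ} (hE : E ⊆ Set.Icc T (2 * T)) (hN : volume N ≤ ENNReal.ofReal (β * T))
    (hβ : 0 ≤ β)
    (hupper : ∀ t ∈ E, t ∉ N → X t ∈ planeRect (a - κ) (b + κ) (c - κ) (d + κ))
    (hlower : ∀ t ∈ Set.Icc T (2 * T), t ∉ N →
      X t ∈ planeRect (a + κ) (b - κ) (c + κ) (d - κ) → t ∈ E) :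
    |volume.real E / T - planeGaussian.real (planeRect a b c d)|
      ≤ (6 * (b - a + (d - c)) + 36 + K) * κ + β := by
  have hNfin : volume N ≠ ⊤ := ne_top_of_le_ne_top (by finiteness) hN
  have hEfin : volume E ≠ ⊤ := measure_ne_top_of_subset hE (by simp)
  have hNreal : volume.real N ≤ β * T := ENNReal.toReal_le_of_le_ofReal (by positivity) hN
  have hμ : ∀ p p' q q' : ℝ, ((timeMeasure T).map X).real (planeRect p p' q q')
      = volume.real (X ⁻¹' planeRect p p' q q' ∩ Set.Icc T (2 * T)) / T := fun p p' q q' => by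
    rw [map_measureReal_apply hX (measurableSet_planeRect p p' q q'),
      measureReal_timeMeasure hT (hX (measurableSet_planeRect p p' q q'))]
  have hfin : ∀ S : Set ℝ, volume (S ∩ Set.Icc T (2 * T)) ≠ ⊤ := fun S =>
    measure_ne_top_of_subset Set.inter_subset_right (by simp)
  rw [hμ] at h1 h2
  have hu : volume.real E ≤ volume.real
      (X ⁻¹' planeRect (a - κ) (b + κ) (c - κ) (d + κ) ∩ Set.Icc T (2 * T)) + β * T := by
    refine (measureReal_mono (fun t ht => ?_) (measure_union_ne_top (hfin _) hNfin)).trans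
      ((measureReal_union_le _ N).trans (by gcongr))
    by_cases htN : t ∈ N
    · exact Or.inr htN
    · exact Or.inl ⟨hupper t ht htN, hE ht⟩
  have hl : volume.real (X ⁻¹' planeRect (a + κ) (b - κ) (c + κ) (d - κ) ∩ Set.Icc T (2 * T))
      ≤ volume.real E + β * T := by
    refine (measureReal_mono (fun t ht => ?_) (measure_union_ne_top hEfin hNfin)).trans
      ((measureReal_union_le _ N).trans (by gcongr))
    by_cases htN : t ∈ N
    · exact Or.inr htN
    · exact Or.inl (hlower t ht.2 htN ht.1)
  have hu' : volume.real E / T ≤ volume.real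
      (X ⁻¹' planeRect (a - κ) (b + κ) (c - κ) (d + κ) ∩ Set.Icc T (2 * T)) / T + β := by
    rw [div_add' _ _ _ hT.ne']
    gcongr
  have hl' : volume.real
      (X ⁻¹' planeRect (a + κ) (b - κ) (c + κ) (d - κ) ∩ Set.Icc T (2 * T)) / T
      ≤ volume.real E / T + β := by
    rw [div_add' _ _ _ hT.ne']
    gcongr
  have g1 := planeGaussian_real_planeRect_le (a := a) (b := b) (c := c) (d := d) (t := 3 * κ)
    (by linarith) (by linarith) (by positivity)
  have g2 := planeGaussian_real_planeRect_le (a := a + 3 * κ) (b := b - 3 * κ) (c := c + 3 * κ)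
    (d := d - 3 * κ) (t := 3 * κ) (by linarith) (by linarith) (by positivity)
  simp only [add_sub_cancel_right, sub_add_cancel] at g2
  rw [abs_le]
  constructor <;> nlinarith

theorem exists_eventually_abs_measureReal_sub_le (hθ0 : 0 < θ) (hθ1 : θ < 1 / 2) {a b c d : ℝ}
    (hab : a < b) (hcd : c < d) : ∃ C : ℝ, 0 < C ∧ ∀ᶠ L : ℝ in atTop,
      |volume.real {t : ℝ | t ∈ Set.Icc (Real.exp L) (2 * Real.exp L) ∧ ∃ z : ℂ,
            logZetaRay (1 / 2 + L ^ (-θ)) t z ∧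
            z.re / √(π * sqLogSum (1 + 2 * L ^ (-θ))) ∈ Set.Icc a b ∧
            z.im / √(π * sqLogSum (1 + 2 * L ^ (-θ))) ∈ Set.Icc c d} / Real.exp L
        - planeGaussian.real (planeRect a b c d)| ≤ C * cltRate θ L := by
  have hπ := Real.pi_pos
  obtain ⟨C, hC0, hC⟩ := exists_eventually_norm_planeCharFun_sub_le hθ0 hθ1
  set W := b - a + (d - c) with hW
  set K := (C * (1 + 8 / (1 / (32 * π)) ^ 2) * (2 * π / (1 / (32 * π))) + 3074 * π)
    * (W + 2 + 2) ^ 2 + 1536 with hK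
  have hW0 : 0 < W := by linarith
  refine ⟨6 * W + 36 + K + 2, by positivity, ?_⟩
  have hrate : Tendsto (fun L => cltRate θ L) atTop (nhds 0) :=
    tendsto_inv_atTop_zero.comp ((tendsto_pow_atTop (by norm_num)).comp
      (Real.tendsto_sqrt_atTop.comp (tendsto_sqLogSum_atTop hθ0 hθ1)))
  filter_upwards [hC, (tendsto_sqLogSum_atTop hθ0 hθ1).eventually_ge_atTop 6,
    eventually_sqLogSum_pow_le hθ0 hθ1 2, eventually_volume_not_logZetaRay_le hθ0 hθ1,
    hrate.eventually_le_const one_pos,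
    hrate.eventually_le_const (show 0 < (b - a) / 6 by linarith),
    hrate.eventually_le_const (show 0 < (d - c) / 6 by linarith),
    eventually_gt_atTop 0] with L hφ hψ6 hψL hbad hκ1 hκa hκc hL
  have := isProbabilityMeasure_primePolyLaw θ L
  set κ := cltRate θ L with hκ
  rw [cltRate] at hκ
  set ψ := sqLogSum (1 + 2 * L ^ (-θ))
  have hsψ : √ψ ^ 2 = ψ := Real.sq_sqrt (by linarith)
  set s := √ψ with hs
  have hs1 : 1 ≤ s := Real.one_le_sqrt.2 (by linarith)
  have hκ0 : 0 < κ := by rw [hκ]; positivity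
  have hLs : L⁻¹ ≤ (s ^ 4)⁻¹ := inv_anti₀ (by positivity) (by
    rw [← hsψ, ← pow_mul] at hψL
    exact hψL)
  have hLκ : 2 / L ≤ 2 * κ := by
    rw [div_eq_mul_inv, hκ]
    exact mul_le_mul_of_nonneg_left (hLs.trans (inv_anti₀ (by positivity)
      (pow_le_pow_right₀ hs1 (by norm_num)))) zero_le_two
  set R := √(π * ψ) with hR
  have hRs : s ≤ R := Real.sqrt_le_sqrt (le_mul_of_one_le_left (by linarith)
    (by linarith [Real.pi_gt_three]))
  have hR0 : 0 < R := by linarith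
  have hshift : 6 / L / R ≤ κ := by
    rw [div_le_iff₀ hR0]
    calc 6 / L = 6 * L⁻¹ := div_eq_mul_inv _ _
      _ ≤ s ^ 2 * (s ^ 4)⁻¹ := by
          rw [hsψ]
          gcongr
      _ = κ * s := by
          rw [hκ]
          field_simp
      _ ≤ κ * R := by gcongr
  have hclose : ∀ t z, ‖z - primePoly (cutY L) (1 / 2 + L ^ (-θ)) t‖ ≤ 6 / L →
      |z.re / R - (primePoly (cutY L) (1 / 2 + L ^ (-θ)) t / R).re| ≤ κ ∧
      |z.im / R - (primePoly (cutY L) (1 / 2 + L ^ (-θ)) t / R).im| ≤ κ := by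
    intro t z hz
    have h1 : ‖(z - primePoly (cutY L) (1 / 2 + L ^ (-θ)) t) / R‖ ≤ κ := by
      rw [norm_div, Complex.norm_real, Real.norm_of_nonneg hR0.le]
      exact le_trans (by gcongr) hshift
    rw [← Complex.div_ofReal_re z, ← Complex.div_ofReal_im z, ← Complex.sub_re,
      ← Complex.sub_im, ← sub_div]
    exact ⟨(Complex.abs_re_le_norm _).trans h1, (Complex.abs_im_le_norm _).trans h1⟩
  have hb : 0 < 1 / (32 * π) := by positivity
  have hfinal := abs_measureReal_div_sub_planeGaussian_le (T := Real.exp L) (κ := κ) (K := K)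
    (β := 2 / L) (a := a) (b := b) (c := c) (d := d) (Real.exp_pos L) hκ0 hκ1 (by linarith)
    (by linarith) (X := fun t => primePoly (cutY L) (1 / 2 + L ^ (-θ)) t / R)
    ((measurable_primePoly _ _).div_const _)
    (by
      have := measureReal_planeRect_le_add hC0.le hb hκ0 hκ1 (primePolyLaw θ L) planeGaussian hφ
        (M := W + 2) (x := a - κ) (x' := b + κ) (y := c - κ) (y' := d + κ)
        (by linarith) (by linarith) (by linarith) (by linarith)
      rwa [show a - κ - 2 * κ = a - 3 * κ by ring, show b + κ + 2 * κ = b + 3 * κ by ring,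
        show c - κ - 2 * κ = c - 3 * κ by ring, show d + κ + 2 * κ = d + 3 * κ by ring] at this)
    (by
      have := measureReal_planeRect_le_add hC0.le hb hκ0 hκ1 planeGaussian (primePolyLaw θ L)
        (fun ξ hξ => by rw [norm_sub_rev]; exact hφ ξ hξ)
        (M := W + 2) (x := a + 3 * κ) (x' := b - 3 * κ) (y := c + 3 * κ) (y' := d - 3 * κ)
        (by linarith) (by linarith) (by linarith) (by linarith)
      rwa [show a + 3 * κ - 2 * κ = a + κ by ring, show b - 3 * κ + 2 * κ = b - κ by ring,
        show c + 3 * κ - 2 * κ = c + κ by ring, show d - 3 * κ + 2 * κ = d - κ by ring] at this)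
    (E := {t : ℝ | t ∈ Set.Icc (Real.exp L) (2 * Real.exp L) ∧ ∃ z : ℂ,
      logZetaRay (1 / 2 + L ^ (-θ)) t z ∧ z.re / R ∈ Set.Icc a b ∧ z.im / R ∈ Set.Icc c d})
    (fun t ht => ht.1) (hbad.trans_eq (by rw [mul_div_right_comm])) (by positivity)
    (fun t ht htN => by
      obtain ⟨hTt, z, hz, ⟨h1, h2⟩, h3, h4⟩ := ht
      obtain ⟨w, hw, hwP⟩ : ∃ z, logZetaRay (1 / 2 + L ^ (-θ)) t z ∧
          ‖z - primePoly (cutY L) (1 / 2 + L ^ (-θ)) t‖ ≤ 6 / L := by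
        by_contra h
        exact htN ⟨hTt, h⟩
      obtain rfl := logZetaRay_unique hz hw
      obtain ⟨h5, h6⟩ := hclose t z hwP
      rw [abs_le] at h5 h6
      exact ⟨⟨by linarith, by linarith⟩, by linarith, by linarith⟩)
    (fun t hTt htN ht => by
      obtain ⟨w, hw, hwP⟩ : ∃ z, logZetaRay (1 / 2 + L ^ (-θ)) t z ∧
          ‖z - primePoly (cutY L) (1 / 2 + L ^ (-θ)) t‖ ≤ 6 / L := by
        by_contra h
        exact htN ⟨hTt, h⟩
      obtain ⟨⟨h1, h2⟩, h3, h4⟩ := ht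
      obtain ⟨h5, h6⟩ := hclose t w hwP
      rw [abs_le] at h5 h6
      exact ⟨hTt, w, hw, ⟨by linarith, by linarith⟩, by linarith, by linarith⟩)
  linarith

lemma eventually_cltRate_le (hθ0 : 0 < θ) (hθ1 : θ < 1 / 2) : ∀ᶠ L : ℝ in atTop,
    cltRate θ L ≤ (√(θ / 4) ^ 3)⁻¹ * (1 / Real.log L ^ ((3 : ℝ) / 2)) := by
  filter_upwards [eventually_sqLogSum_bounds hθ0 hθ1, eventually_gt_atTop 1] with L hψ hL
  have hlog := Real.log_pos hL
  rw [show Real.log L ^ ((3 : ℝ) / 2) = √(Real.log L) ^ 3 by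
      rw [Real.sqrt_eq_rpow, ← Real.rpow_natCast, ← Real.rpow_mul hlog.le]
      norm_num, one_div, ← mul_inv, ← mul_pow, ← Real.sqrt_mul (by positivity), cltRate]
  gcongr
  exact hψ.1

end

/-- **Selberg's central limit theorem near the critical line, with error term.**
For `0 < θ < 1/2` and real `a < b`, `c < d`, as `T → ∞`,
`(1/T) meas{t ∈ [T,2T] : log ζ(σ_T+it)/√(πψ_T) ∈ [a,b]×[c,d]}
  = ∫_c^d ∫_a^b e^{-π(x²+y²)} dx dy + O(1/(log log T)^{3/2})`. -/
theorem selberg_clt_near_critical_line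
    (θ : ℝ) (hθ0 : 0 < θ) (hθ1 : θ < 1 / 2)
    (a b c d : ℝ) (hab : a < b) (hcd : c < d) :
    (fun T : ℝ =>
        (MeasureTheory.volume {t : ℝ | t ∈ Set.Icc T (2 * T) ∧ ∃ z : ℂ,
            logZetaRay (sigmaT θ T) t z ∧
            z.re / Real.sqrt (π * psiT θ T) ∈ Set.Icc a b ∧
            z.im / Real.sqrt (π * psiT θ T) ∈ Set.Icc c d}).toReal / T
        - ∫ y in c..d, ∫ x in a..b, Real.exp (-π * (x ^ 2 + y ^ 2)))
      =O[atTop] (fun T : ℝ => 1 / Real.log (Real.log T) ^ ((3 : ℝ) / 2)) := by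
  obtain ⟨C, hC0, hC⟩ := exists_eventually_abs_measureReal_sub_le hθ0 hθ1 hab hcd
  refine IsBigO.of_bound (C * (√(θ / 4) ^ 3)⁻¹) ?_
  filter_upwards [Real.tendsto_log_atTop.eventually (hC.and (eventually_cltRate_le hθ0 hθ1)),
    Real.tendsto_log_atTop.eventually_gt_atTop 1, eventually_gt_atTop 0] with T h hL hT
  obtain ⟨h, hrate⟩ := h
  have hσ : 1 / 2 < sigmaT θ T :=
    lt_add_of_pos_right _ (Real.rpow_pos_of_pos (zero_lt_one.trans hL) _)
  have hloglog := Real.log_pos hL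
  rw [Real.exp_log hT, planeGaussian_real_planeRect hab.le hcd.le] at h
  rw [psiT_eq_sqLogSum hσ, sigmaT, mul_add, mul_one_div_cancel two_ne_zero, Real.norm_eq_abs,
    Real.norm_of_nonneg (by positivity), mul_assoc]
  exact h.trans (by gcongr)
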